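/- Let R be a local Gorenstein ring with infinite residue field and let E be a finitely generated R-module of projective dimension 1. Write e = rank E and ℓ = ℓ(E) for the analytic spread of E, and assume that E satisfies condition G_{ℓ−e+1} and is torsionfree locally in codimension 1. If the Rees algebra 𝓡(E) is Cohen–Macaulay, then for any minimal reduction U of E one has U · 𝓡(E)_t :_E 𝓡(E)_t = U for 0 ≤ t ≤ ℓ − e − 1. -/

import Mathlib

set_option synthInstance.maxHeartbeats 2000000
set_option maxHeartbeats 2000000

noncomputable section

open IsLocalRing

universe u

/-- The minimal number of generators of a module, as an extended natural number. -/
noncomputable def mu (R M : Type*) [CommRing R] [AddCommGroup M] [Module R M] : ℕ∞ :=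
  sInf {n : ℕ∞ | ∃ s : Finset M, (s.card : ℕ∞) = n ∧ Submodule.span R (s : Set M) = ⊤}

/-- The Krull dimension of the localization `R_p`, i.e. the height of the prime `p`. -/
noncomputable def dimAt {R : Type*} [CommRing R] (p : Ideal R) (hp : p.IsPrime) : WithBot ℕ∞ :=
  haveI := hp
  ringKrullDim (Localization.AtPrime p)

/-- The grade of an ideal: the supremum of the lengths of regular sequences contained in it. -/
noncomputable def idealGrade {R : Type*} [CommRing R] (I : Ideal R) : ℕ∞ :=
  sSup {n : ℕ∞ | ∃ l : List R, (∀ x ∈ l, x ∈ I) ∧ RingTheory.Sequence.IsRegular R l ∧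
    (l.length : ℕ∞) = n}

/-- A local ring is Cohen--Macaulay if its depth (the grade of the maximal ideal)
equals its Krull dimension. -/
def IsCohenMacaulayLocalRing (R : Type*) [CommRing R] [IsLocalRing R] : Prop :=
  (idealGrade (maximalIdeal R) : WithBot ℕ∞) = ringKrullDim R

/-- A (not necessarily local) ring is Cohen--Macaulay if all of its localizations at
primes are Cohen--Macaulay local rings. -/
def IsCohenMacaulayRing (A : Type*) [CommRing A] : Prop :=
  ∀ (p : Ideal A) (hp : p.IsPrime),
    haveI := hp
    IsCohenMacaulayLocalRing (Localization.AtPrime p)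

/-- A local ring is Gorenstein if it is Cohen--Macaulay and some maximal regular sequence
(i.e. a regular sequence of length `dim R` inside the maximal ideal) generates an
irreducible ideal. -/
def IsGorensteinLocalRing (R : Type*) [CommRing R] [IsLocalRing R] : Prop :=
  IsCohenMacaulayLocalRing R ∧
  ∃ l : List R, (∀ x ∈ l, x ∈ maximalIdeal R) ∧ RingTheory.Sequence.IsRegular R l ∧
    ((l.length : ℕ∞) : WithBot ℕ∞) = ringKrullDim R ∧
    ∀ J K : Ideal R, J ⊓ K = Ideal.ofList l → (J = Ideal.ofList l ∨ K = Ideal.ofList l)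

section ReesAlgebraOfModule

variable {R : Type u} [CommRing R] {E : Type u} [AddCommGroup E] [Module R E]

/-- Given a module `E` of rank `e`, witnessed by a trivialization `b` of
`E ⊗ Q` (where `Q = Frac(R)` is the total ring of quotients of `R`), this is the
canonical map from `E` to `Q[X_1, ..., X_e]`, the symmetric algebra of `E ⊗ Q`.
Since `E` has a rank, the `R`-torsion of the symmetric algebra `𝓢(E)` is exactly
the kernel of the natural map `𝓢(E) → 𝓢(E) ⊗ Q = 𝓢_Q(E ⊗ Q)`, so the Rees algebra
`𝓡(E) = 𝓢(E)/(R-torsion)` is the `R`-subalgebra of `Q[X_1, ..., X_e]` generated by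
the image of `E`, and its graded components are spanned by products of images of
elements of `E`. -/
noncomputable def reesMap (e : ℕ)
    (b : LocalizedModule (nonZeroDivisors R) E ≃ₗ[FractionRing R] (Fin e → FractionRing R))
    (x : E) : MvPolynomial (Fin e) (FractionRing R) :=
  ∑ i, MvPolynomial.C (b (LocalizedModule.mkLinearMap (nonZeroDivisors R) E x) i) *
    MvPolynomial.X i

/-- The degree `t` graded component `𝓡(E)_t` of the Rees algebra of `E`, as an
`R`-submodule of `Q[X_1, ..., X_e]`:  the span of products of `t` elements of
(the image of) `E`. -/
noncomputable def reesComponent (e : ℕ)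
    (b : LocalizedModule (nonZeroDivisors R) E ≃ₗ[FractionRing R] (Fin e → FractionRing R))
    (t : ℕ) : Submodule R (MvPolynomial (Fin e) (FractionRing R)) :=
  (Submodule.span R (Set.range (reesMap e b))) ^ t

/-- The Rees algebra `𝓡(E)` of `E`: the `R`-subalgebra of `Q[X_1, ..., X_e]`
generated by the image of `E`. -/
noncomputable def reesAlgebraOfModule (e : ℕ)
    (b : LocalizedModule (nonZeroDivisors R) E ≃ₗ[FractionRing R] (Fin e → FractionRing R)) :
    Subalgebra R (MvPolynomial (Fin e) (FractionRing R)) :=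
  Algebra.adjoin R (Set.range (reesMap e b))

/-- A submodule `U ⊆ E` is a reduction of `E` if `𝓡(E)_{r+1} = U ⬝ 𝓡(E)_r` for all
large `r`. -/
def IsReductionOfModule (e : ℕ)
    (b : LocalizedModule (nonZeroDivisors R) E ≃ₗ[FractionRing R] (Fin e → FractionRing R))
    (U : Submodule R E) : Prop :=
  ∃ N : ℕ, ∀ r : ℕ, N ≤ r →
    Submodule.span R (reesMap e b '' (U : Set E)) * reesComponent e b r =
      reesComponent e b (r + 1)

/-- A minimal reduction of `E` is a reduction minimal with respect to containment. -/
def IsMinimalReductionOfModule (e : ℕ)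
    (b : LocalizedModule (nonZeroDivisors R) E ≃ₗ[FractionRing R] (Fin e → FractionRing R))
    (U : Submodule R E) : Prop :=
  IsReductionOfModule e b U ∧
    ∀ U' : Submodule R E, U' ≤ U → IsReductionOfModule e b U' → U' = U

/-- The analytic spread `ℓ(E)` of `E`: the Krull dimension of the special fiber ring
`𝓡(E) ⊗ R/m` of the Rees algebra of `E`. -/
noncomputable def analyticSpreadOfModule [IsLocalRing R] (e : ℕ)
    (b : LocalizedModule (nonZeroDivisors R) E ≃ₗ[FractionRing R] (Fin e → FractionRing R)) :
    WithBot ℕ∞ :=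
  letI A := reesAlgebraOfModule e b
  letI : CommRing ↥A := inferInstance
  letI : HasQuotient ↥A (Ideal ↥A) := Submodule.hasQuotient
  ringKrullDim (↥A ⧸ Ideal.map (algebraMap R ↥A) (maximalIdeal R))

end ReesAlgebraOfModule

section ExtTorsion

open CategoryTheory Abelian

variable {R : Type u} [CommRing R]

/-- `Ext^i(N, X)` is torsion with respect to the multiplicative set `P` for all `i < g`. -/
def ExtTorsionLT (P : Submonoid R) (N : Type u) [AddCommGroup N] [Module R N] (g : ℕ)
    (X : Type u) [AddCommGroup X] [Module R X] : Prop :=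
  ∀ i < g, ∀ ξ : Ext (ModuleCat.of R N) (ModuleCat.of R X) i, ∃ s ∈ P, s • ξ = 0

variable {P : Submonoid R} {N : Type u} [AddCommGroup N] [Module R N]
  {X Y Z : Type u} [AddCommGroup X] [Module R X] [AddCommGroup Y] [Module R Y]
  [AddCommGroup Z] [Module R Z]

lemma ExtTorsionLT.mono {g g' : ℕ} (h : ExtTorsionLT P N g X) (hg : g' ≤ g) :
    ExtTorsionLT P N g' X := fun i hi => h i (hi.trans_le hg)

lemma ExtTorsionLT.of_subsingleton {g : ℕ}
    (h : ∀ i < g, Subsingleton (Ext (ModuleCat.of R N) (ModuleCat.of R X) i)) :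
    ExtTorsionLT P N g X := fun i hi ξ => ⟨1, P.one_mem, by
  have := h i hi
  exact Subsingleton.elim _ _⟩

lemma ExtTorsionLT.of_exact {g : ℕ} {f : X →ₗ[R] Y} {q : Y →ₗ[R] Z}
    (hf : Function.Injective f) (hq : Function.Surjective q) (hfq : Function.Exact f q)
    (hX : ExtTorsionLT P N (g + 1) X) (hY : ExtTorsionLT P N g Y) :
    ExtTorsionLT P N g Z := by
  intro i hi ξ
  let S := ModuleCat.shortComplexOfCompEqZero f q hfq.linearMap_comp_eq_zero
  have hS : S.ShortExact :=
    { exact := ModuleCat.shortComplex_exact _ hfq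
      mono_f := by
        simpa [S, ModuleCat.shortComplexOfCompEqZero, ModuleCat.mono_iff_injective] using! hf
      epi_g := by
        simpa [S, ModuleCat.shortComplexOfCompEqZero, ModuleCat.epi_iff_surjective] using! hq }
  obtain ⟨s, hs, h⟩ := hX (i + 1) (by omega) (Ext.comp (Z := S.X₁) ξ hS.extClass rfl)
  obtain ⟨η, hη⟩ := Ext.covariant_sequence_exact₃ _ hS (s • ξ) rfl
    (by rw [Ext.smul_comp]; exact h)
  obtain ⟨s', hs', h'⟩ := hY i hi η
  refine ⟨s' * s, P.mul_mem hs' hs, ?_⟩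
  have h2 : s' • (s • ξ) = 0 := by
    rw [← hη, ← Ext.smul_comp]
    erw [h']
    rw [Ext.zero_comp]
  rw [mul_smul]; exact h2

lemma ExtTorsionLT.of_comp_eq_smul {g : ℕ} (f : X →ₗ[R] Y) (q : Y →ₗ[R] X) {s : R} (hs : s ∈ P)
    (hfq : ∀ x, q (f x) = s • x) (hY : ExtTorsionLT P N g Y) : ExtTorsionLT P N g X := by
  intro i hi ξ
  obtain ⟨s', hs', h'⟩ := hY i hi (ξ.comp (Ext.mk₀ (ModuleCat.ofHom f)) (add_zero i))
  refine ⟨s' * s, P.mul_mem hs' hs, ?_⟩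
  have h2 : s • ξ = (ξ.comp (Ext.mk₀ (ModuleCat.ofHom f)) (add_zero i)).comp
      (Ext.mk₀ (ModuleCat.ofHom q)) (add_zero i) := by
    rw [Ext.comp_assoc_of_third_deg_zero, Ext.mk₀_comp_mk₀, Ext.smul_eq_comp_mk₀]
    congr 2
    ext x
    simp [hfq]
  rw [mul_smul, h2, ← Ext.smul_comp, h', Ext.zero_comp]

lemma ExtTorsionLT.of_linearEquiv {g : ℕ} (f : X ≃ₗ[R] Y) (hY : ExtTorsionLT P N g Y) :
    ExtTorsionLT P N g X :=
  hY.of_comp_eq_smul f.toLinearMap f.symm.toLinearMap P.one_mem (by simp)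

lemma ExtTorsionLT.of_exact_middle {g : ℕ} {f : X →ₗ[R] Y} {q : Y →ₗ[R] Z}
    (hf : Function.Injective f) (hq : Function.Surjective q) (hfq : Function.Exact f q)
    (hX : ExtTorsionLT P N g X) (hZ : ExtTorsionLT P N g Z) :
    ExtTorsionLT P N g Y := by
  intro i hi ξ
  let S := ModuleCat.shortComplexOfCompEqZero f q hfq.linearMap_comp_eq_zero
  have hS : S.ShortExact :=
    { exact := ModuleCat.shortComplex_exact _ hfq
      mono_f := by
        simpa [S, ModuleCat.shortComplexOfCompEqZero, ModuleCat.mono_iff_injective] using! hf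
      epi_g := by
        simpa [S, ModuleCat.shortComplexOfCompEqZero, ModuleCat.epi_iff_surjective] using! hq }
  obtain ⟨s, hs, h⟩ := hZ i hi (Ext.comp (Z := S.X₃) ξ (Ext.mk₀ S.g) (add_zero i))
  obtain ⟨η, hη⟩ := Ext.covariant_sequence_exact₂ _ hS (s • ξ)
    (by rw [Ext.smul_comp]; exact h)
  obtain ⟨s', hs', h'⟩ := hX i hi η
  refine ⟨s' * s, P.mul_mem hs' hs, ?_⟩
  have h2 : s' • (s • ξ) = 0 := by
    rw [← hη, ← Ext.smul_comp]
    erw [h']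
    rw [Ext.zero_comp]
  rw [mul_smul]; exact h2

lemma ExtTorsionLT.of_free {g : ℕ} (h : ExtTorsionLT P N g R) [Module.Free R X]
    [Module.Finite R X] : ExtTorsionLT P N g X := by
  have key : ∀ n : ℕ, ExtTorsionLT P N g (Fin n → R) := by
    intro n
    induction n with
    | zero =>
      refine ExtTorsionLT.of_comp_eq_smul (0 : (Fin 0 → R) →ₗ[R] R) 0 P.one_mem ?_ h
      intro x
      exact Subsingleton.elim _ _
    | succ n ih =>
      refine ExtTorsionLT.of_exact_middle (f := LinearMap.single R (fun _ : Fin (n + 1) => R) 0)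
        (q := LinearMap.funLeft R R Fin.succ) ?_ ?_ ?_ h ih
      · exact Pi.single_injective (M := fun _ : Fin (n + 1) => R) 0
      · exact LinearMap.funLeft_surjective_of_injective R R _ (Fin.succ_injective n)
      · intro x
        constructor
        · intro hx
          refine ⟨x 0, ?_⟩
          ext i
          refine Fin.cases (by simp) (fun j => ?_) i
          have := congrFun hx j
          simpa [LinearMap.funLeft_apply] using this.symm
        · rintro ⟨y, rfl⟩
          ext j
          simp [LinearMap.funLeft_apply]
  let b := Module.Free.chooseBasis R X
  exact (key _).of_linearEquiv (b.reindex (Fintype.equivFin _)).equivFun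

lemma ExtTorsionLT.exists_smul_eq_zero {g : ℕ} (hX : ExtTorsionLT P N g X) (hg : 0 < g)
    (φ : N →ₗ[R] X) : ∃ s ∈ P, s • φ = 0 := by
  obtain ⟨s, hs, h⟩ := hX 0 hg (Ext.mk₀ (ModuleCat.ofHom φ))
  refine ⟨s, hs, ?_⟩
  rw [← Ext.mk₀_smul] at h
  have := (Ext.mk₀_eq_zero_iff _).1 h
  ext x
  simpa using congrArg (fun t => t.hom x) this

/-- If `Ext^i(R/I, X)` vanishes (up to torsion) for `i < 1`, then an element of `X` killed by `I` is
killed by an element of `P`. -/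
lemma ExtTorsionLT.exists_smul_eq_zero_of_quotient {I : Ideal R} {g : ℕ}
    (hX : ExtTorsionLT P (R ⧸ I) g X) (hg : 0 < g) (x : X) (hx : ∀ a ∈ I, a • x = 0) :
    ∃ s ∈ P, s • x = 0 := by
  obtain ⟨s, hs, h⟩ := hX.exists_smul_eq_zero hg
    (Submodule.liftQ I (LinearMap.toSpanSingleton R X x) (fun a ha => by simpa using hx a ha))
  refine ⟨s, hs, ?_⟩
  have h1 := LinearMap.congr_fun h (Submodule.Quotient.mk (p := I) 1)
  rwa [LinearMap.smul_apply, Submodule.liftQ_apply,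
    LinearMap.toSpanSingleton_apply, one_smul] at h1

/-- Elements of `X` multiplied by `I` into a submodule `B` lie in `B`, provided that
`Hom(R/I, X) = 0` and `Ext^1(R/I, B) = 0`. -/
lemma ExtTorsionLT.mem_of_forall_smul_mem {I : Ideal R} {g : ℕ} (B : Submodule R X)
    (hB : ExtTorsionLT (⊥ : Submonoid R) (R ⧸ I) (g + 2) B)
    (hX : ExtTorsionLT (⊥ : Submonoid R) (R ⧸ I) (g + 1) X) (x : X) (hx : ∀ a ∈ I, a • x ∈ B) :
    x ∈ B := by
  have h := (ExtTorsionLT.of_exact B.injective_subtype B.mkQ_surjective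
    (LinearMap.exact_subtype_mkQ B) hB hX)
  obtain ⟨s, hs, h⟩ := h.exists_smul_eq_zero_of_quotient (by omega) (B.mkQ x)
    (fun a ha => by
      rw [← map_smul, Submodule.mkQ_apply, Submodule.Quotient.mk_eq_zero]; exact hx a ha)
  rw [Submonoid.mem_bot] at hs
  subst hs
  simpa using h

end ExtTorsion

section GradeHeight

open CategoryTheory Abelian

variable {R : Type u} [CommRing R]

lemma subsingleton_ext_of_forall_mem_support [IsNoetherianRing R] (X : ModuleCat.{u} R) (i : ℕ)
    (N : Type u) [AddCommGroup N] [Module R N] [hfin : Module.Finite R N]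
    (h : ∀ p ∈ Module.support R N,
      Subsingleton (Ext (ModuleCat.of R (R ⧸ p.asIdeal)) X i)) :
    Subsingleton (Ext (ModuleCat.of R N) X i) := by
  induction hfin using IsNoetherianRing.induction_on_isQuotientEquivQuotientPrime R with
  | subsingleton N =>
    have : Limits.IsZero (ModuleCat.of R N) := ModuleCat.isZero_of_subsingleton _
    refine ⟨fun a b => ?_⟩
    rw [← Ext.mk₀_id_comp a, ← Ext.mk₀_id_comp b, this.eq_zero_of_src (𝟙 _)]
    simp
  | quotient N p φ =>
    have hp : p ∈ Module.support R N := by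
      rw [φ.support_eq, Module.support_eq_zeroLocus, Ideal.annihilator_quotient]
      exact fun x hx => hx
    have := h p hp
    refine ⟨fun a b => ?_⟩
    have key : ∀ a : Ext (ModuleCat.of R N) X i, a =
        (Ext.mk₀ φ.toModuleIso.hom).comp
          ((Ext.mk₀ φ.toModuleIso.inv).comp a (zero_add i)) (zero_add i) := by
      intro a
      rw [Ext.mk₀_comp_mk₀_assoc, Iso.hom_inv_id, Ext.mk₀_id_comp]
    rw [key a, key b, Subsingleton.elim ((Ext.mk₀ φ.toModuleIso.inv).comp a (zero_add i))]
  | exact N₁ N₂ N₃ f q hf hq hfq h₁ h₃ =>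
    have hs := Module.support_of_exact hfq hf hq
    have h1 := h₁ (fun p hp => h p (hs ▸ Or.inl hp))
    have h3 := h₃ (fun p hp => h p (hs ▸ Or.inr hp))
    let S := ModuleCat.shortComplexOfCompEqZero f q hfq.linearMap_comp_eq_zero
    have hS : S.ShortExact :=
      { exact := ModuleCat.shortComplex_exact _ hfq
        mono_f := by
          simpa [S, ModuleCat.shortComplexOfCompEqZero, ModuleCat.mono_iff_injective] using! hf
        epi_g := by
          simpa [S, ModuleCat.shortComplexOfCompEqZero, ModuleCat.epi_iff_surjective] using! hq }
    refine subsingleton_of_forall_eq 0 (fun a => ?_)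
    obtain ⟨y, hy⟩ := Ext.contravariant_sequence_exact₂ hS X (n := i) a (h1.elim _ _)
    rw [← hy, h3.elim y 0]
    simp

/-- Over a local ring with a regular sequence of length `dim R`, `Ext^i(R/p, R) = 0` whenever
`i + dim R/p < dim R`. -/
lemma subsingleton_ext_quotient_prime [IsLocalRing R] [IsNoetherianRing R] {rs : List R}
    (hmem : ∀ r ∈ rs, r ∈ maximalIdeal R) (hreg : RingTheory.Sequence.IsRegular R rs)
    (p : PrimeSpectrum R) (i : ℕ) (hi : (i : ℕ∞) + Order.coheight p < rs.length) :
    Subsingleton (Ext (ModuleCat.of R (R ⧸ p.asIdeal)) (ModuleCat.of R R) i) := by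
  have : WellFoundedGT (PrimeSpectrum R) :=
    ⟨InvImage.wf PrimeSpectrum.asIdeal (wellFounded_gt (α := Ideal R))⟩
  induction p using WellFoundedGT.induction generalizing i with
  | ind p ih =>
  by_cases hp : p.asIdeal = maximalIdeal R
  · refine ModuleCat.subsingleton_ext_of_exists_isRegular (maximalIdeal R) _ ?_ _ ?_ rs hmem hreg i ?_
    · show Module.support R (R ⧸ p.asIdeal) ⊆ _
      rw [Module.support_eq_zeroLocus, Ideal.annihilator_quotient, hp]
    · rw [lt_top_iff_ne_top]
      intro h
      have : (maximalIdeal R • (⊤ : Ideal R)) = ⊤ := h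
      rw [smul_eq_mul, Ideal.mul_top] at this
      exact Ideal.IsPrime.ne_top' this
    · have : (i : ℕ∞) < rs.length := lt_of_le_of_lt le_self_add hi
      exact_mod_cast this
  · have hlt : p.asIdeal < maximalIdeal R :=
      lt_of_le_of_ne (IsLocalRing.le_maximalIdeal p.2.ne_top) hp
    obtain ⟨x, hx, hxp⟩ := Set.exists_of_ssubset hlt
    let N := ModuleCat.of R (R ⧸ p.asIdeal)
    have hreg' : IsSMulRegular N x := by
      intro a b hab
      change x • a = x • b at hab
      obtain ⟨a, rfl⟩ := Ideal.Quotient.mk_surjective (I := p.asIdeal) a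
      obtain ⟨b, rfl⟩ := Ideal.Quotient.mk_surjective (I := p.asIdeal) b
      have h2 : Ideal.Quotient.mk p.asIdeal (x * a) = Ideal.Quotient.mk p.asIdeal (x * b) := hab
      rw [Ideal.Quotient.eq, ← mul_sub] at h2
      exact Ideal.Quotient.eq.2 ((p.2.mem_or_mem h2).resolve_left hxp)
    have hS := hreg'.smulShortComplex_shortExact
    have hfin : Module.Finite R N := inferInstanceAs (Module.Finite R (R ⧸ p.asIdeal))
    have hsub : Subsingleton (Ext (ModuleCat.of R (QuotSMulTop x N)) (ModuleCat.of R R) (i + 1)) := by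
      apply subsingleton_ext_of_forall_mem_support
      intro q hq
      have hq' : p < q := by
        have hxa : x ∈ Module.annihilator R (QuotSMulTop x N) := by
          rw [Module.mem_annihilator]
          intro m
          obtain ⟨m, rfl⟩ := Submodule.mkQ_surjective _ m
          rw [← map_smul, Submodule.mkQ_apply, Submodule.Quotient.mk_eq_zero]
          exact Submodule.smul_mem_pointwise_smul m x ⊤ trivial
        have hpa : p.asIdeal ≤ Module.annihilator R (QuotSMulTop x N) := by
          have : Module.annihilator R N = p.asIdeal := Ideal.annihilator_quotient
          refine this.ge.trans ?_
          exact LinearMap.annihilator_le_of_surjective _ (Submodule.mkQ_surjective _)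
        rw [Module.support_eq_zeroLocus] at hq
        refine lt_of_le_of_ne (fun y hy => hq (hpa hy)) ?_
        rintro rfl
        exact hxp (hq hxa)
      apply ih q hq'
      have := Order.coheight_add_one_le hq'
      calc ((i + 1 : ℕ) : ℕ∞) + Order.coheight q = i + (Order.coheight q + 1) := by
            push_cast; ring
        _ ≤ i + Order.coheight p := by gcongr
        _ < _ := hi
    have htop : (⊤ : Submodule R (Ext N (ModuleCat.of R R) i)) ≤ maximalIdeal R • ⊤ := by
      intro ξ _
      have h0 : ∀ η : Ext N (ModuleCat.of R R) i,
          (Ext.mk₀ (x • 𝟙 N)).comp η (zero_add i) = x • η := by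
        intro η
        rw [Ext.mk₀_smul, Ext.smul_comp, Ext.mk₀_id_comp]
      obtain ⟨η, hη⟩ := Ext.contravariant_sequence_exact₁ hS (ModuleCat.of R R) ξ (add_comm 1 i)
        (hsub.elim _ _)
      have : ξ = x • (show Ext N (ModuleCat.of R R) i from η) := by
        rw [← hη]
        exact h0 η
      rw [this]
      exact Submodule.smul_mem_smul hx trivial
    have hbot := Submodule.eq_bot_of_le_smul_of_le_jacobson_bot _ _
      (Module.Finite.fg_top (R := R) (M := Ext N (ModuleCat.of R R) i)) htop
      (IsLocalRing.maximalIdeal_le_jacobson _)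
    exact (Submodule.subsingleton_iff R).1 ((subsingleton_iff_bot_eq_top).1 hbot.symm)

lemma extTorsionLT_of_le_height [IsLocalRing R] [IsNoetherianRing R] {rs : List R}
    (hmem : ∀ r ∈ rs, r ∈ maximalIdeal R) (hreg : RingTheory.Sequence.IsRegular R rs)
    (hdim : ((rs.length : ℕ∞) : WithBot ℕ∞) = ringKrullDim R) (I : Ideal R) (g : ℕ)
    (hI : ∀ p : PrimeSpectrum R, I ≤ p.asIdeal → (g : ℕ∞) ≤ p.asIdeal.height)
    (P : Submonoid R) : ExtTorsionLT P (R ⧸ I) g R := by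
  refine ExtTorsionLT.of_subsingleton (fun i hi => ?_)
  apply subsingleton_ext_of_forall_mem_support
  intro p hp
  rw [Module.support_eq_zeroLocus, Ideal.annihilator_quotient] at hp
  apply subsingleton_ext_quotient_prime hmem hreg
  have h1 := hI p hp
  have h2 : Order.height p + Order.coheight p ≤ rs.length := by
    have : ((Order.height p + Order.coheight p : ℕ∞) : WithBot ℕ∞) ≤ (rs.length : ℕ∞) := by
      rw [hdim, ringKrullDim, Order.krullDim_eq_iSup_height_add_coheight_of_nonempty]
      exact WithBot.coe_le_coe.2
        (le_iSup (fun a : PrimeSpectrum R => Order.height a + Order.coheight a) p)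
    exact WithBot.coe_le_coe.1 this
  rw [PrimeSpectrum.height_eq_orderHeight] at h1
  have h3 : Order.coheight p ≠ ⊤ := by
    intro h
    rw [h, add_top] at h2
    exact absurd (top_le_iff.1 h2) (ENat.natCast_ne_top _)
  refine lt_of_lt_of_le ?_ h2
  refine (ENat.add_lt_add_iff_right h3).2 (lt_of_lt_of_le ?_ h1)
  exact_mod_cast hi

end GradeHeight

section AnticommutingOperators

variable {R V σ : Type*} [CommRing R] [AddCommGroup V] [Module R V]

/-- The composite `i q₁ ∘ i q₂ ∘ ⋯` of the operators indexed by a list. -/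
def listComp (i : σ → V →ₗ[R] V) : List σ → V →ₗ[R] V
  | [] => LinearMap.id
  | q :: l => i q ∘ₗ listComp i l

/-- The composite `⋯ ∘ e q₂ ∘ e q₁` of the operators indexed by a list. -/
def listCompRev (e : σ → V →ₗ[R] V) : List σ → V →ₗ[R] V
  | [] => LinearMap.id
  | q :: l => listCompRev e l ∘ₗ e q

/-- The formal derivative of `listComp i` in the direction replacing `i q` by the scalar `x q`. -/
def listCompDeriv (i : σ → V →ₗ[R] V) (x : σ → R) : List σ → V →ₗ[R] V
  | [] => 0
  | q :: l => x q • listComp i l - i q ∘ₗ listCompDeriv i x l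

variable {i e : σ → V →ₗ[R] V} {x : σ → R} {y : R}

lemma apply_listComp_eq_zero (hi : ∀ p q v, i p (i q v) = -i q (i p v)) {p : σ} (l : List σ)
    {v : V} (hv : i p v = 0) : i p (listComp i l v) = 0 := by
  induction l with
  | nil => simpa [listComp] using hv
  | cons q l ih => simp [listComp, hi p q, ih]

lemma apply_listCompDeriv_eq_zero (hi : ∀ p q v, i p (i q v) = -i q (i p v)) {p : σ}
    (l : List σ) {v : V} (hv : i p v = 0) : i p (listCompDeriv i x l v) = 0 := by
  induction l with
  | nil => simp [listCompDeriv]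
  | cons q l ih => simp [listCompDeriv, hi p q, ih, apply_listComp_eq_zero hi l hv]

lemma apply_listComp_of_mem (hi : ∀ p q v, i p (i q v) = -i q (i p v)) (hi2 : ∀ p v, i p (i p v) = 0)
    {p : σ} {l : List σ} (hp : p ∈ l) (v : V) : i p (listComp i l v) = 0 := by
  induction l with
  | nil => simp at hp
  | cons q l ih =>
    rcases List.mem_cons.1 hp with rfl | h
    · simp [listComp, hi2]
    · simp [listComp, hi p q, ih h]

lemma listComp_apply_of_mem (hi : ∀ p q v, i p (i q v) = -i q (i p v))
    (hi2 : ∀ p v, i p (i p v) = 0) {p : σ} {l : List σ} (hp : p ∈ l) (v : V) :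
    listComp i l (i p v) = 0 := by
  induction l with
  | nil => simp at hp
  | cons q l ih =>
    rcases List.mem_cons.1 hp with rfl | h
    · exact apply_listComp_eq_zero hi l (hi2 p v)
    · simp [listComp, ih h]

lemma listComp_apply (hi : ∀ p q v, i p (i q v) = -i q (i p v)) (p : σ) (l : List σ) (v : V) :
    listComp i l (i p v) = (-1 : R) ^ l.length • i p (listComp i l v) := by
  induction l with
  | nil => simp [listComp]
  | cons q l ih =>
    simp only [listComp, LinearMap.comp_apply, ih, map_smul, hi q p, List.length_cons, pow_succ]
    simp

lemma apply_listCompDeriv (hi : ∀ p q v, i p (i q v) = -i q (i p v))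
    (hi2 : ∀ p v, i p (i p v) = 0) {p : σ} {l : List σ} (hl : l.Nodup) (hp : p ∈ l) (v : V) :
    i p (listCompDeriv i x l v) = x p • listComp i l v := by
  induction l with
  | nil => simp at hp
  | cons q l ih =>
    rcases List.mem_cons.1 hp with rfl | h
    · simp [listComp, listCompDeriv, hi2]
    · simp [listComp, listCompDeriv, hi p q, ih (List.nodup_cons.1 hl).2 h,
        apply_listComp_of_mem hi hi2 h]

lemma listCompDeriv_apply (hi : ∀ p q v, i p (i q v) = -i q (i p v))
    (hi2 : ∀ p v, i p (i p v) = 0) {p : σ} {l : List σ} (hl : l.Nodup) (hp : p ∈ l) (v : V) :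
    listCompDeriv i x l (i p v) = ((-1 : R) ^ (l.length - 1) * x p) • listComp i l v := by
  induction l with
  | nil => simp at hp
  | cons q l ih =>
    rcases List.mem_cons.1 hp with rfl | h
    · simp [listComp, listCompDeriv, listComp_apply hi, apply_listCompDeriv_eq_zero hi l (hi2 p v),
        smul_smul, mul_comm]
    · obtain ⟨k, hk⟩ : ∃ k, l.length = k + 1 :=
        Nat.exists_eq_add_one.2 (List.length_pos_of_mem h)
      simp [listComp, listCompDeriv, ih (List.nodup_cons.1 hl).2 h,
        listComp_apply_of_mem hi hi2 h, hk, pow_succ]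

lemma listComp_listCompRev (hie : ∀ p q v, p ≠ q → i p (e q v) = -e q (i p v))
    (hie2 : ∀ p v, i p (e p v) = y • v - e p (i p v)) {l : List σ} (hl : l.Nodup) (v : V)
    (hv : ∀ p ∈ l, i p v = 0) :
    listComp i l (listCompRev e l v) = y ^ l.length • v := by
  induction l generalizing v with
  | nil => simp [listComp, listCompRev]
  | cons q l ih =>
    simp only [List.nodup_cons] at hl
    simp only [listComp, listCompRev, LinearMap.comp_apply]
    rw [ih hl.2 (e q v), map_smul, hie2, hv q (by simp)]
    · simp [smul_smul, pow_succ]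
    · intro p hp
      rw [hie p q v (by rintro rfl; exact hl.1 hp), hv p (by simp [hp])]
      simp

lemma apply_listComp_eq_zero' (hie : ∀ p q v, p ≠ q → i p (e q v) = -e q (i p v)) {p : σ}
    {l : List σ} (hp : p ∉ l) {v : V} (hv : e p v = 0) : e p (listComp i l v) = 0 := by
  induction l with
  | nil => simpa [listComp] using hv
  | cons q l ih =>
    simp only [List.mem_cons, not_or] at hp
    have := hie q p (listComp i l v) (Ne.symm hp.1)
    rw [ih hp.2, map_zero] at this
    simpa [listComp] using this.symm

lemma listCompRev_listComp (hie : ∀ p q v, p ≠ q → i p (e q v) = -e q (i p v))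
    (hie2 : ∀ p v, i p (e p v) = y • v - e p (i p v)) {l : List σ} (hl : l.Nodup) (v : V)
    (hv : ∀ p ∈ l, e p v = 0) :
    listCompRev e l (listComp i l v) = y ^ l.length • v := by
  induction l with
  | nil => simp [listComp, listCompRev]
  | cons q l ih =>
    simp only [List.nodup_cons] at hl
    simp only [listComp, listCompRev, LinearMap.comp_apply]
    have h1 := hie2 q (listComp i l v)
    rw [apply_listComp_eq_zero' hie hl.1 (hv q (by simp)), map_zero, eq_comm, sub_eq_zero] at h1
    rw [← h1, map_smul, ih hl.2 (fun p hp => hv p (by simp [hp])), smul_smul]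
    simp [pow_succ, mul_comm]

end AnticommutingOperators

section ExteriorContraction

open ExteriorAlgebra

variable {R M : Type*} [CommRing R] [AddCommGroup M] [Module R M]

/-- Contraction of the exterior algebra by a linear form. -/
abbrev extContract (d : Module.Dual R M) : ExteriorAlgebra R M →ₗ[R] ExteriorAlgebra R M :=
  CliffordAlgebra.contractLeft (Q := (0 : QuadraticForm R M)) d

lemma extContract_ι_mul (d : Module.Dual R M) (f : M) (v : ExteriorAlgebra R M) :
    extContract d (ι R f * v) = d f • v - ι R f * extContract d v :=
  CliffordAlgebra.contractLeft_ι_mul (Q := (0 : QuadraticForm R M)) d f v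

lemma extContract_mem (d : Module.Dual R M) {n : ℕ} {v : ExteriorAlgebra R M}
    (hv : v ∈ ⋀[R]^(n + 1) M) : extContract d v ∈ ⋀[R]^n M := by
  induction n generalizing v with
  | zero =>
    rw [ExteriorAlgebra.exteriorPower, zero_add, pow_one] at hv
    obtain ⟨f, rfl⟩ := hv
    have := extContract_ι_mul d f 1
    rw [mul_one, CliffordAlgebra.contractLeft_one, mul_zero, sub_zero] at this
    rw [this, ExteriorAlgebra.exteriorPower, pow_zero]
    exact Submodule.smul_mem _ _ (Submodule.one_le.1 le_rfl)
  | succ n ih =>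
    rw [ExteriorAlgebra.exteriorPower, pow_succ'] at hv
    induction hv using Submodule.mul_induction_on' with
    | mem_mul_mem a ha c hc =>
      obtain ⟨f, rfl⟩ := ha
      rw [extContract_ι_mul]
      refine Submodule.sub_mem _ (Submodule.smul_mem _ _ hc) ?_
      rw [ExteriorAlgebra.exteriorPower, pow_succ']
      exact Submodule.mul_mem_mul ⟨f, rfl⟩ (ih hc)
    | add a _ c _ ha hc => rw [map_add]; exact Submodule.add_mem _ ha hc

lemma extContract_eq_zero (d : Module.Dual R M) {v : ExteriorAlgebra R M}
    (hv : v ∈ ⋀[R]^0 M) : extContract d v = 0 := by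
  rw [ExteriorAlgebra.exteriorPower, pow_zero, Submodule.mem_one] at hv
  obtain ⟨r, rfl⟩ := hv
  exact CliffordAlgebra.contractLeft_algebraMap (Q := (0 : QuadraticForm R M)) d r

lemma ι_mul_mem_exteriorPower (f : M) {n : ℕ} {v : ExteriorAlgebra R M} (hv : v ∈ ⋀[R]^n M) :
    ι R f * v ∈ ⋀[R]^(n + 1) M := by
  rw [ExteriorAlgebra.exteriorPower, pow_succ']
  exact Submodule.mul_mem_mul ⟨f, rfl⟩ hv

lemma exteriorPower_eq_bot (R : Type*) [CommRing R] {m n : ℕ} (h : m < n) :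
    (⋀[R]^n (Fin m → R)) = ⊥ := by
  have hc : IsEmpty (Set.powersetCard (Fin m) n) := by
    refine ⟨fun s => ?_⟩
    have h1 := s.2
    rw [Set.powersetCard.mem_iff] at h1
    have := Finset.card_le_univ s.1
    simp at this
    omega
  have := ((Pi.basisFun R (Fin m)).exteriorPower n).repr.toEquiv.subsingleton
  exact (Submodule.eq_bot_iff _).2 fun x hx => congrArg Subtype.val (Subsingleton.elim (⟨x, hx⟩ : ⋀[R]^n (Fin m → R)) 0)

lemma exists_exteriorPower_eq_span (R : Type*) [CommRing R] (m : ℕ) :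
    ∃ v : ExteriorAlgebra R (Fin m → R), v ∈ ⋀[R]^m (Fin m → R) ∧
      (∀ w ∈ ⋀[R]^m (Fin m → R), ∃ r : R, w = r • v) ∧ ∀ r : R, r • v = 0 → r = 0 := by
  let B := (Pi.basisFun R (Fin m)).exteriorPower m
  have hu : Unique (Set.powersetCard (Fin m) m) := by
    refine ⟨⟨⟨Finset.univ, by simp [Set.powersetCard.mem_iff]⟩⟩, fun s => Subtype.ext ?_⟩
    exact (Finset.card_eq_iff_eq_univ _).1 (by simp)
  refine ⟨B default, (B default).2, fun w hw => ⟨B.repr ⟨w, hw⟩ default, ?_⟩, fun r hr => ?_⟩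
  · have := B.sum_repr ⟨w, hw⟩
    rw [Fintype.sum_unique] at this
    exact (congrArg Subtype.val this).symm
  · have h : r • B default = 0 := Subtype.ext hr
    have := congrArg (fun z => B.repr z default) h
    simpa using this

end ExteriorContraction

section PolynomialKoszul

variable {R V σ : Type*} [CommRing R] [AddCommGroup V] [Module R V] [Fintype σ] [DecidableEq σ]

/-- Multiplication by the `q`-th variable on functions on monomials. -/
def varShift (R V : Type*) {σ : Type*} [CommRing R] [AddCommGroup V] [Module R V] [DecidableEq σ]
    (q : σ) : ((σ →₀ ℕ) → V) →ₗ[R] ((σ →₀ ℕ) → V) where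
  toFun w α := if α q = 0 then 0 else w (α - Finsupp.single q 1)
  map_add' v w := by ext α; by_cases h : α q = 0 <;> simp [h]
  map_smul' r w := by ext α; by_cases h : α q = 0 <;> simp [h]

/-- The Koszul differential `∑ q, Y_q ⊗ i_q`. -/
def koszulDiff (i : σ → V →ₗ[R] V) : ((σ →₀ ℕ) → V) →ₗ[R] ((σ →₀ ℕ) → V) :=
  ∑ q, varShift R V q ∘ₗ (i q).compLeft _

/-- Multiplication by the linear form `∑ q, x q • Y_q`. -/
def linShift (V : Type*) [AddCommGroup V] [Module R V] (x : σ → R) :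
    ((σ →₀ ℕ) → V) →ₗ[R] ((σ →₀ ℕ) → V) :=
  ∑ q, x q • varShift R V q

/-- The homotopy `e_q ⊗ ∂_q`. -/
def koszulHomotopy (e : σ → V →ₗ[R] V) (q : σ) : ((σ →₀ ℕ) → V) →ₗ[R] ((σ →₀ ℕ) → V) where
  toFun w α := e q (w (α + Finsupp.single q 1))
  map_add' v w := by ext α; simp
  map_smul' r w := by ext α; simp

/-- The correction term `ev_q ⊗ (y - e_q i_q)`. -/
def koszulRest (i e : σ → V →ₗ[R] V) (y : R) (q : σ) :
    ((σ →₀ ℕ) → V) →ₗ[R] ((σ →₀ ℕ) → V) where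
  toFun w α := if α q = 0 then y • w α - e q (i q (w α)) else 0
  map_add' v w := by ext α; by_cases h : α q = 0 <;> simp [h]; abel
  map_smul' r w := by
    ext α; by_cases h : α q = 0 <;> simp [h, smul_sub, smul_smul, mul_comm]

/-- Functions with values in `G j`, supported in degree `k`. -/
def koszulComponent (G : ℕ → Submodule R V) (σ : Type*) (j k : ℕ) :
    Submodule R ((σ →₀ ℕ) → V) where
  carrier := {w | ∀ α, w α ∈ G j ∧ (α.degree ≠ k → w α = 0)}
  add_mem' {v w} hv hw α := ⟨add_mem (hv α).1 (hw α).1, fun h => by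
    simp [(hv α).2 h, (hw α).2 h]⟩
  zero_mem' α := ⟨zero_mem _, fun _ => rfl⟩
  smul_mem' r w hw α := ⟨Submodule.smul_mem _ _ (hw α).1, fun h => by simp [(hw α).2 h]⟩

variable {i e : σ → V →ₗ[R] V} {y : R} {x : σ → R} {G : ℕ → Submodule R V}

omit [Fintype σ] in
lemma varShift_apply (q : σ) (w : (σ →₀ ℕ) → V) (α : σ →₀ ℕ) :
    varShift R V q w α = if α q = 0 then 0 else w (α - Finsupp.single q 1) := rfl

lemma koszulDiff_apply (w : (σ →₀ ℕ) → V) (α : σ →₀ ℕ) :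
    koszulDiff i w α = ∑ q, if α q = 0 then 0 else i q (w (α - Finsupp.single q 1)) := by
  simp [koszulDiff, varShift_apply]

lemma linShift_apply (w : (σ →₀ ℕ) → V) (α : σ →₀ ℕ) :
    linShift V x w α = ∑ q, if α q = 0 then 0 else x q • w (α - Finsupp.single q 1) := by
  simp [linShift, varShift_apply]

omit [Fintype σ] in
lemma varShift_comm (p q : σ) (w : (σ →₀ ℕ) → V) :
    varShift R V p (varShift R V q w) = varShift R V q (varShift R V p w) := by
  by_cases hpq : p = q
  · rw [hpq]
  · ext α
    simp only [varShift_apply, Finsupp.tsub_apply, Finsupp.single_apply, hpq, Ne.symm hpq, if_false,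
      tsub_zero]
    rw [tsub_tsub, tsub_tsub, add_comm]
    split_ifs <;> rfl

omit [Fintype σ] in
lemma varShift_compLeft (f : V →ₗ[R] V) (q : σ) (w : (σ →₀ ℕ) → V) :
    varShift R V q (f.compLeft _ w) = f.compLeft _ (varShift R V q w) := by
  ext α
  simp only [varShift_apply, LinearMap.compLeft_apply, Function.comp_apply]
  split_ifs <;> simp

lemma koszulDiff_koszulDiff (hi : ∀ p q v, i p (i q v) = -i q (i p v))
    (hi2 : ∀ p v, i p (i p v) = 0) (w : (σ →₀ ℕ) → V) :
    koszulDiff i (koszulDiff i w) = 0 := by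
  have key : koszulDiff i (koszulDiff i w) =
      ∑ p, ∑ q, varShift R V p (varShift R V q ((i p).compLeft _ ((i q).compLeft _ w))) := by
    simp only [koszulDiff, LinearMap.sum_apply, LinearMap.comp_apply, map_sum, varShift_compLeft]
    exact Finset.sum_comm
  rw [key, ← Finset.sum_product']
  refine Finset.sum_involution (fun a _ => (a.2, a.1)) ?_ ?_ ?_ ?_
  · rintro ⟨p, q⟩ -
    have : (i p).compLeft (σ →₀ ℕ) ((i q).compLeft _ w) =
      - (i q).compLeft _ ((i p).compLeft _ w) := by ext α; simp [hi p q]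
    simp [this, varShift_comm p q]
  · rintro ⟨p, q⟩ - h hpq
    simp only [Prod.mk.injEq] at hpq
    obtain ⟨rfl, -⟩ := hpq
    refine h ?_
    have : (i q).compLeft (σ →₀ ℕ) ((i q).compLeft _ w) = 0 := by ext α; simp [hi2]
    simp [this]
  · simp
  · simp

lemma koszulDiff_linShift (w : (σ →₀ ℕ) → V) :
    koszulDiff i (linShift V x w) = linShift V x (koszulDiff i w) := by
  simp only [koszulDiff, linShift, LinearMap.sum_apply, LinearMap.comp_apply, map_sum,
    LinearMap.smul_apply, map_smul, ← varShift_compLeft, Finset.smul_sum]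
  rw [Finset.sum_comm]
  simp_rw [varShift_comm]

lemma koszulDiff_mem (hG : ∀ q n v, v ∈ G (n + 1) → i q v ∈ G n) {j k : ℕ} {w : (σ →₀ ℕ) → V}
    (hw : w ∈ koszulComponent G σ (j + 1) k) :
    koszulDiff i w ∈ koszulComponent G σ j (k + 1) := by
  intro α
  rw [koszulDiff_apply]
  refine ⟨Submodule.sum_mem _ fun q _ => ?_, fun h => Finset.sum_eq_zero fun q _ => ?_⟩
  · split_ifs
    · exact zero_mem _
    · exact hG _ _ _ (hw _).1
  · split_ifs with h0
    · rfl
    · rw [(hw _).2, map_zero]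
      contrapose! h
      have : (α - Finsupp.single q 1) + Finsupp.single q 1 = α :=
        tsub_add_cancel_of_le (by simpa using Nat.one_le_iff_ne_zero.2 h0)
      rw [← this, map_add, h]
      simp

lemma linShift_mem {j k : ℕ} {w : (σ →₀ ℕ) → V} (hw : w ∈ koszulComponent G σ j k) :
    linShift V x w ∈ koszulComponent G σ j (k + 1) := by
  intro α
  rw [linShift_apply]
  refine ⟨Submodule.sum_mem _ fun q _ => ?_, fun h => Finset.sum_eq_zero fun q _ => ?_⟩
  · split_ifs
    · exact zero_mem _
    · exact Submodule.smul_mem _ _ (hw _).1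
  · split_ifs with h0
    · rfl
    · rw [(hw _).2, smul_zero]
      contrapose! h
      have : (α - Finsupp.single q 1) + Finsupp.single q 1 = α :=
        tsub_add_cancel_of_le (by simpa using Nat.one_le_iff_ne_zero.2 h0)
      rw [← this, map_add, h]
      simp

omit [Fintype σ] [DecidableEq σ] in
lemma koszulHomotopy_mem (hG : ∀ q n v, v ∈ G n → e q v ∈ G (n + 1)) (q : σ) {j k : ℕ}
    {w : (σ →₀ ℕ) → V} (hw : w ∈ koszulComponent G σ j (k + 1)) :
    koszulHomotopy e q w ∈ koszulComponent G σ (j + 1) k := by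
  intro α
  refine ⟨hG _ _ _ (hw _).1, fun h => ?_⟩
  simp only [koszulHomotopy, LinearMap.coe_mk, AddHom.coe_mk]
  rw [(hw _).2, map_zero]
  simpa using h

omit [Fintype σ] [DecidableEq σ] in
lemma koszulRest_mem (hG : ∀ q n v, v ∈ G (n + 1) → i q v ∈ G n)
    (hG0 : ∀ q v, v ∈ G 0 → i q v = 0) (hGe : ∀ q n v, v ∈ G n → e q v ∈ G (n + 1)) (q : σ)
    {j k : ℕ} {w : (σ →₀ ℕ) → V} (hw : w ∈ koszulComponent G σ j k) :
    koszulRest i e y q w ∈ koszulComponent G σ j k := by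
  intro α
  simp only [koszulRest, LinearMap.coe_mk, AddHom.coe_mk]
  split_ifs
  · refine ⟨Submodule.sub_mem _ (Submodule.smul_mem _ _ (hw α).1) ?_, fun h => ?_⟩
    · cases j with
      | zero => rw [hG0 _ _ (hw α).1, map_zero]; exact zero_mem _
      | succ j => exact hGe _ _ _ (hG _ _ _ (hw α).1)
    · simp [(hw α).2 h]
  · exact ⟨zero_mem _, fun _ => rfl⟩

lemma koszulDiff_koszulHomotopy (hie : ∀ p q v, p ≠ q → i p (e q v) = -e q (i p v))
    (hie2 : ∀ p v, i p (e p v) = y • v - e p (i p v)) (q : σ) (w : (σ →₀ ℕ) → V) :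
    koszulDiff i (koszulHomotopy e q w) + koszulHomotopy e q (koszulDiff i w) +
      koszulRest i e y q w = y • w := by
  ext α
  have h1 : ∀ p, (if α p = 0 then 0 else
        i p (koszulHomotopy e q w (α - Finsupp.single p 1))) +
      e q (if (α + Finsupp.single q 1 : σ →₀ ℕ) p = 0 then 0 else
        i p (w (α + Finsupp.single q 1 - Finsupp.single p 1))) =
      if p = q then (y • w α - koszulRest i e y q w α) else 0 := by
    intro p
    simp only [koszulHomotopy, koszulRest, LinearMap.coe_mk, AddHom.coe_mk]
    by_cases hpq : p = q
    · subst hpq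
      by_cases h0 : α p = 0
      · simp [h0]
      · have : (α - Finsupp.single p 1) + Finsupp.single p 1 = α :=
          tsub_add_cancel_of_le (by simpa using Nat.one_le_iff_ne_zero.2 h0)
        simp [h0, this, hie2]
    · have h2 : (α + Finsupp.single q 1 : σ →₀ ℕ) p = α p := by simp [hpq]
      by_cases h0 : α p = 0
      · simp [h0, hpq, h2]
      · have h3 : Finsupp.single p 1 ≤ α := by simpa using Nat.one_le_iff_ne_zero.2 h0
        rw [h2, if_neg h0, if_neg h0, if_neg hpq, hie p q _ hpq, tsub_add_eq_add_tsub h3]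
        simp
  have h2 : koszulHomotopy e q (koszulDiff i w) α = e q (koszulDiff i w (α + Finsupp.single q 1)) :=
    rfl
  rw [Pi.add_apply, Pi.add_apply, h2, koszulDiff_apply, koszulDiff_apply, map_sum,
    ← Finset.sum_add_distrib, Finset.sum_congr rfl fun p _ => h1 p]
  simp

/-- A cycle of positive polynomial degree becomes a boundary after multiplication by a power
of `y`, where `y` is contracted from the homotopy operators. -/
lemma exists_koszulDiff_eq_pow_smul (hi : ∀ p q v, i p (i q v) = -i q (i p v))
    (hi2 : ∀ p v, i p (i p v) = 0)
    (hie : ∀ p q v, p ≠ q → i p (e q v) = -e q (i p v))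
    (hie2 : ∀ p v, i p (e p v) = y • v - e p (i p v))
    (hG : ∀ q n v, v ∈ G (n + 1) → i q v ∈ G n)
    (hG0 : ∀ q v, v ∈ G 0 → i q v = 0) (hGe : ∀ q n v, v ∈ G n → e q v ∈ G (n + 1))
    {j k : ℕ} {z : (σ →₀ ℕ) → V} (hz : z ∈ koszulComponent G σ j (k + 1))
    (hdz : koszulDiff i z = 0) :
    ∃ w ∈ koszulComponent G σ (j + 1) k, koszulDiff i w = y ^ Fintype.card σ • z := by
  have key : ∀ l : Finset σ, ∃ w ∈ koszulComponent G σ (j + 1) k,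
      ∃ z' ∈ koszulComponent G σ j (k + 1), koszulDiff i z' = 0 ∧
        (∀ α, ∀ p ∈ l, α p ≠ 0 → z' α = 0) ∧ koszulDiff i w + z' = y ^ l.card • z := by
    intro l
    induction l using Finset.induction_on with
    | empty => exact ⟨0, zero_mem _, z, hz, hdz, by simp, by simp⟩
    | insert q l hq ih =>
      obtain ⟨w, hw, z', hz', hdz', hv, h⟩ := ih
      have h1 := koszulDiff_koszulHomotopy hie hie2 q z'
      rw [hdz', map_zero, add_zero] at h1
      refine ⟨y • w + koszulHomotopy e q z', add_mem (Submodule.smul_mem _ _ hw)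
        (koszulHomotopy_mem hGe q hz'), koszulRest i e y q z',
        koszulRest_mem hG hG0 hGe q hz', ?_, ?_, ?_⟩
      · have := congrArg (koszulDiff i) h1
        rw [map_add, koszulDiff_koszulDiff hi hi2, map_smul, hdz', smul_zero, zero_add] at this
        exact this
      · intro α p hp hα
        simp only [koszulRest, LinearMap.coe_mk, AddHom.coe_mk]
        rcases Finset.mem_insert.1 hp with rfl | hp
        · simp [hα]
        · simp [hv α p hp hα]
      · rw [Finset.card_insert_of_notMem hq, pow_succ', mul_smul, ← h, map_add, map_smul, add_assoc,
          h1, smul_add]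
  obtain ⟨w, hw, z', hz', -, hv, h⟩ := key Finset.univ
  refine ⟨w, hw, ?_⟩
  have : z' = 0 := by
    ext α
    by_cases hα : α = 0
    · exact (hz' α).2 (by simp [hα])
    · obtain ⟨p, hp⟩ := Finsupp.ne_iff.1 hα
      exact hv α p (Finset.mem_univ _) hp
  simpa [this] using h

/-- The component is a finite product of copies of `G j`. -/
def koszulComponentEquiv (G : ℕ → Submodule R V) (σ : Type*) (j k : ℕ) :
    koszulComponent G σ j k ≃ₗ[R] ({α : σ →₀ ℕ // α.degree = k} → G j) where
  toFun w α := ⟨w.1 α.1, (w.2 α.1).1⟩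
  invFun u := ⟨fun α => if h : α.degree = k then (u ⟨α, h⟩).1 else 0, fun α => by
    refine ⟨?_, fun h => dif_neg h⟩
    dsimp only
    split_ifs
    · exact (u _).2
    · exact zero_mem _⟩
  map_add' v w := rfl
  map_smul' r w := rfl
  left_inv w := by
    ext α
    by_cases h : α.degree = k
    · simp [h]
    · simp [h, (w.2 α).2 h]
  right_inv u := by
    ext α
    simp [α.2]

instance koszulComponent_free [∀ n, Module.Free R (G n)] (j k : ℕ) :
    Module.Free R (koszulComponent G σ j k) := by
  have : Finite {α : σ →₀ ℕ // α.degree = k} :=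
    (Finsupp.finite_of_degree_le (σ := σ) k).subset fun α h => h.le
  exact Module.Free.of_equiv (koszulComponentEquiv G σ j k).symm

instance koszulComponent_finite [∀ n, Module.Finite R (G n)] (j k : ℕ) :
    Module.Finite R (koszulComponent G σ j k) := by
  have : Finite {α : σ →₀ ℕ // α.degree = k} :=
    (Finsupp.finite_of_degree_le (σ := σ) k).subset fun α h => h.le
  exact Module.Finite.equiv (koszulComponentEquiv G σ j k).symm

end PolynomialKoszul

section KoszulDuality

lemma ExtTorsionLT.mem_of_forall_smul_mem_of_le {R X : Type u} [CommRing R] [AddCommGroup X]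
    [Module R X] {I : Ideal R} {g : ℕ} {B C : Submodule R X} (hBC : B ≤ C)
    (hB : ExtTorsionLT (⊥ : Submonoid R) (R ⧸ I) (g + 2) B)
    (hC : ExtTorsionLT (⊥ : Submonoid R) (R ⧸ I) (g + 1) C) {x : X} (hxC : x ∈ C)
    (hx : ∀ a ∈ I, a • x ∈ B) : x ∈ B := by
  have := ExtTorsionLT.mem_of_forall_smul_mem (B.comap C.subtype)
    (hB.of_linearEquiv (Submodule.comapSubtypeEquivOfLe hBC)) hC ⟨x, hxC⟩ (fun a ha => hx a ha)
  exact this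

lemma forall_smul_mem_of_le_span {R X : Type*} [CommRing R] [AddCommGroup X] [Module R X]
    {I : Ideal R} {s : Set R} (hI : I ≤ Ideal.span s) {B : Submodule R X} {x : X}
    (hx : ∀ a ∈ s, a • x ∈ B) : ∀ a ∈ I, a • x ∈ B := by
  have h : Ideal.span s ≤ B.comap (LinearMap.toSpanSingleton R X x) :=
    Submodule.span_le.2 fun a ha => by simpa using hx a ha
  intro a ha
  simpa using h (hI ha)

variable {R : Type u} [CommRing R] {m : ℕ} {σ : Type} [Fintype σ] [DecidableEq σ]
  (ψ : (Fin m → R) →ₗ[R] (σ → R))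

/-- Contractions by the coordinates of a linear map. -/
def coordContract (q : σ) :
    ExteriorAlgebra R (Fin m → R) →ₗ[R] ExteriorAlgebra R (Fin m → R) :=
  extContract (LinearMap.proj q ∘ₗ ψ)

/-- The exterior powers of `R ^ m`. -/
abbrev extGrade (R : Type*) [CommRing R] (m n : ℕ) :
    Submodule R (ExteriorAlgebra R (Fin m → R)) := ⋀[R]^n (Fin m → R)

omit [Fintype σ] [DecidableEq σ] in
lemma coordContract_anticomm (p q : σ) (v : ExteriorAlgebra R (Fin m → R)) :
    coordContract ψ p (coordContract ψ q v) = -coordContract ψ q (coordContract ψ p v) :=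
  CliffordAlgebra.contractLeft_comm _ _ v

omit [Fintype σ] [DecidableEq σ] in
lemma coordContract_self (p : σ) (v : ExteriorAlgebra R (Fin m → R)) :
    coordContract ψ p (coordContract ψ p v) = 0 :=
  CliffordAlgebra.contractLeft_contractLeft _ v

omit [Fintype σ] [DecidableEq σ] in
lemma coordContract_mem (q : σ) (n : ℕ) (v : ExteriorAlgebra R (Fin m → R))
    (hv : v ∈ extGrade R m (n + 1)) : coordContract ψ q v ∈ extGrade R m n :=
  extContract_mem _ hv

omit [Fintype σ] [DecidableEq σ] in
lemma coordContract_eq_zero (q : σ) (v : ExteriorAlgebra R (Fin m → R))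
    (hv : v ∈ extGrade R m 0) : coordContract ψ q v = 0 :=
  extContract_eq_zero _ hv

omit [Fintype σ] in
/-- If `y` annihilates the cokernel of `ψ`, there are multiplication operators `e q` with
anticommutator `y` with the contractions. -/
lemma exists_dual_coordContract {y : R} (hy : ∀ g : σ → R, y • g ∈ LinearMap.range ψ) :
    ∃ e : σ → ExteriorAlgebra R (Fin m → R) →ₗ[R] ExteriorAlgebra R (Fin m → R),
      (∀ p q v, p ≠ q → coordContract ψ p (e q v) = -e q (coordContract ψ p v)) ∧
      (∀ p v, coordContract ψ p (e p v) = y • v - e p (coordContract ψ p v)) ∧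
      ∀ q n v, v ∈ extGrade R m n → e q v ∈ extGrade R m (n + 1) := by
  choose f hf using fun q : σ => hy (Pi.single q 1)
  refine ⟨fun q => LinearMap.mulLeft R (ExteriorAlgebra.ι R (f q)), fun p q v hpq => ?_,
    fun p v => ?_, fun q n v hv => ι_mul_mem_exteriorPower _ hv⟩
  · simp only [coordContract, LinearMap.mulLeft_apply, extContract_ι_mul, LinearMap.comp_apply, hf]
    simp [hpq]
  · simp only [coordContract, LinearMap.mulLeft_apply, extContract_ι_mul, LinearMap.comp_apply, hf]
    simp

omit [Fintype σ] [DecidableEq σ] in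
lemma listComp_mem {V : Type*} [AddCommGroup V] [Module R V] {i : σ → V →ₗ[R] V}
    {G : ℕ → Submodule R V} (hG : ∀ q n v, v ∈ G (n + 1) → i q v ∈ G n) (l : List σ) {n : ℕ} {v : V}
    (hv : v ∈ G (n + l.length)) : listComp i l v ∈ G n := by
  induction l generalizing n with
  | nil => exact hv
  | cons q l ih =>
    refine hG _ _ _ (ih ?_)
    convert hv using 2
    simp only [List.length_cons]
    omega

omit [Fintype σ] [DecidableEq σ] in
lemma listCompDeriv_mem {V : Type*} [AddCommGroup V] [Module R V] {i : σ → V →ₗ[R] V} {x : σ → R}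
    {G : ℕ → Submodule R V} (hG : ∀ q n v, v ∈ G (n + 1) → i q v ∈ G n) (l : List σ) {n : ℕ} {v : V}
    (hv : v ∈ G (n + l.length)) : listCompDeriv i x l v ∈ G (n + 1) := by
  induction l generalizing n with
  | nil => exact zero_mem _
  | cons q l ih =>
    have h : v ∈ G (n + 1 + l.length) := by
      convert hv using 2
      simp only [List.length_cons]
      omega
    exact sub_mem (Submodule.smul_mem _ _ (listComp_mem hG l h)) (hG _ _ _ (ih h))

omit [Fintype σ] [DecidableEq σ] in
lemma listCompRev_mem {V : Type*} [AddCommGroup V] [Module R V] {e : σ → V →ₗ[R] V}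
    {G : ℕ → Submodule R V} (hG : ∀ q n v, v ∈ G n → e q v ∈ G (n + 1)) (l : List σ) {n : ℕ} {v : V}
    (hv : v ∈ G n) : listCompRev e l v ∈ G (n + l.length) := by
  induction l generalizing n v with
  | nil => exact hv
  | cons q l ih =>
    have := ih (hG q _ _ hv)
    rw [List.length_cons, show n + (l.length + 1) = n + 1 + l.length by omega]
    exact this

/-- The cycles in degree `δ`, killed by all the contractions, form a free module of rank one
generated by the full contraction of the volume element. -/
lemma exists_cycle_generator {δ : ℕ} (hm : m = δ + Fintype.card σ) (hδ : 1 ≤ δ) {I : Ideal R}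
    (hI : I = Ideal.span {a | ∃ y : R, (∀ g : σ → R, y • g ∈ LinearMap.range ψ) ∧
      a = y ^ Fintype.card σ})
    (hExt : ExtTorsionLT (⊥ : Submonoid R) (R ⧸ I) (δ + 1) R) :
    ∃ vol ∈ extGrade R m m, (∀ w ∈ extGrade R m m, ∃ r : R, w = r • vol) ∧
      ∀ κ, κ = listComp (coordContract ψ) Finset.univ.toList vol →
      (∀ q, coordContract ψ q κ = 0) ∧ κ ∈ extGrade R m δ ∧ (∀ r : R, r • κ = 0 → r = 0) ∧
      ∀ η ∈ extGrade R m δ, (∀ q, coordContract ψ q η = 0) → ∃ r : R, η = r • κ := by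
  obtain ⟨vol, hvol, hspan, hfaith⟩ := exists_exteriorPower_eq_span R m
  have hlen : (Finset.univ : Finset σ).toList.length = Fintype.card σ := by simp
  have hnodup := (Finset.univ : Finset σ).nodup_toList
  refine ⟨vol, hvol, hspan, ?_⟩
  rintro κ hκ
  have hκG : κ ∈ extGrade R m δ := by
    rw [hκ]
    refine listComp_mem (coordContract_mem ψ) _ ?_
    rw [hlen, ← hm]
    exact hvol
  have hκ0 : ∀ q, coordContract ψ q κ = 0 := fun q => by
    rw [hκ]
    exact apply_listComp_of_mem (coordContract_anticomm ψ) (coordContract_self ψ) (by simp) _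
  have hfaithκ : ∀ r : R, r • κ = 0 → r = 0 := by
    intro r hr
    obtain ⟨s, hs, h⟩ := hExt.exists_smul_eq_zero_of_quotient (by omega) r (by
      have := forall_smul_mem_of_le_span hI.le (B := (⊥ : Ideal R)) (x := r) ?_
      · simpa using this
      rintro a ⟨y, hy, rfl⟩
      obtain ⟨e, he1, he2, he3⟩ := exists_dual_coordContract ψ hy
      have h1 := listCompRev_listComp he1 he2 hnodup vol (fun p _ => by
        have := he3 p _ _ hvol
        rwa [extGrade, exteriorPower_eq_bot R (Nat.lt_succ_self m)] at this)
      rw [← hκ, hlen] at h1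
      rw [Submodule.mem_bot]
      refine hfaith _ ?_
      rw [smul_assoc, smul_comm, ← h1, ← map_smul, hr, map_zero])
    rw [Submonoid.mem_bot] at hs
    rwa [hs, one_smul] at h
  refine ⟨hκ0, hκG, hfaithκ, fun η hη hη0 => ?_⟩
  have hinj : Function.Injective (LinearMap.toSpanSingleton R _ κ) := by
    rw [← LinearMap.ker_eq_bot, LinearMap.ker_eq_bot']
    exact fun r hr => hfaithκ r (by simpa using hr)
  obtain ⟨g, rfl⟩ : ∃ g, δ = g + 1 := ⟨δ - 1, by omega⟩
  have hmem := ExtTorsionLT.mem_of_forall_smul_mem_of_le (I := I) (g := g)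
    (B := LinearMap.range (LinearMap.toSpanSingleton R _ κ)) (C := extGrade R m (g + 1))
    (by
      rintro _ ⟨r, rfl⟩
      exact Submodule.smul_mem _ _ hκG)
    (hExt.of_linearEquiv (LinearEquiv.ofInjective _ hinj).symm)
    ((hExt.mono (by omega)).of_free) hη
    (forall_smul_mem_of_le_span hI.le (by
      rintro a ⟨y, hy, rfl⟩
      obtain ⟨e, he1, he2, he3⟩ := exists_dual_coordContract ψ hy
      have h1 := listComp_listCompRev he1 he2 hnodup η (fun p _ => hη0 p)
      have h2 := listCompRev_mem he3 Finset.univ.toList hη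
      rw [hlen, ← hm] at h2
      obtain ⟨r, hr⟩ := hspan _ h2
      rw [hr, map_smul, ← hκ, hlen] at h1
      exact ⟨r, by simpa using h1⟩))
  obtain ⟨r, hr⟩ := hmem
  exact ⟨r, by simpa using hr.symm⟩

end KoszulDuality

section KoszulDuality

variable {R : Type u} [CommRing R] {m : ℕ} {σ : Type} [Fintype σ] [DecidableEq σ]
  (ψ : (Fin m → R) →ₗ[R] (σ → R))

/-- Cycles of the polynomial Koszul complex. -/
def koszulCycles (j k : ℕ) : Submodule R ((σ →₀ ℕ) → ExteriorAlgebra R (Fin m → R)) :=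
  koszulComponent (extGrade R m) σ j k ⊓ LinearMap.ker (koszulDiff (coordContract ψ))

lemma koszulDiff_apply_single {V : Type*} [AddCommGroup V] [Module R V] (i : σ → V →ₗ[R] V)
    (w : (σ →₀ ℕ) → V) (q : σ) : koszulDiff i w (Finsupp.single q 1) = i q (w 0) := by
  rw [koszulDiff_apply, Finset.sum_eq_single q]
  · simp
  · intro p _ hp
    simp [hp.symm]
  · simp

lemma linShift_apply_single {V : Type*} [AddCommGroup V] [Module R V] (x : σ → R)
    (w : (σ →₀ ℕ) → V) (q : σ) : linShift V x w (Finsupp.single q 1) = x q • w 0 := by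
  rw [linShift_apply, Finset.sum_eq_single q]
  · simp
  · intro p _ hp
    simp [hp.symm]
  · simp

lemma koszulDiff_eq_zero_of_forall {V : Type*} [AddCommGroup V] [Module R V] (i : σ → V →ₗ[R] V)
    {v : V} (hv : ∀ q, i q v = 0) : koszulDiff i (Pi.single 0 v) = 0 := by
  ext α
  rw [koszulDiff_apply]
  refine Finset.sum_eq_zero fun q _ => ?_
  by_cases h : α - Finsupp.single q 1 = 0
  · simp [h, hv]
  · simp [Pi.single_eq_of_ne h]

omit [Fintype σ] in
lemma single_mem_koszulComponent {V : Type*} [AddCommGroup V] [Module R V] {G : ℕ → Submodule R V}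
    {j : ℕ} {v : V} (hv : v ∈ G j) : Pi.single 0 v ∈ koszulComponent G σ j 0 := by
  intro α
  by_cases h : α = 0
  · subst h
    simp [hv]
  · simp [Pi.single_eq_of_ne h]

variable {δ : ℕ} {I : Ideal R} {ψ}

lemma koszulCycles_extTorsionLT (hm : m = δ + Fintype.card σ)
    (hI : I = Ideal.span {a | ∃ y : R, (∀ g : σ → R, y • g ∈ LinearMap.range ψ) ∧
      a = y ^ Fintype.card σ})
    (hExt : ExtTorsionLT (⊥ : Submonoid R) (R ⧸ I) (δ + 1) R) (k : ℕ) :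
    ∀ j, j + k = δ → 1 ≤ j →
      ExtTorsionLT (⊥ : Submonoid R) (R ⧸ I) (j + 1) (koszulCycles ψ j k) ∧
      (1 ≤ k → koszulCycles ψ j k ≤ (koszulComponent (extGrade R m) σ (j + 1) (k - 1)).map
        (koszulDiff (coordContract ψ))) := by
  induction k with
  | zero =>
    rintro j rfl hj
    refine ⟨?_, fun h => absurd h (by omega)⟩
    obtain ⟨vol, -, -, hκ⟩ := exists_cycle_generator ψ hm hj hI hExt
    obtain ⟨hκ0, hκG, hfaith, hgen⟩ := hκ _ rfl
    set κ := listComp (coordContract ψ) Finset.univ.toList vol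
    let φ : R →ₗ[R] ((σ →₀ ℕ) → ExteriorAlgebra R (Fin m → R)) :=
      LinearMap.single R _ 0 ∘ₗ LinearMap.toSpanSingleton R _ κ
    have hφ : Function.Injective φ := by
      rw [← LinearMap.ker_eq_bot, LinearMap.ker_eq_bot']
      intro r hr
      have := congrFun hr 0
      exact hfaith r (by simpa [φ] using this)
    have : koszulCycles ψ j 0 = LinearMap.range φ := by
      refine le_antisymm (fun z hz => ?_) ?_
      · obtain ⟨r, hr⟩ := hgen (z 0) (hz.1 0).1 (fun q => by
          have h1 := LinearMap.mem_ker.1 hz.2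
          rw [← koszulDiff_apply_single, h1, Pi.zero_apply])
        refine ⟨r, ?_⟩
        ext α
        by_cases h : α = 0
        · subst h
          simp [φ, hr]
        · rw [(hz.1 α).2 (by simpa [Finsupp.degree_eq_zero_iff] using h)]
          simp [φ, Pi.single_eq_of_ne h]
      · rintro _ ⟨r, rfl⟩
        refine ⟨single_mem_koszulComponent (Submodule.smul_mem _ _ hκG),
          koszulDiff_eq_zero_of_forall _ fun q => ?_⟩
        simp [hκ0]
    rw [this]
    exact hExt.of_linearEquiv (LinearEquiv.ofInjective _ hφ).symm
  | succ k ih =>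
    intro j hj hj1
    obtain ⟨h1, -⟩ := ih (j + 1) (by omega) (by omega)
    let K := koszulComponent (extGrade R m) σ (j + 1) k
    let d := koszulDiff (coordContract ψ)
    have hle : koszulCycles ψ (j + 1) k ≤ K := inf_le_left
    have hB : ExtTorsionLT (⊥ : Submonoid R) (R ⧸ I) (j + 1) (K.map d) := by
      refine ExtTorsionLT.of_exact (f := Submodule.inclusion hle) (q := d.submoduleMap K)
        (Submodule.inclusion_injective hle) (d.submoduleMap_surjective K) ?_ h1
        ((hExt.mono (by omega)).of_free)
      intro w
      constructor
      · intro hw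
        have : d w.1 = 0 := congrArg Subtype.val hw
        exact ⟨⟨w.1, w.2, this⟩, rfl⟩
      · rintro ⟨z, rfl⟩
        exact Subtype.ext (LinearMap.mem_ker.1 z.2.2)
    obtain ⟨g, rfl⟩ : ∃ g, j = g + 1 := ⟨j - 1, by omega⟩
    have hle2 : K.map d ≤ koszulCycles ψ (g + 1) (k + 1) := by
      rintro _ ⟨w, hw, rfl⟩
      exact ⟨koszulDiff_mem (coordContract_mem ψ) hw,
        koszulDiff_koszulDiff (coordContract_anticomm ψ) (coordContract_self ψ) w⟩
    have hle3 : koszulCycles ψ (g + 1) (k + 1) ≤ K.map d := by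
      intro z hz
      refine ExtTorsionLT.mem_of_forall_smul_mem_of_le (I := I) (hle2.trans inf_le_left) hB
        ((hExt.mono (by omega)).of_free) hz.1 (forall_smul_mem_of_le_span hI.le ?_)
      rintro a ⟨y, hy, rfl⟩
      obtain ⟨e, he1, he2, he3⟩ := exists_dual_coordContract ψ hy
      obtain ⟨w, hw, h⟩ := exists_koszulDiff_eq_pow_smul (coordContract_anticomm ψ)
        (coordContract_self ψ) he1 he2 (coordContract_mem ψ) (coordContract_eq_zero ψ) he3
        hz.1 (LinearMap.mem_ker.1 hz.2)
      exact ⟨w, hw, h⟩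
    refine ⟨?_, fun _ => hle3⟩
    rw [le_antisymm hle3 hle2]
    exact hB

/-- Lifting of multiplication by a linear form along the polynomial Koszul complex. -/
lemma exists_koszul_lift (hm : m = δ + Fintype.card σ)
    (hI : I = Ideal.span {a | ∃ y : R, (∀ g : σ → R, y • g ∈ LinearMap.range ψ) ∧
      a = y ^ Fintype.card σ})
    (hExt : ExtTorsionLT (⊥ : Submonoid R) (R ⧸ I) (δ + 1) R) {x : σ → R}
    (hx : ∀ w ∈ koszulComponent (extGrade R m) σ 0 (δ - 1),
      linShift _ x w ∈ (koszulComponent (extGrade R m) σ 1 (δ - 1)).map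
        (koszulDiff (coordContract ψ))) (i : ℕ) :
    ∀ k, i + k + 1 = δ → ∃ h : koszulComponent (extGrade R m) σ i k →ₗ[R]
      koszulComponent (extGrade R m) σ (i + 1) k,
      ∀ w, koszulDiff (coordContract ψ) w.1 = 0 →
        koszulDiff (coordContract ψ) (h w).1 = linShift _ x w.1 := by
  let d := koszulDiff (coordContract ψ)
  have lift : ∀ i k, ∀ φ : koszulComponent (extGrade R m) σ i k →ₗ[R]
      ((σ →₀ ℕ) → ExteriorAlgebra R (Fin m → R)),
      (∀ w, φ w ∈ (koszulComponent (extGrade R m) σ (i + 1) k).map d) →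
      ∃ h : koszulComponent (extGrade R m) σ i k →ₗ[R]
        koszulComponent (extGrade R m) σ (i + 1) k, ∀ w, d (h w).1 = φ w := by
    intro i k φ hφ
    obtain ⟨h, hh⟩ := Module.projective_lifting_property
      (d.submoduleMap (koszulComponent (extGrade R m) σ (i + 1) k)) (φ.codRestrict _ hφ)
      (d.submoduleMap_surjective _)
    exact ⟨h, fun w => congrArg Subtype.val (LinearMap.congr_fun hh w)⟩
  induction i with
  | zero =>
    intro k hk
    obtain rfl : k = δ - 1 := by omega
    obtain ⟨h, hh⟩ := lift 0 (δ - 1) (linShift _ x ∘ₗ Submodule.subtype _) (fun w => hx w.1 w.2)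
    exact ⟨h, fun w _ => hh w⟩
  | succ i ih =>
    intro k hk
    obtain ⟨h, hh⟩ := ih (k + 1) (by omega)
    let dK : koszulComponent (extGrade R m) σ (i + 1) k →ₗ[R]
        koszulComponent (extGrade R m) σ i (k + 1) :=
      d.restrict fun w hw => koszulDiff_mem (coordContract_mem ψ) hw
    have hdd : ∀ w, d (d w) = 0 :=
      koszulDiff_koszulDiff (coordContract_anticomm ψ) (coordContract_self ψ)
    have h2 := (koszulCycles_extTorsionLT hm hI hExt (k + 1) (i + 1) (by omega) (by omega)).2
      (by omega)
    obtain ⟨h', hh'⟩ := lift (i + 1) k (linShift _ x ∘ₗ Submodule.subtype _ -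
      Submodule.subtype _ ∘ₗ h ∘ₗ dK) (fun w => h2 ⟨sub_mem (linShift_mem w.2) (h (dK w)).2, by
        change d (linShift _ x w.1 - (h (dK w)).1) = 0
        have h3 : d (h (dK w)).1 = linShift _ x (d w.1) := hh (dK w) (hdd _)
        have h4 : d (linShift _ x w.1) = linShift _ x (d w.1) := koszulDiff_linShift _
        rw [map_sub, h3, h4, sub_self]⟩)
    refine ⟨h', fun w hw => ?_⟩
    have h5 : dK w = 0 := Subtype.ext hw
    refine (hh' w).trans ?_
    simp [h5]

/-- If multiplication by the linear form `x` maps the forms of degree `δ - 1` into the ideal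
generated by the columns of `ψ`, then `x` lies in the column space. -/
theorem mem_range_of_linShift_mem (hm : m = δ + Fintype.card σ) (hδ : 1 ≤ δ)
    (hI : I = Ideal.span {a | ∃ y : R, (∀ g : σ → R, y • g ∈ LinearMap.range ψ) ∧
      a = y ^ Fintype.card σ})
    (hExt : ExtTorsionLT (⊥ : Submonoid R) (R ⧸ I) (δ + 1) R) {x : σ → R}
    (hx : ∀ w ∈ koszulComponent (extGrade R m) σ 0 (δ - 1),
      linShift _ x w ∈ (koszulComponent (extGrade R m) σ 1 (δ - 1)).map
        (koszulDiff (coordContract ψ))) : x ∈ LinearMap.range ψ := by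
  obtain ⟨vol, hvol, hspan, hκ⟩ := exists_cycle_generator ψ hm hδ hI hExt
  obtain ⟨hκ0, hκG, hfaith, hgen⟩ := hκ _ rfl
  set l := (Finset.univ : Finset σ).toList with hl
  have hlen : l.length = Fintype.card σ := by simp [hl]
  have hnodup : l.Nodup := Finset.nodup_toList _
  have hmem : ∀ p, p ∈ l := by simp [hl]
  set κ := listComp (coordContract ψ) l vol with hκdef
  obtain ⟨g, rfl⟩ : ∃ g, δ = g + 1 := ⟨δ - 1, by omega⟩
  obtain ⟨n, rfl⟩ : ∃ n, m = n + 1 := ⟨m - 1, by omega⟩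
  have hn : n = g + l.length := by omega
  obtain ⟨h, hh⟩ := exists_koszul_lift hm hI hExt hx g 0 rfl
  let G := extGrade R (n + 1)
  let ec := listComp (coordContract ψ) l
  let dc := listCompDeriv (coordContract ψ) x l
  have hec : ∀ μ ∈ G n, ec μ ∈ G g := fun μ hμ =>
    listComp_mem (coordContract_mem ψ) l (by rwa [← hn])
  have hdc : ∀ μ ∈ G n, dc μ ∈ G (g + 1) := fun μ hμ =>
    listCompDeriv_mem (coordContract_mem ψ) l (by rwa [← hn])
  have hanti := coordContract_anticomm ψ
  have hself := coordContract_self ψ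
  let toK : G g →ₗ[R] koszulComponent G σ g 0 :=
    (LinearMap.single R (fun _ : σ →₀ ℕ => ExteriorAlgebra R (Fin (n + 1) → R)) 0 ∘ₗ
      (G g).subtype).codRestrict _
      fun v => single_mem_koszulComponent v.2
  let T : G n →ₗ[R] ExteriorAlgebra R (Fin (n + 1) → R) :=
    LinearMap.proj 0 ∘ₗ Submodule.subtype _ ∘ₗ h ∘ₗ toK ∘ₗ ec.restrict hec - dc ∘ₗ (G n).subtype
  have hT : ∀ μ : G n, ∃ r : R, T μ = r • κ := by
    intro μ
    refine hgen _ (sub_mem ((h _).2 0).1 (hdc _ μ.2)) fun q => ?_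
    have h1 := hh (toK (ec.restrict hec μ)) (koszulDiff_eq_zero_of_forall _ fun q =>
      apply_listComp_of_mem hanti hself (hmem q) _)
    have h2 := congrFun h1 (Finsupp.single q 1)
    rw [koszulDiff_apply_single, linShift_apply_single] at h2
    change coordContract ψ q ((h (toK (ec.restrict hec μ))).1 0 - dc μ) = 0
    rw [map_sub, h2, apply_listCompDeriv hanti hself hnodup (hmem q)]
    change x q • (Pi.single 0 (ec μ.1) : (σ →₀ ℕ) → _) 0 - _ = 0
    rw [Pi.single_eq_same, sub_self]
  have hinj : Function.Injective (LinearMap.toSpanSingleton R _ κ) := by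
    rw [← LinearMap.ker_eq_bot, LinearMap.ker_eq_bot']
    exact fun r hr => hfaith r (by simpa using hr)
  let k : G n →ₗ[R] R := (LinearEquiv.ofInjective _ hinj).symm.toLinearMap ∘ₗ
    T.codRestrict _ fun μ => (hT μ).imp fun r hr => by simpa using hr.symm
  have hk : ∀ μ, k μ • κ = T μ := fun μ =>
    congrArg Subtype.val ((LinearEquiv.ofInjective _ hinj).apply_symm_apply
      (T.codRestrict _ (fun μ => (hT μ).imp fun r hr => by simpa using hr.symm) μ))
  let c : Module.Dual R (Fin (n + 1) → R) →ₗ[R] G n :=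
    ((CliffordAlgebra.contractLeft (Q := (0 : QuadraticForm R (Fin (n + 1) → R)))).flip
      vol).codRestrict _ fun d => extContract_mem d hvol
  obtain ⟨f, hf⟩ := (Module.evalEquiv R (Fin (n + 1) → R)).surjective (k ∘ₗ c)
  have hfc : ∀ q, ψ f q = -((-1) ^ (l.length - 1) * x q) := by
    intro q
    have h1 := LinearMap.congr_fun hf (LinearMap.proj q ∘ₗ ψ)
    have h2 : ψ f q = k (c (LinearMap.proj q ∘ₗ ψ)) := h1
    rw [h2, ← sub_eq_zero]
    refine hfaith _ ?_
    rw [sub_smul, hk, sub_eq_zero]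
    have h3 : ec.restrict hec (c (LinearMap.proj q ∘ₗ ψ)) = 0 :=
      Subtype.ext (listComp_apply_of_mem hanti hself (hmem q) vol)
    have h4 : dc (c (LinearMap.proj q ∘ₗ ψ)).1 = ((-1 : R) ^ (l.length - 1) * x q) • κ :=
      listCompDeriv_apply hanti hself hnodup (hmem q) vol
    change ((h (toK (ec.restrict hec (c (LinearMap.proj q ∘ₗ ψ))))).1 0 -
      dc (c (LinearMap.proj q ∘ₗ ψ)).1) = _
    rw [h3, h4, map_zero, map_zero]
    simp
  refine ⟨(-(-1) ^ (l.length - 1) : R) • f, ?_⟩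
  ext q
  rw [map_smul, Pi.smul_apply, hfc, smul_eq_mul, neg_mul_neg, ← mul_assoc, ← mul_pow]
  simp

end KoszulDuality

section LinearForms

open MvPolynomial

/-- The linear form with given coefficients. -/
def linForm (R σ : Type*) [CommRing R] [Fintype σ] : (σ → R) →ₗ[R] MvPolynomial σ R :=
  Fintype.linearCombination R X

lemma linForm_apply {R σ : Type*} [CommRing R] [Fintype σ] (c : σ → R) :
    linForm R σ c = ∑ q, c q • X q := rfl

lemma coeff_linForm_mul {R σ : Type*} [CommRing R] [Fintype σ] [DecidableEq σ] (c : σ → R)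
    (s : MvPolynomial σ R) (α : σ →₀ ℕ) :
    coeff α (linForm R σ c * s) =
      ∑ q, if α q = 0 then 0 else c q * coeff (α - Finsupp.single q 1) s := by
  rw [linForm_apply, Finset.sum_mul, coeff_sum]
  refine Finset.sum_congr rfl fun q _ => ?_
  rw [smul_mul_assoc, coeff_smul, mul_comm, coeff_mul_X', smul_eq_mul]
  simp [Finsupp.mem_support_iff]

variable {R : Type u} [CommRing R] {m : ℕ} {σ : Type} [Fintype σ] [DecidableEq σ]
  {ψ : (Fin m → R) →ₗ[R] (σ → R)} {x : σ → R}

lemma linShift_mem_map_koszulDiff {k : ℕ}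
    (hx : ∀ s : MvPolynomial σ R, s.IsHomogeneous k → ∃ s' : Fin m → MvPolynomial σ R,
      (∀ j, (s' j).IsHomogeneous k) ∧
      linForm R σ x * s = ∑ j, linForm R σ (ψ (Pi.single j 1)) * s' j)
    (w : (σ →₀ ℕ) → ExteriorAlgebra R (Fin m → R))
    (hw : w ∈ koszulComponent (extGrade R m) σ 0 k) :
    linShift _ x w ∈ (koszulComponent (extGrade R m) σ 1 k).map
      (koszulDiff (coordContract ψ)) := by
  have h1 : ∀ α, ∃ r : R, algebraMap R _ r = w α := fun α => by
    have := (hw α).1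
    rwa [extGrade, ExteriorAlgebra.exteriorPower, pow_zero, Submodule.mem_one] at this
  choose r hr using h1
  have hfin : {α : σ →₀ ℕ | α.degree = k}.Finite :=
    (Finsupp.finite_of_degree_le (σ := σ) k).subset fun α h => le_of_eq h
  let s : MvPolynomial σ R := ∑ α ∈ hfin.toFinset, monomial α (r α)
  have hs : s.IsHomogeneous k := by
    refine IsHomogeneous.sum _ _ _ fun α hα => ?_
    refine isHomogeneous_monomial _ ?_
    simpa using hα
  have hcoeff : ∀ α, algebraMap R (ExteriorAlgebra R (Fin m → R)) (coeff α s) = w α := by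
    intro α
    by_cases h : α.degree = k
    · rw [← hr]
      congr 1
      simp [s, coeff_sum, coeff_monomial, h]
    · rw [hs.coeff_eq_zero (by simpa using h), (hw α).2 h, map_zero]
  obtain ⟨s', hs', heq⟩ := hx s hs
  refine ⟨fun α => ∑ j, coeff α (s' j) • ExteriorAlgebra.ι R (Pi.single j 1), fun α => ⟨?_, ?_⟩, ?_⟩
  · refine Submodule.sum_mem _ fun j _ => Submodule.smul_mem _ _ ?_
    rw [extGrade, ExteriorAlgebra.exteriorPower, pow_one]
    exact ⟨_, rfl⟩
  · intro h
    refine Finset.sum_eq_zero fun j _ => ?_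
    rw [(hs' j).coeff_eq_zero (by simpa using h), zero_smul]
  · have hι : ∀ q (f : Fin m → R), coordContract ψ q (ExteriorAlgebra.ι R f) =
        algebraMap R _ (ψ f q) := fun q f =>
      CliffordAlgebra.contractLeft_ι (Q := (0 : QuadraticForm R (Fin m → R))) _ f
    ext α
    have h2 := congrArg (algebraMap R (ExteriorAlgebra R (Fin m → R))) (congrArg (coeff α) heq)
    rw [coeff_linForm_mul, coeff_sum, map_sum, map_sum] at h2
    rw [koszulDiff_apply, linShift_apply]
    refine Eq.trans ?_ (h2.symm.trans ?_)
    · simp_rw [coeff_linForm_mul, map_sum]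
      rw [Finset.sum_comm]
      refine Finset.sum_congr rfl fun q _ => ?_
      split_ifs with h0
      · simp
      · refine Finset.sum_congr rfl fun j _ => ?_
        rw [map_smul, hι, Algebra.smul_def, ← map_mul, mul_comm]
    · refine Finset.sum_congr rfl fun q _ => ?_
      split_ifs with h0
      · simp
      · rw [map_mul, hcoeff, Algebra.smul_def]

/-- The multiplication criterion for membership in the column space, for forms. -/
theorem mem_range_of_linForm_mul {δ : ℕ} {I : Ideal R} (hm : m = δ + Fintype.card σ) (hδ : 1 ≤ δ)
    (hI : I = Ideal.span {a | ∃ y : R, (∀ g : σ → R, y • g ∈ LinearMap.range ψ) ∧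
      a = y ^ Fintype.card σ})
    (hExt : ExtTorsionLT (⊥ : Submonoid R) (R ⧸ I) (δ + 1) R)
    (hx : ∀ s : MvPolynomial σ R, s.IsHomogeneous (δ - 1) → ∃ s' : Fin m → MvPolynomial σ R,
      (∀ j, (s' j).IsHomogeneous (δ - 1)) ∧
      linForm R σ x * s = ∑ j, linForm R σ (ψ (Pi.single j 1)) * s' j) :
    x ∈ LinearMap.range ψ :=
  mem_range_of_linShift_mem hm hδ hI hExt (linShift_mem_map_koszulDiff hx)

end LinearForms

section SymmetricPower

open MvPolynomial

instance homogeneousSubmodule_free (R σ : Type*) [CommRing R] (n : ℕ) :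
    Module.Free R (homogeneousSubmodule σ R n) := by
  rw [homogeneousSubmodule_eq_finsupp_supported]
  exact Module.Free.of_equiv (AddMonoidAlgebra.supportedEquivFinsupp (R := R) (S := R) _).symm

instance homogeneousSubmodule_finite (R σ : Type*) [CommRing R] [Finite σ] (n : ℕ) :
    Module.Finite R (homogeneousSubmodule σ R n) :=
  Module.Finite.iff_fg.2 (homogeneousSubmodule_fg σ R n)

/-- A submodule containing all products of a variable with a form of degree `k` contains all forms
of degree `k + 1`. -/
lemma homogeneousSubmodule_succ_le {R σ : Type*} [CommRing R] {k : ℕ}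
    {N : Submodule R (MvPolynomial σ R)}
    (h : ∀ q, ∀ z ∈ homogeneousSubmodule σ R k, X q * z ∈ N) :
    homogeneousSubmodule σ R (k + 1) ≤ N := by
  classical
  intro z hz
  rw [← support_sum_monomial_coeff z]
  refine Submodule.sum_mem _ fun α hα => ?_
  have hdeg : α.degree = k + 1 := by
    by_contra hne
    exact (mem_support_iff.1 hα) (((mem_homogeneousSubmodule _ _).1 hz).coeff_eq_zero hne)
  have hα0 : α ≠ 0 := by
    rintro rfl
    simp at hdeg
  obtain ⟨q, hq⟩ := Finsupp.support_nonempty_iff.2 hα0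
  have hle : Finsupp.single q 1 ≤ α := by
    rw [Finsupp.single_le_iff]
    exact Nat.one_le_iff_ne_zero.2 (Finsupp.mem_support_iff.1 hq)
  have hα' : α = Finsupp.single q 1 + (α - Finsupp.single q 1) := (add_tsub_cancel_of_le hle).symm
  have : monomial α (coeff α z) =
      X q * monomial (α - Finsupp.single q 1) (coeff α z) := by
    rw [X, monomial_mul, one_mul, ← hα']
  rw [this]
  refine h q _ ((mem_homogeneousSubmodule _ _).2 (isHomogeneous_monomial _ ?_))
  have h2 := congrArg Finsupp.degree hα'
  rw [map_add, hdeg, Finsupp.degree_single] at h2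
  omega

lemma linForm_single {R σ : Type*} [CommRing R] [Fintype σ] [DecidableEq σ] (q : σ) :
    linForm R σ (Pi.single q 1) = X q := by
  simp [linForm_apply, Pi.single_apply]

lemma linForm_isHomogeneous {R σ : Type*} [CommRing R] [Fintype σ] (c : σ → R) :
    (linForm R σ c).IsHomogeneous 1 := by
  rw [linForm_apply]
  refine IsHomogeneous.sum _ _ _ fun q _ => ?_
  exact (homogeneousSubmodule σ R 1).smul_mem _ (isHomogeneous_X R q)

lemma linForm_mul_mem {R σ : Type*} [CommRing R] [Fintype σ] (c : σ → R) {k : ℕ}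
    {z : MvPolynomial σ R} (hz : z ∈ homogeneousSubmodule σ R k) :
    linForm R σ c * z ∈ homogeneousSubmodule σ R (k + 1) := by
  rw [mem_homogeneousSubmodule] at *
  rw [add_comm]
  exact (linForm_isHomogeneous c).mul hz

variable {R : Type u} [CommRing R] {σ ι : Type} [Fintype σ] [DecidableEq ι]

/-- The degree `k` component of the ideal generated by the linear forms `c i`, `i ∈ B`. -/
def symRel (c : ι → σ → R) (B : Finset ι) : ℕ → Submodule R (MvPolynomial σ R)
  | 0 => ⊥
  | k + 1 => ⨆ i ∈ B, (homogeneousSubmodule σ R k).map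
      (LinearMap.mulLeft R (linForm R σ (c i)))

variable {c : ι → σ → R} {B B' : Finset ι} {k : ℕ}

omit [DecidableEq ι] in
lemma symRel_succ_le {N : Submodule R (MvPolynomial σ R)} :
    symRel c B (k + 1) ≤ N ↔
      ∀ i ∈ B, ∀ z ∈ homogeneousSubmodule σ R k, linForm R σ (c i) * z ∈ N := by
  simp only [symRel, iSup_le_iff, Submodule.map_le_iff_le_comap]
  rfl

omit [DecidableEq ι] in
lemma linForm_mul_mem_symRel {i : ι} (hi : i ∈ B) {z : MvPolynomial σ R}
    (hz : z ∈ homogeneousSubmodule σ R k) : linForm R σ (c i) * z ∈ symRel c B (k + 1) :=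
  symRel_succ_le.1 le_rfl i hi z hz

omit [DecidableEq ι] in
lemma symRel_mono (h : B ⊆ B') : symRel c B k ≤ symRel c B' k := by
  cases k with
  | zero => exact bot_le
  | succ k => exact symRel_succ_le.2 fun i hi z hz => linForm_mul_mem_symRel (h hi) hz

omit [DecidableEq ι] in
lemma linForm_mul_mem_symRel_succ (d : σ → R) {z : MvPolynomial σ R} (hz : z ∈ symRel c B k) :
    linForm R σ d * z ∈ symRel c B (k + 1) := by
  cases k with
  | zero =>
    rw [(Submodule.mem_bot R).1 hz, mul_zero]
    exact zero_mem _
  | succ k =>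
    have : symRel c B (k + 1) ≤
        (symRel c B (k + 2)).comap (LinearMap.mulLeft R (linForm R σ d)) := by
      refine symRel_succ_le.2 fun i hi z hz => ?_
      rw [Submodule.mem_comap, LinearMap.mulLeft_apply, mul_left_comm]
      exact linForm_mul_mem_symRel hi (linForm_mul_mem _ hz)
    exact this hz

lemma symRel_insert_succ (i : ι) : symRel c (insert i B) (k + 1) = symRel c B (k + 1) ⊔
    (homogeneousSubmodule σ R k).map (LinearMap.mulLeft R (linForm R σ (c i))) := by
  rw [symRel, Finset.iSup_insert, sup_comm]
  rfl

/-- The columns `c a`, `a ∈ A`, can be simultaneously diagonalised away from the prime `p`. -/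
def IsPivotSet (c : ι → σ → R) (p : Ideal R) (A : Finset ι) : Prop :=
  ∃ s ∉ p, ∃ l : ι → (σ → R) →ₗ[R] R, ∀ a ∈ A, ∀ b ∈ A, l a (c b) = if a = b then s else 0

omit [Fintype σ] in
lemma IsPivotSet.mono {p : Ideal R} {A A' : Finset ι} (h : IsPivotSet c p A) (hA : A' ⊆ A) :
    IsPivotSet c p A' := by
  obtain ⟨s, hs, l, hl⟩ := h
  exact ⟨s, hs, l, fun a ha b hb => hl a (hA ha) b (hA hb)⟩

section Elimination

variable [DecidableEq σ]

/-- The endomorphism eliminating the pivot forms `c a`, `a ∈ A`. -/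
def pivotHom (c : ι → σ → R) (A : Finset ι) (s : R) (l : ι → (σ → R) →ₗ[R] R) :
    MvPolynomial σ R →ₐ[R] MvPolynomial σ R :=
  aeval fun q => s • X q - ∑ a ∈ A, l a (Pi.single q 1) • linForm R σ (c a)

variable {A : Finset ι} {s : R} {l : ι → (σ → R) →ₗ[R] R}

omit [DecidableEq ι] in
lemma pivotHom_linForm (d : σ → R) : pivotHom c A s l (linForm R σ d) =
    s • linForm R σ d - ∑ a ∈ A, l a d • linForm R σ (c a) := by
  have : (pivotHom c A s l).toLinearMap ∘ₗ linForm R σ =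
      s • linForm R σ - ∑ a ∈ A, (l a).smulRight (linForm R σ (c a)) := by
    refine LinearMap.pi_ext' fun q => LinearMap.ext_ring ?_
    simp [linForm_single, pivotHom, LinearMap.sum_apply]
  simpa [LinearMap.sum_apply] using LinearMap.congr_fun this d

omit [DecidableEq ι] in
lemma pivotHom_mem {z : MvPolynomial σ R} (hz : z ∈ homogeneousSubmodule σ R k) :
    pivotHom c A s l z ∈ homogeneousSubmodule σ R k := by
  rw [mem_homogeneousSubmodule] at *
  have := hz.aeval (S := R) (n := 1)
    (fun q => s • X q - ∑ a ∈ A, l a (Pi.single q 1) • linForm R σ (c a)) (fun q => ?_)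
  · rwa [one_mul] at this
  · refine Submodule.sub_mem (homogeneousSubmodule σ R 1)
      (Submodule.smul_mem _ _ (isHomogeneous_X R q)) (Submodule.sum_mem _ fun a _ =>
        Submodule.smul_mem _ _ (linForm_isHomogeneous _))

lemma pivotHom_sub_mem {z : MvPolynomial σ R} (hz : z ∈ homogeneousSubmodule σ R k) :
    pivotHom c A s l z - s ^ k • z ∈ symRel c A k := by
  induction k generalizing z with
  | zero =>
    rw [mem_homogeneousSubmodule] at hz
    rw [← totalDegree_zero_iff_isHomogeneous, totalDegree_eq_zero_iff_eq_C] at hz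
    rw [hz]
    simp [pivotHom]
  | succ k ih =>
    have : homogeneousSubmodule σ R (k + 1) ≤ (symRel c A (k + 1)).comap
        ((pivotHom c A s l).toLinearMap - s ^ (k + 1) • LinearMap.id) := by
      refine homogeneousSubmodule_succ_le fun q z hz => ?_
      rw [Submodule.mem_comap]
      have h1 : ((pivotHom c A s l).toLinearMap - s ^ (k + 1) • LinearMap.id :
          MvPolynomial σ R →ₗ[R] MvPolynomial σ R) (X q * z) =
          s • (linForm R σ (Pi.single q 1) * (pivotHom c A s l z - s ^ k • z)) -
            ∑ a ∈ A, l a (Pi.single q 1) • (linForm R σ (c a) * pivotHom c A s l z) := by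
        simp only [LinearMap.sub_apply, AlgHom.toLinearMap_apply, LinearMap.smul_apply,
          LinearMap.id_apply, map_mul]
        nth_rw 1 [← linForm_single q]
        rw [pivotHom_linForm, sub_mul, Finset.sum_mul, linForm_single, mul_sub, smul_sub,
          mul_smul_comm, ← mul_smul, ← pow_succ', smul_mul_assoc]
        simp only [smul_mul_assoc]
        abel
      rw [h1]
      exact Submodule.sub_mem _ (Submodule.smul_mem _ _ (linForm_mul_mem_symRel_succ _ (ih hz)))
        (Submodule.sum_mem _ fun a ha => Submodule.smul_mem _ _
          (linForm_mul_mem_symRel ha (pivotHom_mem hz)))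
    simpa using this hz

lemma pivotHom_eq_zero (hl : ∀ a ∈ A, ∀ b ∈ A, l a (c b) = if a = b then s else 0)
    {z : MvPolynomial σ R} (hz : z ∈ symRel c A k) : pivotHom c A s l z = 0 := by
  cases k with
  | zero => rw [(Submodule.mem_bot R).1 hz, map_zero]
  | succ k =>
    have : symRel c A (k + 1) ≤ LinearMap.ker (pivotHom c A s l).toLinearMap := by
      refine symRel_succ_le.2 fun i hi z _ => ?_
      rw [LinearMap.mem_ker, AlgHom.toLinearMap_apply, map_mul, pivotHom_linForm,
        Finset.sum_congr rfl (fun a ha => by rw [hl a ha i hi])]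
      simp [hi]
    exact this hz

end Elimination

/-- The degree `k` component of the symmetric algebra of the cokernel of the columns `c i`,
`i ∈ B`. -/
abbrev SymQuot (c : ι → σ → R) (B : Finset ι) (k : ℕ) : Type u :=
  homogeneousSubmodule σ R k ⧸ (symRel c B k).comap (homogeneousSubmodule σ R k).subtype

lemma extTorsionLT_symQuot_of_isPivotSet {p : Ideal R} [hp : p.IsPrime] {A : Finset ι}
    (h : IsPivotSet c p A) {N : Type u} [AddCommGroup N] [Module R N] {g : ℕ}
    (hExt : ExtTorsionLT p.primeCompl N g R) :
    ExtTorsionLT p.primeCompl N g (SymQuot c A k) := by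
  classical
  obtain ⟨s, hs, l, hl⟩ := h
  let S := homogeneousSubmodule σ R k
  let θ : S →ₗ[R] S := (pivotHom c A s l).toLinearMap.restrict fun z hz => pivotHom_mem hz
  let f : SymQuot c A k →ₗ[R] S := Submodule.liftQ _ θ (by
    intro z hz
    rw [LinearMap.mem_ker]
    exact Subtype.ext (pivotHom_eq_zero hl hz))
  refine ExtTorsionLT.of_comp_eq_smul f (Submodule.mkQ _) (s := s ^ k)
    (p.primeCompl.pow_mem hs k) ?_ hExt.of_free
  intro x
  obtain ⟨z, rfl⟩ := Submodule.Quotient.mk_surjective _ x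
  rw [← Submodule.Quotient.mk_smul]
  exact (Submodule.Quotient.eq _).2 (pivotHom_sub_mem z.2)

lemma extTorsionLT_symQuot_insert {i : ι} {P : Submonoid R} {N : Type u} [AddCommGroup N]
    [Module R N] {g : ℕ}
    (hreg : ∀ z ∈ homogeneousSubmodule σ R k,
      linForm R σ (c i) * z ∈ symRel c B (k + 1) → z ∈ symRel c B k)
    (h1 : ExtTorsionLT P N (g + 1) (SymQuot c B k))
    (h2 : ExtTorsionLT P N g (SymQuot c B (k + 1))) :
    ExtTorsionLT P N g (SymQuot c (insert i B) (k + 1)) := by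
  let μ : homogeneousSubmodule σ R k →ₗ[R] homogeneousSubmodule σ R (k + 1) :=
    (LinearMap.mulLeft R (linForm R σ (c i))).restrict fun z hz => linForm_mul_mem _ hz
  let f : SymQuot c B k →ₗ[R] SymQuot c B (k + 1) := Submodule.mapQ _ _ μ
    fun z hz => linForm_mul_mem_symRel_succ _ hz
  let q : SymQuot c B (k + 1) →ₗ[R] SymQuot c (insert i B) (k + 1) :=
    Submodule.mapQ _ _ LinearMap.id fun z hz =>
      symRel_mono (c := c) (k := k + 1) (Finset.subset_insert i B) hz
  refine ExtTorsionLT.of_exact (f := f) (q := q) ?_ ?_ ?_ h1 h2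
  · rw [← LinearMap.ker_eq_bot, eq_bot_iff]
    intro x hx
    obtain ⟨z, rfl⟩ := Submodule.Quotient.mk_surjective _ x
    have hx' : (Submodule.Quotient.mk (μ z) : SymQuot c B (k + 1)) = 0 := hx
    rw [Submodule.Quotient.mk_eq_zero] at hx'
    exact (Submodule.Quotient.mk_eq_zero _).2 (hreg z z.2 hx')
  · intro x
    obtain ⟨z, rfl⟩ := Submodule.Quotient.mk_surjective _ x
    exact ⟨Submodule.Quotient.mk z, rfl⟩
  · intro x
    obtain ⟨z, rfl⟩ := Submodule.Quotient.mk_surjective _ x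
    constructor
    · intro hx
      have hx' : (Submodule.Quotient.mk z : SymQuot c (insert i B) (k + 1)) = 0 := hx
      rw [Submodule.Quotient.mk_eq_zero, Submodule.mem_comap, symRel_insert_succ] at hx'
      obtain ⟨y, hy, _, ⟨w, hw, rfl⟩, hyw⟩ := Submodule.mem_sup.1 hx'
      refine ⟨Submodule.Quotient.mk ⟨w, hw⟩, ?_⟩
      refine (Submodule.Quotient.eq _).2 ?_
      rw [Submodule.mem_comap, ← Submodule.neg_mem_iff]
      have h4 : -((homogeneousSubmodule σ R (k + 1)).subtype (μ ⟨w, hw⟩ - z)) = y := by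
        rw [map_sub, ← hyw]
        change -(linForm R σ (c i) * w - (y + linForm R σ (c i) * w)) = y
        abel
      rw [h4]
      exact hy
    · rintro ⟨y, hy⟩
      obtain ⟨w, rfl⟩ := Submodule.Quotient.mk_surjective _ y
      rw [← hy]
      refine (Submodule.Quotient.mk_eq_zero _).2 ?_
      exact linForm_mul_mem_symRel (Finset.mem_insert_self _ _) w.2

omit [DecidableEq ι] in
lemma extTorsionLT_symQuot_zero {P : Submonoid R} {N : Type u} [AddCommGroup N] [Module R N]
    {g : ℕ} (h : ExtTorsionLT P N g (SymQuot c B 0)) : ExtTorsionLT P N g (SymQuot c B' 0) := h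

end SymmetricPower

section LinearType

open MvPolynomial

/-- An element outside a submodule has a multiple whose class has prime annihilator. -/
lemma exists_isPrime_forall_smul_mem_iff {R M : Type*} [CommRing R] [IsNoetherianRing R]
    [AddCommGroup M] [Module R M] {L : Submodule R M} {z : M} (hz : z ∉ L) :
    ∃ (r : R) (p : Ideal R), p.IsPrime ∧ ∀ a : R, a • r • z ∈ L ↔ a ∈ p := by
  let N := (Submodule.span R {z}).map L.mkQ
  have hzN : L.mkQ z ∈ N := ⟨z, Submodule.mem_span_singleton_self z, rfl⟩
  obtain ⟨p, hp, -⟩ := exists_le_isAssociatedPrime_of_isNoetherianRing R (⟨L.mkQ z, hzN⟩ : N)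
    (fun h => hz (by simpa using congrArg Subtype.val h))
  rw [isAssociatedPrime_iff] at hp
  obtain ⟨hprime, ⟨_, w, hw, rfl⟩, hcolon⟩ := hp
  obtain ⟨r, rfl⟩ := Submodule.mem_span_singleton.1 hw
  refine ⟨r, p, hprime, fun a => ?_⟩
  rw [hcolon, Submodule.mem_colon_singleton, Submodule.mem_bot, Subtype.ext_iff]
  change _ ↔ a • L.mkQ (r • z) = 0
  rw [← map_smul, Submodule.mkQ_apply, Submodule.Quotient.mk_eq_zero]

lemma pow_mul_eq_zero_of_linForm_mul {R : Type*} [CommRing R] {σ : Type*} [Fintype σ]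
    {d : σ → R} {k : ℕ} {y : MvPolynomial σ R} (hy : y ∈ homogeneousSubmodule σ R k)
    (h : linForm R σ d * y = 0) (q : σ) : d q ^ (k + 1) • y = 0 := by
  classical
  rw [mem_homogeneousSubmodule] at hy
  have key : ∀ j : ℕ, ∀ α : σ →₀ ℕ, k + 1 ≤ α q + j → d q ^ j * coeff α y = 0 := by
    intro j
    induction j with
    | zero =>
      intro α hα
      rw [hy.coeff_eq_zero, mul_zero]
      have := Finsupp.le_degree q α
      omega
    | succ j ih =>
      intro α hα
      have h1 := coeff_linForm_mul d y (α + Finsupp.single q 1)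
      rw [h, coeff_zero, ← Finset.add_sum_erase _ _ (Finset.mem_univ q)] at h1
      have h2 : d q ^ j * ∑ x ∈ Finset.univ.erase q,
          (if (α + Finsupp.single q 1 : σ →₀ ℕ) x = 0 then 0 else
            d x * coeff (α + Finsupp.single q 1 - Finsupp.single x 1) y) = 0 := by
        rw [Finset.mul_sum]
        refine Finset.sum_eq_zero fun x hx => ?_
        split_ifs
        · rw [mul_zero]
        · rw [mul_left_comm, ih, mul_zero]
          have hxq : x ≠ q := Finset.ne_of_mem_erase hx
          simp only [Finsupp.coe_tsub, Finsupp.coe_add, Pi.sub_apply, Pi.add_apply,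
            Finsupp.single_eq_same, Finsupp.single_apply, hxq, if_false]
          omega
      have h3 : (α + Finsupp.single q 1 : σ →₀ ℕ) q ≠ 0 := by simp
      rw [if_neg h3, add_tsub_cancel_right] at h1
      have h4 := congrArg (fun t => d q ^ j * t) h1
      simp only [mul_zero, mul_add, h2, add_zero] at h4
      rw [pow_succ, mul_assoc, ← h4]
  ext α
  rw [coeff_smul, coeff_zero, smul_eq_mul]
  exact key _ _ (by omega)

variable {R : Type u} [CommRing R] [IsNoetherianRing R] {σ ι : Type} [Fintype σ] [DecidableEq σ]
  [DecidableEq ι] {c : ι → σ → R} {B : Finset ι} {δ : ℕ}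

/-- At every prime of height at most `δ` the columns `c i`, `i ∈ B`, can be diagonalised except for
fewer columns than the height. -/
def HasPivots (c : ι → σ → R) (δ : ℕ) (B : Finset ι) : Prop :=
  ∀ p : Ideal R, p.IsPrime → p.height ≤ δ → ∃ A ⊆ B, IsPivotSet c p A ∧
    (p.height = 0 → A = B) ∧ (p.height ≠ 0 → ((B \ A).card : ℕ∞) + 1 ≤ p.height)

omit [Fintype σ] in
omit [IsNoetherianRing R] [DecidableEq σ] in
lemma HasPivots.mono (h : HasPivots c δ B) {B' : Finset ι} (hB : B' ⊆ B) : HasPivots c δ B' := by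
  intro p hp hh
  obtain ⟨A, hA, hpiv, h0, h1⟩ := h p hp hh
  refine ⟨B' ∩ A, Finset.inter_subset_left, hpiv.mono Finset.inter_subset_right, ?_, ?_⟩
  · intro h
    rw [h0 h]
    exact Finset.inter_eq_left.2 hB
  · intro h
    refine le_trans ?_ (h1 h)
    have hsub : B' \ (B' ∩ A) ⊆ B \ A := by
      intro x
      simp only [Finset.mem_sdiff, Finset.mem_inter]
      exact fun hx => ⟨hB hx.1, fun hxA => hx.2 ⟨hx.1, hxA⟩⟩
    gcongr

lemma mem_symRel_of_linForm_mul_mem {i : ι} (hi : i ∉ B) (hpiv : HasPivots c δ (insert i B))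
    (hB : ∀ k ≤ δ, ∀ p : Ideal R, p.IsPrime → ∀ z ∈ homogeneousSubmodule σ R k,
      (∀ a : R, a • z ∈ symRel c B k ↔ a ∈ p) → p.height = 0) {k : ℕ} (hk : k ≤ δ)
    {z : MvPolynomial σ R} (hz : z ∈ homogeneousSubmodule σ R k)
    (hiz : linForm R σ (c i) * z ∈ symRel c B (k + 1)) : z ∈ symRel c B k := by
  by_contra hzL
  obtain ⟨r, p, hp, hann⟩ := exists_isPrime_forall_smul_mem_iff hzL
  have hw : r • z ∈ homogeneousSubmodule σ R k := Submodule.smul_mem _ _ hz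
  have hiw : linForm R σ (c i) * (r • z) ∈ symRel c B (k + 1) := by
    rw [mul_smul_comm]
    exact Submodule.smul_mem _ _ hiz
  generalize r • z = w at hw hann hiw
  have hht := hB k hk p hp w hw hann
  obtain ⟨A, -, hA, hAB, -⟩ := hpiv p hp (by simp [hht])
  obtain rfl := hAB hht
  obtain ⟨s, hs, l, hl⟩ := hA
  have hlB : ∀ a ∈ B, ∀ b ∈ B, l a (c b) = if a = b then s else 0 := fun a ha b hb =>
    hl a (Finset.mem_insert_of_mem ha) b (Finset.mem_insert_of_mem hb)
  have h1 := pivotHom_eq_zero hlB hiw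
  rw [map_mul, pivotHom_linForm, Finset.sum_eq_zero, sub_zero, smul_mul_assoc,
    ← mul_smul_comm] at h1
  swap
  · intro a ha
    rw [hl a (Finset.mem_insert_of_mem ha) i (Finset.mem_insert_self _ _), if_neg, zero_smul]
    rintro rfl
    exact hi ha
  have h2 : l i (c i) = s := by
    rw [hl i (Finset.mem_insert_self _ _) i (Finset.mem_insert_self _ _), if_pos rfl]
  obtain ⟨q, hq⟩ : ∃ q, c i q ∉ p := by
    by_contra! hcon
    refine hs ?_
    rw [← h2, LinearMap.pi_apply_eq_sum_univ (l i) (c i)]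
    exact Submodule.sum_mem _ fun q _ => by
      rw [smul_eq_mul]; exact p.mul_mem_right _ (hcon q)
  have h3 := pow_mul_eq_zero_of_linForm_mul (Submodule.smul_mem _ _ (pivotHom_mem hw)) h1 q
  have h4 : (c i q ^ (k + 1) * s * s ^ k) • w ∈ symRel c B k := by
    have h5 := Submodule.smul_mem _ (c i q ^ (k + 1) * s)
      (pivotHom_sub_mem (c := c) (A := B) (s := s) (l := l) hw)
    rw [smul_sub, mul_smul, h3, zero_sub, Submodule.neg_mem_iff, ← mul_smul] at h5
    exact h5
  rw [hann] at h4
  have hpow : ∀ {x : R} {n : ℕ}, x ∉ p → x ^ n ∉ p := fun hx h => hx (hp.mem_of_pow_mem _ h)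
  rcases hp.mem_or_mem h4 with h | h
  · rcases hp.mem_or_mem h with h | h
    · exact hpow hq h
    · exact hs h
  · exact hpow hs h

lemma height_eq_zero_of_smul_mem_symRel_iff
    (hExt : ∀ p : Ideal R, p.IsPrime → ∀ (P : Submonoid R) (g : ℕ), (g : ℕ∞) ≤ p.height →
      ExtTorsionLT P (R ⧸ p) g R)
    (hpiv : HasPivots c δ B) : ∀ k ≤ δ, ∀ p : Ideal R, p.IsPrime →
      ∀ z ∈ homogeneousSubmodule σ R k,
      (∀ a : R, a • z ∈ symRel c B k ↔ a ∈ p) → p.height = 0 := by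
  induction B using Finset.strongInduction with
  | H B IH =>
  have hreg : ∀ (B' : Finset ι) (i : ι), i ∉ B' → insert i B' ⊆ B → ∀ k ≤ δ,
      ∀ z ∈ homogeneousSubmodule σ R k, linForm R σ (c i) * z ∈ symRel c B' (k + 1) →
        z ∈ symRel c B' k := by
    intro B' i hi hB' k hk z hz hiz
    have hss : B' ⊂ B := Finset.ssubset_of_ssubset_of_subset (Finset.ssubset_insert hi) hB'
    exact mem_symRel_of_linForm_mul_mem hi (hpiv.mono hB') (IH B' hss (hpiv.mono hss.1)) hk hz hiz
  intro k hk p hp z hz hann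
  have hcontra : ¬ ExtTorsionLT p.primeCompl (R ⧸ p) 1 (SymQuot c B k) := by
    intro hE
    obtain ⟨s, hs, h⟩ := hE.exists_smul_eq_zero_of_quotient one_pos
      (Submodule.Quotient.mk ⟨z, hz⟩) (fun a ha => by
        rw [← Submodule.Quotient.mk_smul, Submodule.Quotient.mk_eq_zero]
        exact (hann a).2 ha)
    rw [← Submodule.Quotient.mk_smul, Submodule.Quotient.mk_eq_zero] at h
    exact hs ((hann s).1 h)
  have hle : p.height ≤ k := by
    have D : ∀ B' ⊆ B, ∀ k ≤ δ, ∀ g : ℕ, ((g + k : ℕ) : ℕ∞) ≤ p.height →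
        ExtTorsionLT p.primeCompl (R ⧸ p) g (SymQuot c B' k) := by
      intro B' 
      induction B' using Finset.induction_on with
      | empty =>
        intro _ k _ g hg
        refine extTorsionLT_symQuot_of_isPivotSet ⟨1, ?_, 0, by simp⟩
          (hExt p hp _ _ (le_trans (Nat.cast_le.2 (by omega)) hg))
        exact fun h => hp.ne_top ((Ideal.eq_top_iff_one p).2 h)
      | insert i B' hi ih =>
        intro hB' k hk g hg
        have hB'' : B' ⊆ B := (Finset.subset_insert _ _).trans hB'
        cases k with
        | zero => exact extTorsionLT_symQuot_zero (ih hB'' 0 hk g hg)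
        | succ k =>
          exact extTorsionLT_symQuot_insert (hreg B' i hi hB' k (by omega))
            (ih hB'' k (by omega) (g + 1) (le_trans (Nat.cast_le.2 (by omega)) hg))
            (ih hB'' (k + 1) hk g hg)
    by_contra! hlt
    exact hcontra (D B subset_rfl k hk 1 (by
      have := Order.add_one_le_of_lt hlt
      push_cast
      rwa [add_comm]))
  obtain ⟨A, hA, hpivA, -, hcard⟩ := hpiv p hp (hle.trans (by exact_mod_cast hk))
  by_contra h0
  have D : ∀ C ⊆ B \ A, ∀ k ≤ δ, ∀ g : ℕ, ((g + C.card : ℕ) : ℕ∞) ≤ p.height →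
      ExtTorsionLT p.primeCompl (R ⧸ p) g (SymQuot c (A ∪ C) k) := by
    intro C
    induction C using Finset.induction_on with
    | empty =>
      intro _ k _ g hg
      rw [Finset.union_empty]
      exact extTorsionLT_symQuot_of_isPivotSet hpivA
        (hExt p hp _ _ (le_trans (Nat.cast_le.2 (by omega)) hg))
    | insert i C hi ih =>
      intro hC k hk g hg
      rw [Finset.card_insert_of_notMem hi] at hg
      have hC' : C ⊆ B \ A := (Finset.subset_insert _ _).trans hC
      have hiA := hC (Finset.mem_insert_self _ _)
      rw [Finset.mem_sdiff] at hiA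
      rw [Finset.union_insert]
      have h1 := ih hC' k hk g (le_trans (Nat.cast_le.2 (by omega)) hg)
      cases k with
      | zero => exact extTorsionLT_symQuot_zero h1
      | succ k =>
        refine extTorsionLT_symQuot_insert (hreg (A ∪ C) i ?_ ?_ k (by omega))
            (ih hC' k (by omega) (g + 1) (le_trans (Nat.cast_le.2 (by omega)) hg)) h1
        · simp [hi, hiA.2]
        · refine Finset.insert_subset hiA.1 (Finset.union_subset hA ?_)
          exact hC'.trans Finset.sdiff_subset
  have h2 := D (B \ A) subset_rfl k hk 1 (by
    rw [add_comm]; push_cast; exact hcard h0)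
  rw [Finset.union_sdiff_of_subset hA] at h2
  exact hcontra h2

/-- Under the pivot condition the symmetric algebra is torsion-free in degrees at most `δ`. -/
theorem mem_symRel_of_smul_mem
    (hExt : ∀ p : Ideal R, p.IsPrime → ∀ (P : Submonoid R) (g : ℕ), (g : ℕ∞) ≤ p.height →
      ExtTorsionLT P (R ⧸ p) g R)
    (hpiv : HasPivots c δ B) {k : ℕ} (hk : k ≤ δ) {z : MvPolynomial σ R}
    (hz : z ∈ homogeneousSubmodule σ R k) {a : R} (ha : a ∈ nonZeroDivisors R)
    (haz : a • z ∈ symRel c B k) : z ∈ symRel c B k := by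
  by_contra hzL
  obtain ⟨r, p, hp, hann⟩ := exists_isPrime_forall_smul_mem_iff hzL
  have h0 := height_eq_zero_of_smul_mem_symRel_iff hExt hpiv k hk p hp (r • z)
    (Submodule.smul_mem _ _ hz) hann
  rw [Ideal.height_eq_zero_iff] at h0
  refine notMem_nonZeroDivisors_of_mem_mem_minimalPrimes ((hann a).1 ?_) h0 ha
  rw [smul_comm]
  exact Submodule.smul_mem _ _ haz

end LinearType

section Pivots

variable {R : Type u} [CommRing R] {σ ι : Type} [DecidableEq ι]

/-- The residual of a vector after elimination of the pivot columns `c a`, `a ∈ A`. -/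
def pivotResidual (c : ι → σ → R) (A : Finset ι) (s : R) (l : ι → (σ → R) →ₗ[R] R) :
    (σ → R) →ₗ[R] (σ → R) :=
  s • LinearMap.id - ∑ a ∈ A, (l a).smulRight (c a)

variable {c : ι → σ → R} {A : Finset ι} {s : R} {l : ι → (σ → R) →ₗ[R] R}

omit [DecidableEq ι] in
lemma pivotResidual_apply (d : σ → R) :
    pivotResidual c A s l d = s • d - ∑ a ∈ A, l a d • c a := by
  simp [pivotResidual, LinearMap.sum_apply]

lemma pivotResidual_eq_zero (hl : ∀ a ∈ A, ∀ b ∈ A, l a (c b) = if a = b then s else 0) {b : ι}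
    (hb : b ∈ A) : pivotResidual c A s l (c b) = 0 := by
  rw [pivotResidual_apply, Finset.sum_congr rfl fun a ha => by rw [hl a ha b hb]]
  simp [hb]

/-- Every pivot set extends to one with residual columns vanishing modulo `p`. -/
lemma IsPivotSet.exists_maximal [Finite ι] {p : Ideal R} [hp : p.IsPrime] {A₀ : Finset ι}
    (h : IsPivotSet c p A₀) : ∃ A, A₀ ⊆ A ∧ ∃ s ∉ p, ∃ l : ι → (σ → R) →ₗ[R] R,
      (∀ a ∈ A, ∀ b ∈ A, l a (c b) = if a = b then s else 0) ∧
      ∀ b q, pivotResidual c A s l (c b) q ∈ p := by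
  have := Fintype.ofFinite ι
  obtain ⟨A, hA₀, hmax⟩ := (Set.toFinite {A | IsPivotSet c p A}).exists_le_maximal h
  refine ⟨A, hA₀, ?_⟩
  obtain ⟨s, hs, l, hl⟩ := hmax.prop
  refine ⟨s, hs, l, hl, ?_⟩
  by_contra! hcon
  obtain ⟨b, q, hq⟩ := hcon
  have hb : b ∉ A := by
    intro hb
    rw [pivotResidual_eq_zero hl hb] at hq
    exact hq p.zero_mem
  let w := pivotResidual c A s l (c b) q
  let r : (σ → R) →ₗ[R] R := (LinearMap.proj q).comp (pivotResidual c A s l)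
  have hr : ∀ a ∈ A, r (c a) = 0 := fun a ha => by
    simp [r, pivotResidual_eq_zero hl ha]
  have hrb : r (c b) = w := rfl
  have hins : IsPivotSet c p (insert b A) := by
    refine ⟨w * s, fun h => (hp.mem_or_mem h).elim hq hs,
      fun a => if a = b then s • r else w • l a - l a (c b) • r, ?_⟩
    intro a ha a' ha'
    by_cases hab : a = b
    · subst hab
      by_cases hab' : a' = a
      · subst hab'
        simp [hrb, mul_comm]
      · have := hr a' ((Finset.mem_insert.1 ha').resolve_left hab')
        simp [this, Ne.symm hab']
    · have haA := (Finset.mem_insert.1 ha).resolve_left hab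
      by_cases hab' : a' = b
      · subst hab'
        simp [hab, hrb, mul_comm]
      · have haA' := (Finset.mem_insert.1 ha').resolve_left hab'
        simp [hab, hr a' haA', hl a haA a' haA']
  exact hb (hmax.le_of_ge hins (Finset.subset_insert b A) (Finset.mem_insert_self b A))

omit [DecidableEq ι] in
lemma isPivotSet_empty [DecidableEq ι] {p : Ideal R} [hp : p.IsPrime] : IsPivotSet c p ∅ :=
  ⟨1, fun h => hp.ne_top ((Ideal.eq_top_iff_one p).2 h), 0, by simp⟩

end Pivots

section Nakayama

/-- A form of Nakayama's lemma at a prime `p`. -/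
lemma exists_smul_mem_of_smul_mem_sup {R M : Type*} [CommRing R] [AddCommGroup M] [Module R M]
    {p : Ideal R} [hp : p.IsPrime] {N T : Submodule R M} (hT : T.FG) {s : R} (hs : s ∉ p)
    (h : ∀ x ∈ T, s • x ∈ N ⊔ p • T) : ∃ s' ∉ p, ∀ x ∈ T, s' • x ∈ N := by
  let Q := T.map N.mkQ
  have hQ : Module.Finite R Q := Module.Finite.iff_fg.2 (hT.map _)
  obtain ⟨P, hmonic, -, hcoeff, hP⟩ :=
    LinearMap.exists_monic_and_natDegree_eq_and_coeff_mem_pow_and_aeval_eq_zero R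
      (algebraMap R (Module.End R Q) s) p (by
      rintro _ ⟨⟨_, x, hx, rfl⟩, rfl⟩
      rw [Submodule.mem_smul_top_iff]
      change s • N.mkQ x ∈ _
      rw [← map_smul]
      obtain ⟨n, hn, y, hy, hxy⟩ := Submodule.mem_sup.1 (h x hx)
      rw [← hxy, map_add, Submodule.mkQ_apply, (Submodule.Quotient.mk_eq_zero _).2 hn, zero_add,
        ← Submodule.map_smul'']
      exact ⟨y, hy, rfl⟩)
  refine ⟨P.eval s, ?_, fun x hx => ?_⟩
  · intro hmem
    rw [Polynomial.eval_eq_sum_range, Finset.sum_range_succ, hmonic.coeff_natDegree,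
      one_mul] at hmem
    refine hs (hp.mem_of_pow_mem P.natDegree ((Submodule.add_mem_iff_right _ ?_).1 hmem))
    refine Submodule.sum_mem _ fun i hi => p.mul_mem_right _ ?_
    exact Ideal.pow_le_self (by have := Finset.mem_range.1 hi; omega) (hcoeff i)
  · have h1 : Polynomial.aeval (algebraMap R (Module.End R Q) s) P =
        algebraMap R (Module.End R Q) (P.eval s) := by
      rw [Polynomial.aeval_algebraMap_apply, Polynomial.aeval_def, Polynomial.eval₂_eq_eval_map,
        Algebra.algebraMap_self, Polynomial.map_id]
    rw [h1] at hP
    have h2 := congrArg Subtype.val (LinearMap.congr_fun hP ⟨N.mkQ x, x, hx, rfl⟩)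
    change P.eval s • N.mkQ x = 0 at h2
    rwa [← map_smul, Submodule.mkQ_apply, Submodule.Quotient.mk_eq_zero] at h2

end Nakayama

section ReesAlgebraBasics

open MvPolynomial

variable {R : Type u} [CommRing R] {E : Type u} [AddCommGroup E] [Module R E] {e : ℕ}
  (b : LocalizedModule (nonZeroDivisors R) E ≃ₗ[FractionRing R] (Fin e → FractionRing R))

/-- The coordinates of an element of `E` in the given trivialization of `E ⊗ Q`. -/
def fracCoord : E →ₗ[R] (Fin e → FractionRing R) :=
  (b.toLinearMap.restrictScalars R) ∘ₗ LocalizedModule.mkLinearMap (nonZeroDivisors R) E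

/-- The map `reesMap` as a linear map. -/
def reesLin : E →ₗ[R] MvPolynomial (Fin e) (FractionRing R) :=
  ((linForm (FractionRing R) (Fin e)).restrictScalars R) ∘ₗ fracCoord b

lemma reesLin_apply (x : E) : reesLin b x = reesMap e b x := by
  simp [reesLin, linForm_apply, reesMap, fracCoord, smul_eq_C_mul]

lemma coe_reesLin : (reesLin b : E → _) = reesMap e b := funext (reesLin_apply b)

lemma reesComponent_eq (t : ℕ) : reesComponent e b t = LinearMap.range (reesLin b) ^ t := by
  rw [reesComponent, ← coe_reesLin, ← LinearMap.coe_range, Submodule.span_eq]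

lemma span_reesMap_image (U : Submodule R E) :
    Submodule.span R (reesMap e b '' (U : Set E)) = U.map (reesLin b) := by
  rw [← coe_reesLin, ← Submodule.map_coe, Submodule.span_eq]

lemma exists_smul_eq_zero_of_fracCoord {x : E} (hx : fracCoord b x = 0) :
    ∃ a ∈ nonZeroDivisors R, a • x = 0 := by
  have h : LocalizedModule.mkLinearMap (nonZeroDivisors R) E x = 0 := by
    apply b.injective
    rw [map_zero]
    exact hx
  obtain ⟨a, ha⟩ := (IsLocalizedModule.eq_zero_iff (nonZeroDivisors R)
    (LocalizedModule.mkLinearMap (nonZeroDivisors R) E)).1 h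
  exact ⟨a, a.2, ha⟩

lemma exists_fracCoord_eq_smul (y : Fin e → FractionRing R) :
    ∃ a ∈ nonZeroDivisors R, ∃ x, fracCoord b x = a • y := by
  obtain ⟨⟨x, a⟩, h⟩ := IsLocalizedModule.surj (nonZeroDivisors R)
    (LocalizedModule.mkLinearMap (nonZeroDivisors R) E) (b.symm y)
  refine ⟨a, a.2, x, ?_⟩
  have := congrArg b h
  change b ((a : R) • b.symm y) = _ at this
  rw [← IsScalarTower.algebraMap_smul (FractionRing R) (a : R) (b.symm y), map_smul,
    LinearEquiv.apply_symm_apply, IsScalarTower.algebraMap_smul] at this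
  exact this.symm

end ReesAlgebraBasics

section Presentation

variable {R : Type u} [CommRing R] {E : Type u} [AddCommGroup E] [Module R E] {e n m : ℕ}
  {f : (Fin n → R) →ₗ[R] (Fin m → R)} {g : (Fin m → R) →ₗ[R] E}

/-- The columns of a linear map between finite free modules. -/
def cols (f : (Fin n → R) →ₗ[R] (Fin m → R)) (i : Fin n) : Fin m → R := f (Pi.single i 1)

lemma range_eq_span_cols : LinearMap.range f = Submodule.span R (Set.range (cols f)) := by
  have : f = Fintype.linearCombination R (cols f) := by
    refine LinearMap.pi_ext' fun q => LinearMap.ext_ring ?_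
    simp [cols]
  rw [← Fintype.range_linearCombination, ← this]

lemma card_eq_add_of_trivialization [Nontrivial R]
    (b : LocalizedModule (nonZeroDivisors R) E ≃ₗ[FractionRing R] (Fin e → FractionRing R))
    (hf : Function.Injective f) (hg : Function.Surjective g)
    (hfg : LinearMap.range f = LinearMap.ker g) : m = n + e := by
  let S := nonZeroDivisors R
  have hinj := LocalizedModule.map_injective S f hf
  have hsurj := LocalizedModule.map_surjective S g hg
  have hex : Function.Exact (LocalizedModule.map S f) (LocalizedModule.map S g) :=
    LocalizedModule.map_exact S f g (LinearMap.exact_iff.2 hfg.symm)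
  have h1 : Module.finrank (Localization S) (LocalizedModule S (Fin n → R)) = n := by
    rw [Module.finrank_of_isLocalizedModule_of_free (Localization S) S
      (LocalizedModule.mkLinearMap S (Fin n → R)), Module.finrank_fin_fun]
  have h2 : Module.finrank (Localization S) (LocalizedModule S (Fin m → R)) = m := by
    rw [Module.finrank_of_isLocalizedModule_of_free (Localization S) S
      (LocalizedModule.mkLinearMap S (Fin m → R)), Module.finrank_fin_fun]
  have h3 : Module.finrank (Localization S) (LocalizedModule S E) = e := by
    rw [LinearEquiv.finrank_eq b, Module.finrank_fin_fun]
  have hproj : Module.Projective (Localization S) (LocalizedModule S E) :=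
    Module.Projective.of_equiv b.symm
  have hfree : Module.Free (Localization S) (LocalizedModule S E) := Module.Free.of_equiv b.symm
  have hfin : Module.Finite (Localization S) (LocalizedModule S E) := Module.Finite.equiv b.symm
  have hfree' : Module.Free (Localization S) (LocalizedModule S (Fin n → R)) :=
    Module.free_of_isLocalizedModule S (LocalizedModule.mkLinearMap S (Fin n → R))
  have hfin' : Module.Finite (Localization S) (LocalizedModule S (Fin n → R)) :=
    Module.Finite.of_isLocalizedModule S (LocalizedModule.mkLinearMap S (Fin n → R))
  obtain ⟨σ, hσ⟩ := Module.projective_lifting_property (LocalizedModule.map S g)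
    LinearMap.id hsurj
  obtain ⟨eqv, -⟩ := hex.splitSurjectiveEquiv hinj ⟨σ, hσ⟩
  rw [← h2, LinearEquiv.finrank_eq eqv, Module.finrank_prod, h1, h3]

lemma le_card_add_card_of_span_eq_top (hg : Function.Surjective g)
    (hfg : LinearMap.range f = LinearMap.ker g) {p : Ideal R} [hp : p.IsPrime]
    {A : Finset (Fin n)} {s : R} (hs : s ∉ p) {l : Fin n → (Fin m → R) →ₗ[R] R}
    (hres : ∀ b q, pivotResidual (cols f) A s l (cols f b) q ∈ p)
    {T : Finset (LocalizedModule p.primeCompl E)}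
    (hT : Submodule.span (Localization.AtPrime p) (T : Set (LocalizedModule p.primeCompl E)) = ⊤) :
    m ≤ A.card + T.card := by
  let mk := LocalizedModule.mkLinearMap p.primeCompl E
  have h1 : ∀ t : T, ∃ (x : Fin m → R) (u : p.primeCompl), u • (t : LocalizedModule _ _) =
      mk (g x) := by
    intro t
    obtain ⟨⟨y, u⟩, h⟩ := IsLocalizedModule.surj p.primeCompl mk t
    obtain ⟨x, rfl⟩ := hg y
    exact ⟨x, u, h⟩
  choose x u hxu using h1
  let N : Submodule R (Fin m → R) := Submodule.span R (Set.range x)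
  have hloc : Submodule.localized' (Localization.AtPrime p) p.primeCompl mk (N.map g) = ⊤ := by
    rw [← top_le_iff, ← hT, Submodule.span_le]
    intro t ht
    refine (Submodule.mem_localized' _ _ _ _ _).2
      ⟨g (x ⟨t, ht⟩), ⟨_, Submodule.subset_span ⟨_, rfl⟩, rfl⟩, u ⟨t, ht⟩, ?_⟩
    rw [IsLocalizedModule.mk'_eq_iff]
    exact (hxu ⟨t, ht⟩).symm
  have h2 : ∀ z : Fin m → R, ∃ w ∉ p, w • z ∈ N ⊔ LinearMap.range f := by
    intro z
    have hz : mk (g z) ∈ Submodule.localized' (Localization.AtPrime p) p.primeCompl mk (N.map g) := by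
      rw [hloc]
      trivial
    obtain ⟨_, ⟨y, hy, rfl⟩, w, hw⟩ := (Submodule.mem_localized' _ _ _ _ _).1 hz
    rw [IsLocalizedModule.mk'_eq_iff] at hw
    have hw' : mk (g y) = mk ((w : R) • g z) := by rw [map_smul]; exact hw
    obtain ⟨v, hv⟩ := (IsLocalizedModule.eq_iff_exists p.primeCompl mk).1 hw'
    refine ⟨v * w, (v * w).2, ?_⟩
    have hker : ((v : R) * w) • z - (v : R) • y ∈ LinearMap.range f := by
      rw [hfg, LinearMap.mem_ker, map_sub, map_smul, map_smul, mul_smul, sub_eq_zero]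
      exact hv.symm
    rw [show ((v : R) * w) • z = (v : R) • y + (((v : R) * w) • z - (v : R) • y) by abel]
    exact Submodule.add_mem_sup (N.smul_mem _ hy) hker
  let κ := p.ResidueField
  let red : (Fin m → R) →ₗ[R] (Fin m → κ) := (Algebra.linearMap R κ).compLeft (Fin m)
  have hred : ∀ z q, red z q = algebraMap R κ (z q) := fun z q => rfl
  let v : A ⊕ T → (Fin m → κ) := Sum.elim (fun a => red (cols f a)) (fun t => red (x t))
  let V := Submodule.span κ (Set.range v)
  let V' : Submodule R (Fin m → R) := (V.restrictScalars R).comap red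
  have hinv : ∀ w ∉ p, ∀ z, w • z ∈ V' → z ∈ V' := by
    intro w hw z hz
    have hw' : algebraMap R κ w ≠ 0 := by rwa [Ne, Ideal.algebraMap_residueField_eq_zero]
    have hz' : w • red z ∈ V := by
      have : red (w • z) ∈ V := hz
      rwa [map_smul] at this
    rw [← algebraMap_smul κ w (red z)] at hz'
    have h : red z ∈ V := (Submodule.smul_mem_iff V hw').1 hz'
    exact h
  have hN : N ≤ V' := Submodule.span_le.2 (by
    rintro _ ⟨t, rfl⟩
    exact Submodule.subset_span ⟨Sum.inr t, rfl⟩)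
  have hA : ∀ a ∈ A, cols f a ∈ V' := fun a ha => Submodule.subset_span ⟨Sum.inl ⟨a, ha⟩, rfl⟩
  have hf : LinearMap.range f ≤ V' := by
    rw [range_eq_span_cols, Submodule.span_le]
    rintro _ ⟨i, rfl⟩
    refine hinv s hs _ ?_
    have h3 : pivotResidual (cols f) A s l (cols f i) ∈ V' := by
      have : red (pivotResidual (cols f) A s l (cols f i)) = 0 := by
        ext q
        rw [hred, Ideal.algebraMap_residueField_eq_zero.2 (hres i q), Pi.zero_apply]
      change red _ ∈ V
      rw [this]
      exact V.zero_mem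
    rw [pivotResidual_apply] at h3
    exact (Submodule.sub_mem_iff_left _
      (Submodule.sum_mem _ fun a ha => Submodule.smul_mem _ _ (hA a ha))).1 h3
  have hV : V = ⊤ := by
    rw [eq_top_iff, ← (Pi.basisFun κ (Fin m)).span_eq, Submodule.span_le]
    rintro _ ⟨q, rfl⟩
    obtain ⟨w, hw, h⟩ := h2 (Pi.single q 1)
    have h4 : red (Pi.single q 1) ∈ V := hinv w hw _ (sup_le hN hf h)
    have h5 : red (Pi.single q 1) = Pi.basisFun κ (Fin m) q := by
      ext j
      simp [hred, Pi.single_apply, apply_ite (algebraMap R κ)]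
    rw [← h5]
    exact h4
  have := finrank_le_of_span_eq_top hV
  rwa [Module.finrank_fin_fun, Fintype.card_sum, Fintype.card_coe, Fintype.card_coe] at this

/-- The columns of a presentation satisfy the pivot condition when the cokernel satisfies the
condition `G`. -/
theorem hasPivots_cols [IsNoetherianRing R] (hf : Function.Injective f)
    (hg : Function.Surjective g) (hfg : LinearMap.range f = LinearMap.ker g) (hm : m = n + e)
    {δ : ℕ}
    (hGs : ∀ (p : Ideal R) (hp : p.IsPrime), 1 ≤ dimAt p hp →
      dimAt p hp + (e : WithBot ℕ∞) ≤ ((δ + e : ℕ) : WithBot ℕ∞) →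
      haveI := hp
      ((mu (Localization.AtPrime p) (LocalizedModule p.primeCompl E) : ℕ∞) : WithBot ℕ∞) + 1 ≤
        dimAt p hp + (e : WithBot ℕ∞)) :
    HasPivots (cols f) δ Finset.univ := by
  intro p hp hδ
  obtain ⟨A, -, s, hs, l, hl, hres⟩ :=
    (isPivotSet_empty (c := cols f) (p := p)).exists_maximal
  refine ⟨A, Finset.subset_univ _, ⟨s, hs, l, hl⟩, ?_, ?_⟩
  · intro h0
    by_contra hA
    obtain ⟨i, hi⟩ : ∃ i, i ∉ A := by
      by_contra! hcon
      exact hA (Finset.eq_univ_iff_forall.2 hcon)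
    rw [Ideal.height_eq_zero_iff] at h0
    have hass : IsAssociatedPrime p R := by
      refine Module.associatedPrimes.minimalPrimes_annihilator_subset_associatedPrimes R R ?_
      rwa [(Module.annihilator_eq_bot).2 inferInstance]
    rw [isAssociatedPrime_iff] at hass
    obtain ⟨-, x, hx⟩ := hass
    have hx' : ∀ a, a ∈ p ↔ a * x = 0 := fun a => by
      rw [hx, Submodule.mem_colon_singleton, Submodule.mem_bot, smul_eq_mul]
    let ε : Fin n → R := s • Pi.single i 1 - ∑ a ∈ A, l a (cols f i) • Pi.single a 1
    have hε : f ε = pivotResidual (cols f) A s l (cols f i) := by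
      simp only [ε, map_sub, map_sum, map_smul]
      rw [pivotResidual_apply]
      rfl
    have h1 : f (x • ε) = 0 := by
      rw [map_smul, hε]
      ext q
      rw [Pi.smul_apply, smul_eq_mul, mul_comm]
      exact (hx' _).1 (hres i q)
    have h2 := congrFun (hf (h1.trans (map_zero f).symm)) i
    have h3 : ε i = s := by
      have : ∑ a ∈ A, l a (cols f i) • (Pi.single a (1 : R) : Fin n → R) i = 0 := by
        refine Finset.sum_eq_zero fun a ha => ?_
        have : i ≠ a := by rintro rfl; exact hi ha
        simp [this]
      simp only [ε, Pi.sub_apply, Finset.sum_apply, Pi.smul_apply] at this ⊢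
      rw [this]
      simp
    rw [Pi.smul_apply, h3, smul_eq_mul, mul_comm] at h2
    exact hs ((hx' s).2 h2)
  · intro h0
    have hdim : dimAt p hp = (p.height : WithBot ℕ∞) :=
      IsLocalization.AtPrime.ringKrullDim_eq_height p (Localization.AtPrime p)
    obtain ⟨h, hh⟩ := ENat.ne_top_iff_exists.1
      (ne_top_of_le_ne_top (ENat.natCast_ne_top δ) hδ)
    have hmu := hGs p hp
    rw [hdim, ← hh] at hmu
    rw [← hh] at hδ h0 ⊢
    norm_cast at hδ h0
    have hmu' := hmu (by exact_mod_cast Nat.one_le_iff_ne_zero.2 h0)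
      (by exact_mod_cast Nat.add_le_add_right hδ e)
    have hmu2 : mu (Localization.AtPrime p) (LocalizedModule p.primeCompl E) + 1 ≤
        ((h + e : ℕ) : ℕ∞) := by exact_mod_cast hmu'
    have hne : {n : ℕ∞ | ∃ s : Finset (LocalizedModule p.primeCompl E), (s.card : ℕ∞) = n ∧
        Submodule.span (Localization.AtPrime p)
          (s : Set (LocalizedModule p.primeCompl E)) = ⊤}.Nonempty := by
      by_contra hemp
      rw [Set.not_nonempty_iff_eq_empty] at hemp
      rw [mu, hemp, sInf_empty, top_add] at hmu2
      exact absurd hmu2 (not_le.2 (ENat.natCast_lt_top _))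
    obtain ⟨T, hT, hspan⟩ := csInf_mem hne
    rw [mu, ← hT] at hmu2
    have h5 := le_card_add_card_of_span_eq_top hg hfg hs hres hspan
    have hcard : (Finset.univ \ A).card + A.card = n := by
      rw [Finset.card_sdiff_add_card_eq_card (Finset.subset_univ A), Finset.card_univ,
        Fintype.card_fin]
    norm_cast at hmu2 ⊢
    omega

end Presentation

section SupportOfQuotient

variable {R : Type u} [CommRing R] {E : Type u} [AddCommGroup E] [Module R E] {e n m : ℕ}
  {f : (Fin n → R) →ₗ[R] (Fin m → R)} {g : (Fin m → R) →ₗ[R] E}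

/-- Either `W` equals `E` at the prime `p`, or there is a linear form detecting the difference
which kills a given set of pivot columns. -/
lemma exists_smul_mem_or_exists_linearForm [IsNoetherianRing R] (hg : Function.Surjective g)
    (hfg : LinearMap.range f = LinearMap.ker g) {p : Ideal R} [hp : p.IsPrime]
    {A : Finset (Fin n)} (hA : IsPivotSet (cols f) p A) (W : Submodule R E) :
    (∃ s ∉ p, ∀ x, s • x ∈ W) ∨ ∃ (φ : (Fin m → R) →ₗ[R] R) (y : Fin m → R), φ y ∉ p ∧
      (∀ z, g z ∈ W → φ z ∈ p) ∧ ∀ a ∈ A, φ (cols f a) = 0 := by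
  let N := W.comap g
  obtain ⟨k, d, hd⟩ := Submodule.fg_iff_exists_fin_generating_family.1 (IsNoetherian.noetherian N)
  let c : Fin n ⊕ Fin k → Fin m → R := Sum.elim (cols f) d
  have hcN : ∀ i, c i ∈ N := by
    rintro (i | i)
    · have : g (f (Pi.single i 1)) = 0 := by
        rw [← LinearMap.mem_ker, ← hfg]
        exact ⟨_, rfl⟩
      change g (f (Pi.single i 1)) ∈ W
      rw [this]
      exact W.zero_mem
    · rw [← hd]
      exact Submodule.subset_span ⟨i, rfl⟩
  have hA₀ : IsPivotSet c p (A.map Function.Embedding.inl) := by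
    obtain ⟨s, hs, l, hl⟩ := hA
    refine ⟨s, hs, Sum.elim l 0, ?_⟩
    simp only [Finset.mem_map, forall_exists_index, and_imp]
    rintro _ a ha rfl _ a' ha' rfl
    simpa [c] using hl a ha a' ha'
  obtain ⟨A', hAA', s, hs, l, hl, hres⟩ := hA₀.exists_maximal
  by_cases hall : ∀ q' q, pivotResidual c A' s l (Pi.single q' 1) q ∈ p
  · left
    have hx : ∀ x, s • x ∈ N ⊔ p • (⊤ : Submodule R (Fin m → R)) := by
      intro x
      have h1 : ∀ q, pivotResidual c A' s l x q ∈ p := by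
        intro q
        have h := congrFun (congrArg (pivotResidual c A' s l) (pi_eq_sum_univ' x)) q
        rw [h, map_sum, Finset.sum_apply]
        refine Submodule.sum_mem _ fun q' _ => ?_
        rw [map_smul, Pi.smul_apply]
        have h2 := hall q' q
        refine p.mul_mem_left _ ?_
        convert h2 using 3
      have h3 : pivotResidual c A' s l x ∈ p • (⊤ : Submodule R (Fin m → R)) := by
        rw [pi_eq_sum_univ' (pivotResidual c A' s l x)]
        exact Submodule.sum_mem _ fun q _ => Submodule.smul_mem_smul (h1 q) trivial
      have h4 : s • x = ∑ a ∈ A', l a x • c a + pivotResidual c A' s l x := by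
        rw [pivotResidual_apply]
        abel
      rw [h4]
      exact Submodule.add_mem_sup
        (Submodule.sum_mem _ fun a _ => N.smul_mem _ (hcN a)) h3
    obtain ⟨s', hs', h⟩ := exists_smul_mem_of_smul_mem_sup
      (IsNoetherian.noetherian (⊤ : Submodule R (Fin m → R))) hs fun x _ => hx x
    refine ⟨s', hs', fun x => ?_⟩
    obtain ⟨y, rfl⟩ := hg x
    rw [← map_smul]
    exact h y trivial
  · right
    push Not at hall
    obtain ⟨q', q, hq⟩ := hall
    refine ⟨(LinearMap.proj q).comp (pivotResidual c A' s l), _, hq, fun z hz => ?_, fun a ha => ?_⟩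
    · have hz' : z ∈ Submodule.span R (Set.range d) := hd.symm ▸ hz
      have h5 : Submodule.span R (Set.range d) ≤
          Submodule.comap ((LinearMap.proj q).comp (pivotResidual c A' s l)) p := by
        rw [Submodule.span_le]
        rintro _ ⟨i, rfl⟩
        exact hres (Sum.inr i) q
      exact h5 hz'
    · have := pivotResidual_eq_zero hl (hAA' (Finset.mem_map_of_mem Function.Embedding.inl ha))
      change pivotResidual c A' s l (cols f a) q = 0
      exact congrFun this q

section Rees

open MvPolynomial

variable (b : LocalizedModule (nonZeroDivisors R) E ≃ₗ[FractionRing R] (Fin e → FractionRing R))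

/-- A linear form on `E` extends to an evaluation of the ambient polynomial ring. -/
lemma exists_aeval_reesLin_eq (φ : E →ₗ[R] R) :
    ∃ ev : MvPolynomial (Fin e) (FractionRing R) →ₐ[R] FractionRing R,
      ∀ x, ev (reesLin b x) = algebraMap R (FractionRing R) (φ x) := by
  let S := nonZeroDivisors R
  let Φ : LocalizedModule S E →ₗ[FractionRing R] FractionRing R :=
    IsLocalizedModule.mapExtendScalars S (LocalizedModule.mkLinearMap S E)
      (Algebra.linearMap R (FractionRing R)) (FractionRing R) φ
  refine ⟨(aeval fun i => Φ (b.symm (Pi.single i 1))).restrictScalars R, fun x => ?_⟩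
  have h1 : ∀ c : Fin e → FractionRing R,
      aeval (fun i => Φ (b.symm (Pi.single i 1))) (linForm (FractionRing R) (Fin e) c) =
        Φ (b.symm c) := by
    intro c
    conv_rhs => rw [pi_eq_sum_univ' c]
    simp only [linForm_apply, map_sum, map_smul, aeval_X]
  change aeval _ (linForm (FractionRing R) (Fin e) (b (LocalizedModule.mkLinearMap S E x))) = _
  rw [h1, LinearEquiv.symm_apply_apply]
  exact IsLocalizedModule.map_apply S (LocalizedModule.mkLinearMap S E)
    (Algebra.linearMap R (FractionRing R)) φ x

lemma mem_of_smul_pow_mem {φ : E →ₗ[R] R} {p : Ideal R} {W : Submodule R E}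
    (hW : ∀ w ∈ W, φ w ∈ p) {x : E} {s : R} {k r : ℕ}
    (h : s • reesLin b x ^ k ∈ W.map (reesLin b) * LinearMap.range (reesLin b) ^ r) :
    s * φ x ^ k ∈ p := by
  obtain ⟨ev, hev⟩ := exists_aeval_reesLin_eq b φ
  have h1 : (LinearMap.range (reesLin b) ^ r).map ev.toLinearMap ≤ 1 := by
    rw [Submodule.map_pow]
    refine (pow_le_pow_left' ?_ r).trans (one_pow r).le
    rintro _ ⟨_, ⟨z, rfl⟩, rfl⟩
    exact Submodule.mem_one.2 ⟨φ z, (hev z).symm⟩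
  have h2 : W.map (reesLin b) * LinearMap.range (reesLin b) ^ r ≤
      (Submodule.map (Algebra.linearMap R (FractionRing R)) p).comap ev.toLinearMap := by
    rw [Submodule.mul_le]
    rintro _ ⟨w, hw, rfl⟩ z hz
    obtain ⟨y, hy⟩ := Submodule.mem_one.1 (h1 ⟨z, hz, rfl⟩)
    refine ⟨y * φ w, p.mul_mem_left y (hW w hw), ?_⟩
    change _ = ev (reesLin b w * z)
    change _ = ev z at hy
    rw [Algebra.linearMap_apply, map_mul, map_mul, hev, ← hy, mul_comm]
  obtain ⟨y, hy, hyx⟩ := h2 h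
  change _ = ev (s • reesLin b x ^ k) at hyx
  rw [map_smul, map_pow, hev, Algebra.smul_def, ← map_pow, ← map_mul,
    Algebra.linearMap_apply] at hyx
  rwa [← IsFractionRing.injective R (FractionRing R) hyx]

/-- If `E` is integral over `W` at a prime `p` of small height, then `W` equals `E` at `p`. -/
theorem exists_smul_mem_of_smul_mem_rees [IsNoetherianRing R] (hg : Function.Surjective g)
    (hfg : LinearMap.range f = LinearMap.ker g) {δ : ℕ}
    (hpiv : HasPivots (cols f) δ Finset.univ) (h : ℕ) :
    ∀ p : Ideal R, p.IsPrime → p.height = h → h ≤ δ → ∀ W : Submodule R E,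
      (∃ r, ∃ s ∉ p, ∀ z ∈ LinearMap.range (reesLin b) ^ (r + 1),
        s • z ∈ W.map (reesLin b) * LinearMap.range (reesLin b) ^ r) →
      ∃ s ∉ p, ∀ x, s • x ∈ W := by
  induction h using Nat.strong_induction_on with
  | _ h ih =>
  intro p hp hph hδ W hW
  obtain ⟨A, -, hA, hA0, hA1⟩ := hpiv p hp (by rw [hph]; exact_mod_cast hδ)
  refine (exists_smul_mem_or_exists_linearForm hg hfg hA W).resolve_right ?_
  rintro ⟨φ, y, hy, hφW, hφA⟩
  obtain ⟨r, s, hs, hr⟩ := hW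
  by_cases h0 : p.height = 0
  · have hφf : LinearMap.ker g ≤ LinearMap.ker φ := by
      rw [← hfg, range_eq_span_cols, Submodule.span_le]
      rintro _ ⟨i, rfl⟩
      exact hφA i (hA0 h0 ▸ Finset.mem_univ i)
    let φ' : E →ₗ[R] R :=
      ((LinearMap.ker g).liftQ φ hφf) ∘ₗ (g.quotKerEquivOfSurjective hg).symm.toLinearMap
    have hφ' : ∀ z, φ' (g z) = φ z := by
      intro z
      have : (g.quotKerEquivOfSurjective hg).symm (g z) = Submodule.Quotient.mk z := by
        rw [LinearEquiv.symm_apply_eq]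
        rfl
      simp [φ', this]
    have h1 := hr (reesLin b (g y) ^ (r + 1)) (Submodule.pow_mem_pow _ (LinearMap.mem_range_self _ _) _)
    have h2 := mem_of_smul_pow_mem b (φ := φ') (p := p) (W := W) (fun w hw => by
      obtain ⟨z, rfl⟩ := hg w
      rw [hφ']
      exact hφW z hw) h1
    rw [hφ'] at h2
    exact (hp.mem_or_mem h2).elim hs fun h3 => hy (hp.mem_of_pow_mem _ h3)
  · let I : Ideal R := Ideal.span ((fun i => φ (cols f i)) '' ((Finset.univ \ A : Finset (Fin n)) : Set (Fin n)))
    have hφI : ∀ c, φ (f c) ∈ I := by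
      have : LinearMap.range f ≤ Submodule.comap φ I := by
        rw [range_eq_span_cols, Submodule.span_le]
        rintro _ ⟨i, rfl⟩
        by_cases hi : i ∈ A
        · change φ (cols f i) ∈ I
          rw [hφA i hi]
          exact I.zero_mem
        · exact Ideal.subset_span ⟨i, by simpa using hi, rfl⟩
      exact fun c => this ⟨c, rfl⟩
    have hIp : I ≤ p := by
      rw [Ideal.span_le]
      rintro _ ⟨i, -, rfl⟩
      refine hφW _ ?_
      have : g (cols f i) = 0 := by
        rw [← LinearMap.mem_ker, ← hfg]
        exact ⟨_, rfl⟩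
      rw [this]
      exact W.zero_mem
    obtain ⟨q, hq, hqp⟩ := Ideal.exists_minimalPrimes_le hIp
    have hq' : q.IsPrime := hq.1.1
    have hqht : q.height ≤ ((Finset.univ \ A).card : ℕ∞) := by
      refine (Ideal.height_le_card_of_mem_minimalPrimes_span
        ((Finset.finite_toSet _).image _) hq).trans ?_
      refine (Nat.cast_le.2 (Set.ncard_image_le (Finset.finite_toSet _))).trans ?_
      rw [Set.ncard_coe_finset]
    have h1 := hA1 h0
    rw [hph] at h1
    obtain ⟨k, hk⟩ := ENat.ne_top_iff_exists.1
      (ne_top_of_le_ne_top (ENat.natCast_ne_top _) hqht)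
    rw [← hk] at hqht
    norm_cast at h1 hqht
    have hW' : ∃ r, ∃ s ∉ p, ∀ z ∈ LinearMap.range (reesLin b) ^ (r + 1),
        s • z ∈ ((LinearMap.ker φ).map g).map (reesLin b) * LinearMap.range (reesLin b) ^ r := by
      have hfin : Module.Finite R E := Module.Finite.of_surjective g hg
      refine ⟨r, exists_smul_mem_of_smul_mem_sup (s := φ y * s)
        ((Module.Finite.iff_fg.1 inferInstance).pow _)
        (fun h3 => (hp.mem_or_mem h3).elim hy hs) fun z hz => ?_⟩
      have h4 : W.map (reesLin b) * LinearMap.range (reesLin b) ^ r ≤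
          (((LinearMap.ker φ).map g).map (reesLin b) * LinearMap.range (reesLin b) ^ r ⊔
            p • LinearMap.range (reesLin b) ^ (r + 1)).comap (LinearMap.lsmul R _ (φ y)) := by
        rw [Submodule.mul_le]
        rintro _ ⟨w, hw, rfl⟩ v hv
        obtain ⟨x, rfl⟩ := hg w
        have h5 : φ y • reesLin b (g x) = reesLin b (g (φ y • x - φ x • y)) +
            φ x • reesLin b (g y) := by
          simp only [map_sub, map_smul]
          abel
        rw [Submodule.mem_comap, LinearMap.lsmul_apply, ← smul_mul_assoc, h5, add_mul, smul_mul_assoc]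
        refine Submodule.add_mem_sup (Submodule.mul_mem_mul ⟨_, ⟨_, ?_, rfl⟩, rfl⟩ hv)
          (Submodule.smul_mem_smul (hφW x hw) ?_)
        · simp [mul_comm]
        · rw [pow_succ']
          exact Submodule.mul_mem_mul ⟨_, rfl⟩ hv
      rw [mul_smul]
      exact h4 (hr z hz)
    obtain ⟨r', s', hs', hr'⟩ := hW'
    obtain ⟨s'', hs'', hE⟩ := ih k (by omega) q hq' hk.symm (by omega) _
      ⟨r', s', fun h3 => hs' (hqp h3), hr'⟩
    obtain ⟨z, hz, hzy⟩ := hE (g y)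
    have h6 : s'' • y - z ∈ LinearMap.range f := by
      rw [hfg, LinearMap.mem_ker, map_sub, map_smul, hzy, sub_self]
    obtain ⟨c, hc⟩ := h6
    have h7 := hq.1.2 (hφI c)
    rw [hc, map_sub, map_smul, LinearMap.mem_ker.1 hz, sub_zero] at h7
    exact (hq'.mem_or_mem h7).elim hs'' fun h8 => hy (hqp h8)

end Rees

end SupportOfQuotient

section ReesTorsion

open MvPolynomial

lemma aeval_smul_of_mem_homogeneousSubmodule {R S σ : Type*} [CommRing R] [CommRing S] [Algebra R S]
    {k : ℕ} {z : MvPolynomial σ R} (hz : z ∈ homogeneousSubmodule σ R k) (a : R) (y : σ → S) :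
    aeval (fun q => a • y q) z = a ^ k • aeval y z := by
  rw [aeval_def, aeval_def, eval₂_eq, eval₂_eq, Finset.smul_sum]
  refine Finset.sum_congr rfl fun d hd => ?_
  have h : ∑ i ∈ d.support, d i = k := by
    have := (mem_homogeneousSubmodule k z).1 hz (mem_support_iff.1 hd)
    rwa [Finsupp.weight_apply, Finsupp.sum, Finset.sum_congr rfl fun i _ => by
      rw [Pi.one_apply, smul_eq_mul, mul_one]] at this
  simp only [smul_pow]
  rw [← h, Finset.prod_smul, Finset.prod_pow_eq_pow_sum, mul_smul_comm]

lemma exists_mem_nonZeroDivisors_forall {R ι : Type*} [CommRing R] [Fintype ι] {P : ι → R → Prop}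
    (hP : ∀ i a c, P i a → P i (c * a)) (h : ∀ i, ∃ a ∈ nonZeroDivisors R, P i a) :
    ∃ a ∈ nonZeroDivisors R, ∀ i, P i a := by
  classical
  choose a ha hPa using h
  refine ⟨∏ i, a i, Submonoid.prod_mem _ fun i _ => ha i, fun i => ?_⟩
  rw [← Finset.prod_erase_mul _ _ (Finset.mem_univ i)]
  exact hP _ _ _ (hPa i)

variable {R : Type u} [CommRing R] {σ ι : Type} [Fintype σ] [DecidableEq ι]

omit [DecidableEq ι] in
lemma linForm_mul_mem_symRel_of_mem_span {c : ι → σ → R} {B : Finset ι} {d : σ → R}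
    (hd : d ∈ Submodule.span R (c '' B)) {k : ℕ} {z : MvPolynomial σ R}
    (hz : z ∈ homogeneousSubmodule σ R k) : linForm R σ d * z ∈ symRel c B (k + 1) := by
  have : Submodule.span R (c '' B) ≤ (symRel c B (k + 1)).comap
      ((LinearMap.mulRight R z).comp (linForm R σ)) := by
    rw [Submodule.span_le]
    rintro _ ⟨i, hi, rfl⟩
    exact linForm_mul_mem_symRel hi hz
  exact this hd

lemma aeval_linForm_sub_smul_mem_symRel {c : ι → σ → R} {B : Finset ι} [DecidableEq σ]
    {φ : σ → σ → R} {a : R}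
    (hφ : ∀ q, φ q - a • Pi.single q 1 ∈ Submodule.span R (c '' B)) {k : ℕ}
    {z : MvPolynomial σ R} (hz : z ∈ homogeneousSubmodule σ R k) :
    aeval (fun q => linForm R σ (φ q)) z - a ^ k • z ∈ symRel c B k := by
  induction k generalizing z with
  | zero =>
    rw [mem_homogeneousSubmodule, ← totalDegree_zero_iff_isHomogeneous,
      totalDegree_eq_zero_iff_eq_C] at hz
    rw [hz]
    simp
  | succ k ih =>
    have : homogeneousSubmodule σ R (k + 1) ≤ (symRel c B (k + 1)).comap
        ((aeval fun q => linForm R σ (φ q)).toLinearMap - a ^ (k + 1) • LinearMap.id) := by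
      refine homogeneousSubmodule_succ_le fun q z hz => ?_
      rw [Submodule.mem_comap]
      have hmem : aeval (fun q => linForm R σ (φ q)) z ∈ homogeneousSubmodule σ R k := by
        have := ((mem_homogeneousSubmodule k z).1 hz).aeval (S := R) (n := 1)
          (fun q => linForm R σ (φ q)) (fun q => linForm_isHomogeneous _)
        rwa [one_mul] at this
      have h1 : ((aeval fun q => linForm R σ (φ q)).toLinearMap - a ^ (k + 1) • LinearMap.id :
          MvPolynomial σ R →ₗ[R] MvPolynomial σ R) (X q * z) =
          a • (linForm R σ (Pi.single q 1) *
            (aeval (fun q => linForm R σ (φ q)) z - a ^ k • z)) +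
            linForm R σ (φ q - a • Pi.single q 1) * aeval (fun q => linForm R σ (φ q)) z := by
        simp only [LinearMap.sub_apply, AlgHom.toLinearMap_apply, LinearMap.smul_apply,
          LinearMap.id_apply, map_mul, aeval_X, map_sub, map_smul, linForm_single]
        simp only [smul_eq_C_mul, map_pow]
        ring
      rw [h1]
      exact Submodule.add_mem _ (Submodule.smul_mem _ _ (linForm_mul_mem_symRel_succ _ (ih hz)))
        (linForm_mul_mem_symRel_of_mem_span (hφ q) hmem)
    simpa using this hz

variable {E : Type u} [AddCommGroup E] [Module R E] {e n m : ℕ}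
  {f : (Fin n → R) →ₗ[R] (Fin m → R)} {g : (Fin m → R) →ₗ[R] E}
  (b : LocalizedModule (nonZeroDivisors R) E ≃ₗ[FractionRing R] (Fin e → FractionRing R))

/-- The kernel of the map from the polynomial ring to the Rees algebra is the torsion of the
symmetric algebra. -/
theorem exists_smul_mem_symRel (hg : Function.Surjective g)
    (hfg : LinearMap.range f = LinearMap.ker g) {k : ℕ} {z : MvPolynomial (Fin m) R}
    (hz : z ∈ homogeneousSubmodule (Fin m) R k)
    (h0 : aeval (fun q => reesLin b (g (Pi.single q 1))) z = 0) :
    ∃ a ∈ nonZeroDivisors R, a • z ∈ symRel (cols f) Finset.univ k := by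
  obtain ⟨D, hD, hx⟩ : ∃ D ∈ nonZeroDivisors R, ∀ i : Fin e, ∃ x, fracCoord b (g x) =
      D • Pi.single i (1 : FractionRing R) := by
    refine exists_mem_nonZeroDivisors_forall ?_ fun i => ?_
    · rintro i a c ⟨x, hx⟩
      exact ⟨c • x, by rw [map_smul, map_smul, hx, mul_smul]⟩
    · obtain ⟨a, ha, x, hx⟩ := exists_fracCoord_eq_smul b (Pi.single i 1)
      obtain ⟨x, rfl⟩ := hg x
      exact ⟨a, ha, x, hx⟩
  choose x hx using hx
  obtain ⟨a, ha, hB⟩ : ∃ a ∈ nonZeroDivisors R, ∀ q : Fin m, ∃ B : Fin e → R,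
      ∑ i, B i • x i - a • Pi.single q 1 ∈ LinearMap.range f := by
    refine exists_mem_nonZeroDivisors_forall ?_ fun q => ?_
    · rintro q a c ⟨B, hB⟩
      refine ⟨c • B, ?_⟩
      have := Submodule.smul_mem _ c hB
      rw [smul_sub, Finset.smul_sum] at this
      simpa only [Pi.smul_apply, smul_eq_mul, mul_smul] using this
    · obtain ⟨a₀, ha₀⟩ := IsLocalization.exist_integer_multiples_of_finite (nonZeroDivisors R)
        (fracCoord b (g (Pi.single q 1)))
      choose B hB using ha₀
      have h1 : fracCoord b (∑ i, B i • g (x i) - (D * a₀) • g (Pi.single q 1)) = 0 := by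
        rw [map_sub, map_sum, map_smul, sub_eq_zero]
        ext j
        have h2 := hB j
        rw [mul_smul, Pi.smul_apply, Pi.smul_apply]
        change _ = D • ((a₀ : R) • fracCoord b (g (Pi.single q 1)) j)
        change _ = (a₀ : R) • fracCoord b (g (Pi.single q 1)) j at h2
        rw [← h2]
        simp [hx, Finset.sum_apply, Pi.single_apply, Algebra.smul_def, mul_comm]
      obtain ⟨a₁, ha₁, h3⟩ := exists_smul_eq_zero_of_fracCoord b h1
      refine ⟨a₁ * (D * a₀), mul_mem ha₁ (mul_mem hD a₀.2), a₁ • B, ?_⟩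
      rw [hfg, LinearMap.mem_ker]
      rw [← h3]
      simp [smul_sub, Finset.smul_sum, mul_smul]
  choose B hB using hB
  refine ⟨a ^ k, pow_mem ha k, ?_⟩
  let z' : MvPolynomial (Fin e) R := aeval (fun q => linForm R (Fin e) (B q)) z
  have hz' : z' ∈ homogeneousSubmodule (Fin e) R k := by
    have := ((mem_homogeneousSubmodule k z).1 hz).aeval (S := R) (n := 1)
      (fun q => linForm R (Fin e) (B q)) (fun q => linForm_isHomogeneous _)
    rwa [one_mul] at this
  have hcomp : ∀ {S : Type u} [CommRing S] [Algebra R S] (y : Fin e → S),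
      aeval y z' = aeval (fun q => ∑ i, B q i • y i) z := by
    intro S _ _ y
    have : ∀ q, aeval y (linForm R (Fin e) (B q)) = ∑ i, B q i • y i := by
      intro q
      simp [linForm_apply]
    simp only [z', ← this]
    rw [← AlgHom.comp_apply, comp_aeval]
  have h4 : aeval (fun i => D • (X i : MvPolynomial (Fin e) (FractionRing R))) z' = 0 := by
    rw [hcomp]
    have h5 : ∀ q, ∑ i, B q i • D • (X i : MvPolynomial (Fin e) (FractionRing R)) =
        a • reesLin b (g (Pi.single q 1)) := by
      intro q
      have h6 : reesLin b (g (∑ i, B q i • x i - a • Pi.single q 1)) = 0 := by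
        have := hB q
        rw [hfg, LinearMap.mem_ker] at this
        rw [this, map_zero]
      rw [map_sub, map_sub, sub_eq_zero, map_smul, map_smul] at h6
      rw [← h6, map_sum, map_sum]
      refine Finset.sum_congr rfl fun i _ => ?_
      rw [map_smul, map_smul]
      congr 1
      change _ = linForm _ _ (fracCoord b (g (x i)))
      rw [hx, ← algebraMap_smul (FractionRing R) D (Pi.single i (1 : FractionRing R) : Fin e → _),
        map_smul, linForm_single, algebraMap_smul]
    simp only [h5]
    rw [aeval_smul_of_mem_homogeneousSubmodule hz, h0, smul_zero]
  have h7 : z' = 0 := by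
    rw [aeval_smul_of_mem_homogeneousSubmodule hz'] at h4
    ext d
    have h8 := congrArg (coeff d) h4
    have h9 : aeval (X : Fin e → MvPolynomial (Fin e) (FractionRing R)) z' =
        map (algebraMap R (FractionRing R)) z' := by
      rw [← aeval_map_algebraMap (FractionRing R), aeval_X_left_apply]
    rw [h9, coeff_smul, coeff_map, coeff_zero, Algebra.smul_def, ← map_mul,
      IsFractionRing.to_map_eq_zero_iff] at h8
    rw [coeff_zero]
    exact (mul_left_mem_nonZeroDivisors_eq_zero_iff (pow_mem hD k)).1 h8
  have h10 := aeval_linForm_sub_smul_mem_symRel (c := cols f) (B := Finset.univ)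
    (φ := fun q => ∑ i, B q i • x i) (a := a) (fun q => by
      rw [Finset.coe_univ, Set.image_univ, ← range_eq_span_cols]
      exact hB q) hz
  have h11 := hcomp fun i => linForm R (Fin m) (x i)
  simp only [map_sum, map_smul] at h10
  rw [← h11, h7, map_zero, zero_sub, neg_mem_iff] at h10
  exact h10

end ReesTorsion

section FiberDimension

open MvPolynomial

lemma ringKrullDim_le_of_injective_of_isIntegral {R S : Type*} [CommRing R] [CommRing S]
    (f : R →+* S) (hf : Function.Injective f) (hi : f.IsIntegral) :
    ringKrullDim R ≤ ringKrullDim S := by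
  let _ := f.toAlgebra
  have : Algebra.IsIntegral R S := ⟨hi⟩
  refine iSup_le fun l => ?_
  obtain ⟨P, -, hP, hPl⟩ := Ideal.exists_ideal_over_prime_of_isIntegral
    l.head.asIdeal (⊥ : Ideal S) (by
      rw [← RingHom.ker_eq_comap_bot, (RingHom.injective_iff_ker_eq_bot (algebraMap R S)).1 hf]
      exact bot_le)
  have : P.LiesOver l.head.asIdeal := ⟨hPl.symm⟩
  obtain ⟨L, hL, -⟩ := Ideal.exists_ltSeries_of_hasGoingUp l P
  rw [← hL]
  exact Order.LTSeries.length_le_krullDim L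

/-- Elements exceeding in number the dimension of the special fibre satisfy a nontrivial relation
there. -/
lemma exists_coeff_notMem_aeval_mem {R A ι : Type*} [CommRing R] [IsLocalRing R] [CommRing A]
    [Algebra R A] [Fintype ι] (u : ι → A)
    (hint : (aeval u : MvPolynomial ι R →ₐ[R] A).toRingHom.IsIntegral)
    (hdim : ringKrullDim (A ⧸ (maximalIdeal R).map (algebraMap R A)) <
      ((Fintype.card ι : ℕ∞) : WithBot ℕ∞)) :
    ∃ P : MvPolynomial ι R, (∃ α, coeff α P ∉ maximalIdeal R) ∧
      aeval u P ∈ (maximalIdeal R).map (algebraMap R A) := by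
  by_contra! hcon
  refine hdim.not_ge ?_
  let κ := ResidueField R
  let J := (maximalIdeal R).map (algebraMap R A)
  let π := Ideal.Quotient.mk J
  let j : κ →+* A ⧸ J := Ideal.Quotient.lift (maximalIdeal R) (π.comp (algebraMap R A))
    fun a ha => Ideal.Quotient.eq_zero_iff_mem.2 (Ideal.mem_map_of_mem _ ha)
  let ψ : MvPolynomial ι κ →+* A ⧸ J := eval₂Hom j fun i => π (u i)
  have hψ : ψ.comp (map (residue R)) =
      π.comp (aeval u : MvPolynomial ι R →ₐ[R] A).toRingHom := by
    refine MvPolynomial.ringHom_ext (fun r => ?_) fun i => ?_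
    · have : j (residue R r) = π (algebraMap R A r) := rfl
      rw [RingHom.comp_apply, map_C, RingHom.comp_apply, AlgHom.toRingHom_eq_coe,
        RingHom.coe_coe, aeval_C, ← this]
      exact eval₂Hom_C _ _ _
    · simp [ψ, π]
  have hinj : Function.Injective ψ := by
    rw [injective_iff_map_eq_zero]
    intro p hp
    obtain ⟨P, rfl⟩ := MvPolynomial.map_surjective (residue R) residue_surjective p
    have h1 : π (aeval u P) = 0 := by
      have := RingHom.congr_fun hψ P
      rw [RingHom.comp_apply, hp] at this
      exact this.symm
    by_contra hne
    obtain ⟨α, hα⟩ := MvPolynomial.ne_zero_iff.1 hne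
    rw [coeff_map] at hα
    rw [Ne, residue_eq_zero_iff] at hα
    exact hcon P ⟨α, hα⟩ (Ideal.Quotient.eq_zero_iff_mem.1 h1)
  have hψi : ψ.IsIntegral := by
    refine RingHom.IsIntegral.tower_top (f := map (residue R)) (g := ψ) ?_
    rw [hψ]
    exact RingHom.IsIntegral.trans _ _ hint
      (RingHom.isIntegral_of_surjective _ Ideal.Quotient.mk_surjective)
  have h2 := ringKrullDim_le_of_injective_of_isIntegral ψ hinj hψi
  rwa [MvPolynomial.ringKrullDim_of_isNoetherianRing, ringKrullDim_eq_zero_of_field, zero_add,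
    Nat.card_eq_fintype_card] at h2

end FiberDimension

section Reductions

open MvPolynomial

variable {R B : Type*} [CommRing R] [CommRing B] [Algebra R B] {L V : Submodule R B}

lemma ideal_smul_mul_le (I : Ideal R) (M N : Submodule R B) : I • M * N ≤ I • (M * N) := by
  refine Submodule.mul_le.2 fun x hx y hy => ?_
  refine Submodule.smul_induction_on hx (fun a ha m hm => ?_) fun x x' hx hx' => ?_
  · rw [smul_mul_assoc]
    exact Submodule.smul_mem_smul ha (Submodule.mul_mem_mul hm hy)
  · rw [add_mul]
    exact Submodule.add_mem _ hx hx'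

lemma mul_pow_eq_of_pow_succ_le (hV : V ≤ L) {M : ℕ} (h : L ^ (M + 1) ≤ V * L ^ M) {r : ℕ}
    (hr : M ≤ r) : V * L ^ r = L ^ (r + 1) := by
  refine le_antisymm ?_ ?_
  · rw [pow_succ']
    gcongr
  · obtain ⟨i, rfl⟩ := Nat.exists_eq_add_of_le hr
    calc L ^ (M + i + 1) = L ^ (M + 1) * L ^ i := by ring
      _ ≤ V * L ^ M * L ^ i := by gcongr
      _ = V * L ^ (M + i) := by ring

lemma adjoin_toSubmodule_le_iSup_pow (T : Type*) [CommRing T] [Algebra T B] {M : Submodule T B}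
    (h : ∀ t, ((L ^ t : Submodule R B) : Set B) ⊆ M) :
    Subalgebra.toSubmodule (Algebra.adjoin T (L : Set B)) ≤ M := by
  rw [Algebra.adjoin_eq_span, Submodule.span_le]
  have : ∀ x ∈ Submonoid.closure (L : Set B), ∃ t, x ∈ L ^ t := by
    intro x hx
    induction hx using Submonoid.closure_induction with
    | mem x hx => exact ⟨1, by simpa using hx⟩
    | one => exact ⟨0, by rw [pow_zero]; exact Submodule.one_le.1 le_rfl⟩
    | mul x y _ _ hx hy =>
      obtain ⟨s, hs⟩ := hx
      obtain ⟨t, ht⟩ := hy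
      exact ⟨s + t, by rw [pow_add]; exact Submodule.mul_mem_mul hs ht⟩
  intro x hx
  obtain ⟨t, ht⟩ := this x hx
  exact h t ht

/-- The algebra generated by `L` is integral over the one generated by a reduction. -/
lemma isIntegralElem_of_mem_adjoin {ι : Type*} {w : ι → B} (hL : L.FG) {N : ℕ}
    (hN : ∀ r, N ≤ r → Submodule.span R (Set.range w) * L ^ r = L ^ (r + 1)) {x : B}
    (hx : x ∈ Algebra.adjoin R (L : Set B)) :
    (aeval w : MvPolynomial ι R →ₐ[R] B).toRingHom.IsIntegralElem x := by
  let _ : Algebra (MvPolynomial ι R) B := (aeval w : MvPolynomial ι R →ₐ[R] B).toRingHom.toAlgebra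
  have hsmul : ∀ (p : MvPolynomial ι R) (y : B), p • y = aeval w p * y := fun p y => rfl
  have : IsScalarTower R (MvPolynomial ι R) B := ⟨fun r p y => by
    rw [hsmul, hsmul, map_smul, smul_mul_assoc]⟩
  let S : Subalgebra (MvPolynomial ι R) B := Algebra.adjoin _ (L : Set B)
  have hLS : ∀ t, ((L ^ t : Submodule R B) : Set B) ⊆ S := by
    intro t x hx
    refine Submodule.pow_induction_on_left L (C := fun x => x ∈ S) (fun r => ?_)
      (fun x y hx hy => S.add_mem hx hy)
      (fun m hm x hx => S.mul_mem (Algebra.subset_adjoin hm) hx) hx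
    rw [Algebra.algebraMap_eq_smul_one, ← algebraMap_smul (MvPolynomial ι R)]
    exact S.smul_mem S.one_mem _
  let M : Submodule (MvPolynomial ι R) B :=
    ⨆ i ∈ Finset.range (N + 1), Submodule.span _ ((L ^ i : Submodule R B) : Set B)
  have hMfg : M.FG := by
    refine Submodule.fg_biSup _ _ fun i _ => ?_
    obtain ⟨G, hG⟩ := hL.pow i
    rw [← hG, Submodule.span_span_of_tower]
    exact ⟨G, rfl⟩
  have hLM : ∀ t, ((L ^ t : Submodule R B) : Set B) ⊆ M := by
    intro t
    induction t with
    | zero =>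
      exact fun x hx => Submodule.mem_iSup_of_mem 0 (Submodule.mem_iSup_of_mem (by simp)
        (Submodule.subset_span hx))
    | succ t ih =>
      by_cases ht : t < N
      · exact fun x hx => Submodule.mem_iSup_of_mem (t + 1)
          (Submodule.mem_iSup_of_mem (by simpa using ht) (Submodule.subset_span hx))
      · rw [← hN t (not_lt.1 ht)]
        change _ ≤ M.restrictScalars R
        rw [Submodule.mul_le]
        intro v hv l hl
        have : Submodule.span R (Set.range w) ≤
            (M.restrictScalars R).comap (LinearMap.mulRight R l) := by
          rw [Submodule.span_le]
          rintro _ ⟨i, rfl⟩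
          have h1 := M.smul_mem (X i : MvPolynomial ι R) (ih hl)
          rw [hsmul, aeval_X] at h1
          exact h1
        exact this hv
  have hSM : Subalgebra.toSubmodule S = M := by
    refine le_antisymm (adjoin_toSubmodule_le_iSup_pow _ hLM) ?_
    refine iSup₂_le fun i _ => ?_
    rw [Submodule.span_le]
    exact hLS i
  have hxS : x ∈ S := by
    have : Algebra.adjoin R (L : Set B) ≤ S.restrictScalars R :=
      Algebra.adjoin_le Algebra.subset_adjoin
    exact this hx
  exact IsIntegral.of_mem_of_fg S (hSM ▸ hMfg) x hxS

lemma aeval_sub_eval_smul_mul_mem {ι : Type} {ρ : ι → B} {ρ₀ : B} {c : ι → R}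
    (hρ : ∀ i, ρ i ∈ L) (hρ₀ : ρ₀ ∈ L) (hV : ∀ i, ρ i - c i • ρ₀ ∈ V) {d : ℕ}
    {z : MvPolynomial ι R} (hz : z ∈ homogeneousSubmodule ι R d) {y : B} (hy : y ∈ L) :
    (aeval ρ z - eval c z • ρ₀ ^ d) * y ∈ V * L ^ d := by
  induction d generalizing z with
  | zero =>
    rw [mem_homogeneousSubmodule, ← totalDegree_zero_iff_isHomogeneous,
      totalDegree_eq_zero_iff_eq_C] at hz
    rw [hz]
    simp [Algebra.algebraMap_eq_smul_one]
  | succ d ih =>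
    have : homogeneousSubmodule ι R (d + 1) ≤ (V * L ^ (d + 1)).comap
        (LinearMap.mulRight R y ∘ₗ ((aeval ρ).toLinearMap -
          (aeval c : MvPolynomial ι R →ₐ[R] R).toLinearMap.smulRight (ρ₀ ^ (d + 1)))) := by
      refine homogeneousSubmodule_succ_le fun q z hz => ?_
      have h1 : (aeval ρ (X q * z) - eval c (X q * z) • ρ₀ ^ (d + 1)) * y =
          ρ q * ((aeval ρ z - eval c z • ρ₀ ^ d) * y) +
            (ρ q - c q • ρ₀) * (eval c z • (ρ₀ ^ d * y)) := by
        simp only [map_mul, aeval_X, eval_X, Algebra.smul_def]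
        ring
      have h2 : (aeval ρ (X q * z) - eval c (X q * z) • ρ₀ ^ (d + 1)) * y ∈ V * L ^ (d + 1) := by
        rw [h1]
        refine Submodule.add_mem _ ?_ (Submodule.mul_mem_mul (hV q) (Submodule.smul_mem _ _ ?_))
        · rw [pow_succ', mul_left_comm]
          exact Submodule.mul_mem_mul (hρ q) (ih hz)
        · rw [pow_succ]
          exact Submodule.mul_mem_mul (Submodule.pow_mem_pow _ hρ₀ d) hy
      exact h2
    exact this hz

/-- A polynomial relation among the generators of a reduction modulo the maximal ideal allows one
to drop a generator. -/
lemma exists_forall_mul_pow_eq [IsLocalRing R] (hL : L.FG) {ι : Type} {ρ : ι → B} {i₀ : ι}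
    {c : ι → R} (hρ : ∀ i, ρ i ∈ L) (hVL : V ≤ L) (hV : ∀ i, ρ i - c i • ρ i₀ ∈ V) {N : ℕ}
    (hN : ∀ r, N ≤ r → Submodule.span R (Set.range ρ) * L ^ r = L ^ (r + 1)) {d : ℕ}
    {P : MvPolynomial ι R} (hP : P ∈ homogeneousSubmodule ι R d)
    (hPc : eval c P ∉ maximalIdeal R) (hPρ : aeval ρ P ∈ maximalIdeal R • L ^ d) :
    ∃ N, ∀ r, N ≤ r → V * L ^ r = L ^ (r + 1) := by
  have h1 : ∀ y ∈ L, ρ i₀ ^ d * y ∈ V * L ^ d ⊔ maximalIdeal R • L ^ (d + 1) := by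
    intro y hy
    have hu : IsUnit (eval c P) := by
      by_contra h
      exact hPc ((mem_maximalIdeal _).2 h)
    have h2 := aeval_sub_eval_smul_mul_mem hρ (hρ i₀) hV hP hy
    have h3 : aeval ρ P * y ∈ maximalIdeal R • L ^ (d + 1) := by
      rw [pow_succ]
      exact ideal_smul_mul_le _ _ _ (Submodule.mul_mem_mul hPρ hy)
    have h4 : eval c P • (ρ i₀ ^ d * y) ∈ V * L ^ d ⊔ maximalIdeal R • L ^ (d + 1) := by
      have : eval c P • (ρ i₀ ^ d * y) =
          -((aeval ρ P - eval c P • ρ i₀ ^ d) * y) + aeval ρ P * y := by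
        rw [sub_mul, smul_mul_assoc]
        abel
      rw [this]
      exact Submodule.add_mem_sup (Submodule.neg_mem _ h2) h3
    exact (Submodule.smul_mem_iff_of_isUnit _ hu).1 h4
  have hspan : Submodule.span R (Set.range ρ) ≤ Submodule.span R {ρ i₀} ⊔ V := by
    rw [Submodule.span_le]
    rintro _ ⟨i, rfl⟩
    rw [← add_sub_cancel (c i • ρ i₀) (ρ i)]
    exact Submodule.add_mem_sup (Submodule.smul_mem _ _ (Submodule.mem_span_singleton_self _))
      (hV i)
  have h5 : ∀ i, L ^ (N + 1 + i) ≤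
      Submodule.span R {ρ i₀ ^ i} * L ^ (N + 1) ⊔ V * L ^ (N + i) := by
    intro i
    induction i with
    | zero =>
      refine le_sup_of_le_left ?_
      rw [pow_zero, ← Submodule.one_eq_span, one_mul, add_zero]
    | succ i ih =>
      rw [← add_assoc, ← hN _ (by omega)]
      refine (mul_le_mul' hspan le_rfl).trans ?_
      rw [Submodule.sup_mul]
      refine sup_le ?_ (le_sup_of_le_right (le_of_eq (by ring)))
      refine (mul_le_mul' le_rfl ih).trans ?_
      rw [Submodule.mul_sup]
      refine sup_le_sup (le_of_eq ?_) ?_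
      · rw [← mul_assoc, Submodule.span_mul_span, Set.singleton_mul_singleton, ← pow_succ']
      · rw [← mul_assoc, mul_comm _ V, mul_assoc, ← add_assoc, pow_succ']
        gcongr
        exact (Submodule.span_singleton_le_iff_mem _ _).2 (hρ i₀)
  have h6 : L ^ (N + d + 1) ≤ V * L ^ (N + d) ⊔ maximalIdeal R • L ^ (N + d + 1) := by
    have h7 : Submodule.span R {ρ i₀ ^ d} * L ≤ V * L ^ d ⊔ maximalIdeal R • L ^ (d + 1) := by
      rw [Submodule.mul_le]
      intro v hv y hy
      obtain ⟨a, rfl⟩ := Submodule.mem_span_singleton.1 hv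
      rw [smul_mul_assoc]
      exact Submodule.smul_mem _ _ (h1 y hy)
    have h8 := h5 d
    rw [show N + 1 + d = N + d + 1 by omega, pow_succ' L N, ← mul_assoc] at h8
    refine h8.trans (sup_le ?_ le_sup_left)
    refine (mul_le_mul' h7 le_rfl).trans ?_
    rw [Submodule.sup_mul]
    refine sup_le_sup (le_of_eq (by ring)) ((ideal_smul_mul_le _ _ _).trans (le_of_eq ?_))
    congr 1
    ring
  have h9 := Submodule.le_of_le_smul_of_le_jacobson_bot (hL.pow _)
    (maximalIdeal_le_jacobson ⊥) h6
  exact ⟨N + d, fun r hr => mul_pow_eq_of_pow_succ_le hVL h9 hr⟩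

end Reductions

section SpecialFibre

open MvPolynomial

lemma homogeneousComponent_aeval {R S σ τ : Type*} [CommRing R] [CommRing S] [Algebra R S]
    {w : σ → MvPolynomial τ S} (hw : ∀ i, (w i).IsHomogeneous 1) (P : MvPolynomial σ R) (d : ℕ) :
    homogeneousComponent d (aeval w P) = aeval w (homogeneousComponent d P) := by
  have h : ∀ i, homogeneousComponent d (aeval w (homogeneousComponent i P)) =
      if d = i then aeval w (homogeneousComponent i P) else 0 := fun i => by
    refine homogeneousComponent_of_mem ?_
    rw [mem_homogeneousSubmodule]
    simpa using (homogeneousComponent_isHomogeneous i P).aeval w hw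
  conv_lhs => rw [← sum_homogeneousComponent P]
  rw [map_sum, map_sum, Finset.sum_congr rfl fun i _ => h i, Finset.sum_ite_eq]
  split_ifs with hd
  · rfl
  · rw [homogeneousComponent_eq_zero, map_zero]
    simpa using hd

variable {R : Type u} [CommRing R] {E : Type u} [AddCommGroup E] [Module R E] {e : ℕ}
  (b : LocalizedModule (nonZeroDivisors R) E ≃ₗ[FractionRing R] (Fin e → FractionRing R))

lemma reesLin_isHomogeneous (x : E) : (reesLin b x).IsHomogeneous 1 :=
  linForm_isHomogeneous _

lemma isHomogeneous_of_mem_range_reesLin_pow {t : ℕ} {z : MvPolynomial (Fin e) (FractionRing R)}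
    (hz : z ∈ LinearMap.range (reesLin b) ^ t) : z.IsHomogeneous t := by
  induction hz using Submodule.pow_induction_on_left' with
  | algebraMap r => exact isHomogeneous_C _ _
  | add x y i _ _ hx hy => exact hx.add hy
  | mem_mul m hm i x _ hx =>
    obtain ⟨v, rfl⟩ := hm
    rw [Nat.succ_eq_add_one, add_comm]
    exact (reesLin_isHomogeneous b v).mul hx

lemma reesAlgebraOfModule_eq :
    reesAlgebraOfModule e b = Algebra.adjoin R (LinearMap.range (reesLin b) : Set _) := by
  rw [reesAlgebraOfModule, LinearMap.coe_range, coe_reesLin]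

lemma homogeneousComponent_mem_smul {I : Ideal R} {y : MvPolynomial (Fin e) (FractionRing R)}
    (hy : y ∈ I • Subalgebra.toSubmodule (reesAlgebraOfModule e b)) (d : ℕ) :
    homogeneousComponent d y ∈ I • LinearMap.range (reesLin b) ^ d := by
  let h := (homogeneousComponent (R := FractionRing R) (σ := Fin e) d).restrictScalars R
  have h1 : Subalgebra.toSubmodule (reesAlgebraOfModule e b) ≤
      (LinearMap.range (reesLin b) ^ d).comap h := by
    rw [reesAlgebraOfModule_eq]
    refine adjoin_toSubmodule_le_iSup_pow R fun t z hz => ?_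
    have h2 := homogeneousComponent_of_mem (m := d)
      ((mem_homogeneousSubmodule _ _).2 (isHomogeneous_of_mem_range_reesLin_pow b hz))
    change homogeneousComponent d z ∈ LinearMap.range (reesLin b) ^ d
    rw [h2]
    split_ifs with hd
    · rwa [hd]
    · exact zero_mem _
  have h3 : h y ∈ (I • Subalgebra.toSubmodule (reesAlgebraOfModule e b)).map h :=
    Submodule.mem_map_of_mem hy
  rw [Submodule.map_smul''] at h3
  exact Submodule.smul_mono le_rfl (Submodule.map_le_iff_le_comap.2 h1) h3

lemma coe_mem_smul_toSubmodule {B : Type*} [CommRing B] [Algebra R B] {A : Subalgebra R B}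
    {I : Ideal R} {y : A} (hy : y ∈ I.map (algebraMap R A)) :
    (y : B) ∈ I • Subalgebra.toSubmodule A := by
  have h1 : y ∈ (I • ⊤ : Submodule R A) := by
    rw [Ideal.smul_top_eq_map]
    exact hy
  have h2 := Submodule.mem_map_of_mem (f := A.val.toLinearMap) h1
  rw [Submodule.map_smul''] at h2
  refine Submodule.smul_mono le_rfl ?_ h2
  rintro _ ⟨x, -, rfl⟩
  exact x.2

/-- The generators of a reduction that are more numerous than the analytic spread satisfy a
homogeneous relation modulo the maximal ideal. -/
lemma exists_homogeneous_aeval_mem [IsLocalRing R] [Module.Finite R E] {ι : Type} [Fintype ι]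
    {u : ι → E} {N : ℕ} (hN : ∀ r, N ≤ r →
      Submodule.span R (Set.range fun i => reesLin b (u i)) * LinearMap.range (reesLin b) ^ r =
        LinearMap.range (reesLin b) ^ (r + 1))
    (hl : analyticSpreadOfModule e b < ((Fintype.card ι : ℕ∞) : WithBot ℕ∞)) :
    ∃ d, ∃ P ∈ homogeneousSubmodule ι R d, (∃ α, coeff α P ∉ maximalIdeal R) ∧
      aeval (fun i => reesLin b (u i)) P ∈ maximalIdeal R • LinearMap.range (reesLin b) ^ d := by
  let A := reesAlgebraOfModule e b
  let _ : CommRing A := A.toCommRing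
  let w : ι → MvPolynomial (Fin e) (FractionRing R) := fun i => reesLin b (u i)
  have hw : ∀ i, w i ∈ A := fun i => by
    change _ ∈ reesAlgebraOfModule e b
    rw [reesAlgebraOfModule_eq]
    exact Algebra.subset_adjoin ⟨u i, rfl⟩
  let v : ι → A := fun i => ⟨w i, hw i⟩
  have hv : ∀ P : MvPolynomial ι R, A.val (aeval v P) = aeval w P := fun P => by
    rw [← AlgHom.comp_apply, comp_aeval]
    rfl
  have hint : (aeval v : MvPolynomial ι R →ₐ[R] A).toRingHom.IsIntegral := by
    intro x
    have hx : (x : MvPolynomial (Fin e) (FractionRing R)) ∈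
        Algebra.adjoin R (LinearMap.range (reesLin b) : Set _) := by
      rw [← reesAlgebraOfModule_eq]
      exact x.2
    obtain ⟨p, hp, hpx⟩ := isIntegralElem_of_mem_adjoin
      (by rw [LinearMap.range_eq_map]; exact Module.Finite.fg_top.map _) hN hx
    refine ⟨p, hp, Subtype.val_injective ?_⟩
    have h1 : A.val.toRingHom.comp (aeval v : MvPolynomial ι R →ₐ[R] A).toRingHom =
        (aeval w : MvPolynomial ι R →ₐ[R] _).toRingHom := RingHom.ext hv
    have h2 := Polynomial.hom_eval₂ p (aeval v : MvPolynomial ι R →ₐ[R] A).toRingHom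
      A.val.toRingHom x
    rw [h1] at h2
    exact h2.trans hpx
  obtain ⟨P, ⟨α, hα⟩, hP⟩ := exists_coeff_notMem_aeval_mem v hint hl
  refine ⟨α.degree, homogeneousComponent α.degree P, homogeneousComponent_mem _ _, ⟨α, ?_⟩, ?_⟩
  · rwa [coeff_homogeneousComponent, if_pos rfl]
  · have h1 := homogeneousComponent_mem_smul b (coe_mem_smul_toSubmodule hP) α.degree
    have h2 : ((aeval v P : A) : MvPolynomial (Fin e) (FractionRing R)) = aeval w P := hv P
    rw [h2, homogeneousComponent_aeval fun i => reesLin_isHomogeneous b (u i)] at h1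
    exact h1

/-- Over a local ring with infinite residue field, a homogeneous polynomial with a unit coefficient
takes a unit value at a point with a prescribed coordinate equal to one. -/
lemma exists_eval_X_mul_notMem [IsLocalRing R] [Infinite (ResidueField R)] {ι : Type} (i₀ : ι)
    {d : ℕ} {P : MvPolynomial ι R} (hP : P ∈ homogeneousSubmodule ι R d)
    (hα : ∃ α, coeff α P ∉ maximalIdeal R) :
    ∃ c : ι → R, c i₀ = 1 ∧ eval c P ∉ maximalIdeal R := by
  obtain ⟨α, hα⟩ := hα
  let κ := ResidueField R
  have hne : map (residue R) P * X i₀ ≠ 0 := by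
    refine mul_ne_zero (fun h => hα ?_) (X_ne_zero i₀)
    have := congrArg (coeff α) h
    rwa [coeff_map, coeff_zero, residue_eq_zero_iff] at this
  obtain ⟨y, hy⟩ : ∃ y, eval y (map (residue R) P * X i₀) ≠ 0 := by
    by_contra! h
    exact hne (funext fun y => by rw [h, map_zero])
  rw [map_mul, eval_X] at hy
  choose c hc using fun i => residue_surjective (y i)
  have h0 : IsUnit (c i₀) := by
    by_contra h
    refine right_ne_zero_of_mul hy ?_
    rw [← hc, residue_eq_zero_iff, mem_maximalIdeal]
    exact h
  have hPc : eval c P ∉ maximalIdeal R := by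
    intro h
    refine left_ne_zero_of_mul hy ?_
    rw [← residue_eq_zero_iff] at h
    rw [eval_map, ← h, ← eval₂_id, hom_eval₂]
    congr 1
    ext1 i
    exact (hc i).symm
  obtain ⟨a, ha⟩ := h0.exists_left_inv
  refine ⟨fun i => a • c i, ha, fun h => ?_⟩
  have h1 := aeval_smul_of_mem_homogeneousSubmodule hP a c
  rw [aeval_eq_eval, aeval_eq_eval] at h1
  rw [h1] at h
  have hau : IsUnit (a ^ d) := (IsUnit.of_mul_eq_one _ ha).pow d
  exact hPc ((Submodule.smul_mem_iff_of_isUnit _ hau).1 h)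

end SpecialFibre

section MinimalReductions

open MvPolynomial

variable {R : Type u} [CommRing R] {E : Type u} [AddCommGroup E] [Module R E] {e : ℕ}
  {b : LocalizedModule (nonZeroDivisors R) E ≃ₗ[FractionRing R] (Fin e → FractionRing R)}

lemma isReductionOfModule_iff {U : Submodule R E} : IsReductionOfModule e b U ↔
    ∃ N, ∀ r, N ≤ r → U.map (reesLin b) * LinearMap.range (reesLin b) ^ r =
      LinearMap.range (reesLin b) ^ (r + 1) := by
  simp only [IsReductionOfModule, span_reesMap_image, reesComponent_eq]

lemma IsMinimalReductionOfModule.exists_span_eq_pred [IsLocalRing R] [Infinite (ResidueField R)]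
    [Module.Finite R E] {U : Submodule R E} (hU : IsMinimalReductionOfModule e b U) {k : ℕ}
    (hl : analyticSpreadOfModule e b < (((k + 1 : ℕ) : ℕ∞) : WithBot ℕ∞)) {u : Fin (k + 1) → E}
    (hu : Submodule.span R (Set.range u) = U) :
    ∃ v : Fin k → E, Submodule.span R (Set.range v) = U := by
  obtain ⟨N, hN⟩ := isReductionOfModule_iff.1 hU.1
  have hN' : ∀ r, N ≤ r →
      Submodule.span R (Set.range fun i => reesLin b (u i)) * LinearMap.range (reesLin b) ^ r =
        LinearMap.range (reesLin b) ^ (r + 1) := by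
    rw [← hu, Submodule.map_span, ← Set.range_comp] at hN
    exact hN
  obtain ⟨d, P, hP, hα, hPu⟩ := exists_homogeneous_aeval_mem b hN' (by simpa using hl)
  obtain ⟨c, hc, hcP⟩ := exists_eval_X_mul_notMem 0 hP hα
  let v : Fin k → E := fun i => u i.succ - c i.succ • u 0
  have hvU : Submodule.span R (Set.range v) ≤ U := by
    rw [Submodule.span_le, ← hu]
    rintro _ ⟨i, rfl⟩
    exact Submodule.sub_mem _ (Submodule.subset_span ⟨_, rfl⟩)
      (Submodule.smul_mem _ _ (Submodule.subset_span ⟨_, rfl⟩))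
  refine ⟨v, hU.2 _ hvU (isReductionOfModule_iff.2 ?_)⟩
  refine exists_forall_mul_pow_eq (by rw [LinearMap.range_eq_map]; exact Module.Finite.fg_top.map _)
    (i₀ := 0) (c := c) (fun i => ⟨u i, rfl⟩) LinearMap.map_le_range (fun i => ?_) hN' hP hcP hPu
  rw [← map_smul, ← map_sub]
  refine Submodule.mem_map_of_mem ?_
  refine Fin.cases ?_ (fun i => ?_) i
  · rw [hc, one_smul, sub_self]
    exact zero_mem _
  · exact Submodule.subset_span ⟨i, rfl⟩

/-- A minimal reduction is generated by as many elements as the analytic spread. -/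
lemma IsMinimalReductionOfModule.exists_span_eq [IsLocalRing R] [IsNoetherianRing R]
    [Infinite (ResidueField R)] [Module.Finite R E] {U : Submodule R E}
    (hU : IsMinimalReductionOfModule e b U) {l : ℕ}
    (hl : analyticSpreadOfModule e b = ((l : ℕ∞) : WithBot ℕ∞)) :
    ∃ v : Fin l → E, Submodule.span R (Set.range v) = U := by
  have key : ∀ (k : ℕ) (u : Fin k → E), Submodule.span R (Set.range u) = U →
      ∃ v : Fin l → E, Submodule.span R (Set.range v) = U := by
    intro k
    induction k with
    | zero =>
      intro u hu
      refine ⟨fun _ => 0, ?_⟩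
      rw [← hu, Set.range_eq_empty u, Submodule.span_empty, Submodule.span_eq_bot]
      rintro _ ⟨i, rfl⟩
      rfl
    | succ k ih =>
      intro u hu
      by_cases hk : l < k + 1
      · obtain ⟨v, hv⟩ := hU.exists_span_eq_pred (by rw [hl]; exact_mod_cast hk) hu
        exact ih v hv
      · obtain ⟨i, rfl⟩ := Nat.exists_eq_add_of_le (not_lt.1 hk)
        refine ⟨Fin.append u fun _ => 0, ?_⟩
        rw [← hu]
        refine le_antisymm (Submodule.span_le.2 ?_) (Submodule.span_mono ?_)
        · rintro _ ⟨j, rfl⟩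
          refine Fin.addCases (fun j => ?_) (fun j => ?_) j
          · rw [Fin.append_left]
            exact Submodule.subset_span ⟨j, rfl⟩
          · rw [Fin.append_right]
            exact zero_mem _
        · rintro _ ⟨j, rfl⟩
          exact ⟨Fin.castAdd i j, Fin.append_left _ _ _⟩
  obtain ⟨k, u, hu⟩ := Submodule.fg_iff_exists_fin_generating_family.1
    (IsNoetherian.noetherian U)
  exact key k u hu

end MinimalReductions

section Colon

open MvPolynomial

lemma exists_eq_sum_mul_of_mem_span_range_mul {R A ι : Type*} [CommRing R] [CommRing A]
    [Algebra R A] [Fintype ι] {w : ι → A} {M : Submodule R A} {x : A}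
    (hx : x ∈ Submodule.span R (Set.range w) * M) :
    ∃ y : ι → A, (∀ j, y j ∈ M) ∧ x = ∑ j, w j * y j := by
  classical
  let Φ : (ι → M) →ₗ[R] A := ∑ j, LinearMap.mulLeft R (w j) ∘ₗ M.subtype ∘ₗ LinearMap.proj j
  have hΦ : ∀ y, Φ y = ∑ j, w j * (y j : A) := fun y => by simp [Φ, LinearMap.sum_apply]
  have h : Submodule.span R (Set.range w) * M ≤ LinearMap.range Φ := by
    refine Submodule.mul_le.2 fun a ha z hz => ?_
    have : Submodule.span R (Set.range w) ≤ (LinearMap.range Φ).comap (LinearMap.mulRight R z) := by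
      rw [Submodule.span_le]
      rintro _ ⟨i, rfl⟩
      refine ⟨Pi.single i ⟨z, hz⟩, ?_⟩
      rw [hΦ, Finset.sum_eq_single i (fun j _ hj => by simp [Pi.single_eq_of_ne hj])
        (fun hi => absurd (Finset.mem_univ i) hi)]
      simp
    exact this ha
  obtain ⟨y, rfl⟩ := h hx
  exact ⟨fun j => y j, fun j => (y j).2, hΦ y⟩

variable {R : Type u} [CommRing R] {E : Type u} [AddCommGroup E] [Module R E] {e n m : ℕ}
  (b : LocalizedModule (nonZeroDivisors R) E ≃ₗ[FractionRing R] (Fin e → FractionRing R))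
  {f : (Fin n → R) →ₗ[R] (Fin m → R)} {g : (Fin m → R) →ₗ[R] E}

lemma exists_eq_sum_of_mem_symRel {c : Fin n → Fin m → R} {k : ℕ} {z : MvPolynomial (Fin m) R}
    (hz : z ∈ symRel c Finset.univ (k + 1)) :
    ∃ s : Fin n → MvPolynomial (Fin m) R, (∀ j, (s j).IsHomogeneous k) ∧
      z = ∑ j, linForm R (Fin m) (c j) * s j := by
  have h : symRel c Finset.univ (k + 1) ≤
      Submodule.span R (Set.range fun j => linForm R (Fin m) (c j)) *
        homogeneousSubmodule (Fin m) R k :=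
    symRel_succ_le.2 fun i _ y hy => Submodule.mul_mem_mul (Submodule.subset_span ⟨i, rfl⟩) hy
  exact exists_eq_sum_mul_of_mem_span_range_mul (h hz)

lemma aeval_reesLin_linForm (a : Fin m → R) :
    aeval (fun q => reesLin b (g (Pi.single q 1))) (linForm R (Fin m) a) = reesLin b (g a) := by
  conv_rhs => rw [pi_eq_sum_univ' a]
  simp only [linForm_apply, map_sum, map_smul, aeval_X]

lemma exists_aeval_eq_of_mem_pow (hg : Function.Surjective g) {k : ℕ}
    {y : MvPolynomial (Fin e) (FractionRing R)} (hy : y ∈ LinearMap.range (reesLin b) ^ k) :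
    ∃ z ∈ homogeneousSubmodule (Fin m) R k,
      aeval (fun q => reesLin b (g (Pi.single q 1))) z = y := by
  induction hy using Submodule.pow_induction_on_left' with
  | algebraMap r => exact ⟨C r, isHomogeneous_C _ _, aeval_C _ _⟩
  | add x y i _ _ hx hy =>
    obtain ⟨z, hz, rfl⟩ := hx
    obtain ⟨w, hw, rfl⟩ := hy
    exact ⟨z + w, add_mem hz hw, map_add _ _ _⟩
  | mem_mul a ha i y _ hy =>
    obtain ⟨x, rfl⟩ := ha
    obtain ⟨a, rfl⟩ := hg x
    obtain ⟨z, hz, rfl⟩ := hy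
    exact ⟨linForm R (Fin m) a * z, linForm_mul_mem a hz, by rw [map_mul, aeval_reesLin_linForm]⟩

lemma aeval_mem_range_reesLin_pow {k : ℕ} {z : MvPolynomial (Fin m) R}
    (hz : z ∈ homogeneousSubmodule (Fin m) R k) :
    aeval (fun q => reesLin b (g (Pi.single q 1))) z ∈ LinearMap.range (reesLin b) ^ k := by
  induction k generalizing z with
  | zero =>
    rw [mem_homogeneousSubmodule, ← totalDegree_zero_iff_isHomogeneous,
      totalDegree_eq_zero_iff_eq_C] at hz
    rw [hz, aeval_C, pow_zero]
    exact Submodule.algebraMap_mem _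
  | succ k ih =>
    have : homogeneousSubmodule (Fin m) R (k + 1) ≤ (LinearMap.range (reesLin b) ^ (k + 1)).comap
        (aeval fun q => reesLin b (g (Pi.single q 1))).toLinearMap := by
      refine homogeneousSubmodule_succ_le fun q z hz => ?_
      change aeval _ (X q * z) ∈ LinearMap.range (reesLin b) ^ (k + 1)
      rw [map_mul, aeval_X, pow_succ']
      exact Submodule.mul_mem_mul ⟨_, rfl⟩ (ih hz)
    exact this hz

lemma range_linearCombination_append_eq_comap (hfg : LinearMap.range f = LinearMap.ker g)
    {l : ℕ} {v : Fin l → Fin m → R} {U : Submodule R E}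
    (hv : Submodule.span R (Set.range fun j => g (v j)) = U) :
    LinearMap.range (Fintype.linearCombination R (Fin.append (cols f) v)) = U.comap g := by
  have h : Set.range (Fin.append (cols f) v) = Set.range (cols f) ∪ Set.range v := by
    rw [← Set.Sum.elim_range, ← Fin.append_comp_sumElim]
    exact (finSumFinEquiv.surjective.range_comp _).symm
  rw [Fintype.range_linearCombination, h, Submodule.span_union, ← range_eq_span_cols, hfg, ← hv,
    sup_comm]
  have : Submodule.span R (Set.range fun j => g (v j)) =
      (Submodule.span R (Set.range v)).map g := by
    rw [Submodule.map_span, ← Set.range_comp]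
    rfl
  rw [this, Submodule.comap_map_eq]

/-- The colon property of a reduction `U` generated by `d + 1 + e` elements. -/
theorem mem_of_forall_reesLin_mul_mem [IsNoetherianRing R]
    (hExt : ∀ (I : Ideal R) (h : ℕ), (∀ p : PrimeSpectrum R, I ≤ p.asIdeal →
      (h : ℕ∞) ≤ p.asIdeal.height) → ∀ P : Submonoid R, ExtTorsionLT P (R ⧸ I) h R)
    (hg : Function.Surjective g) (hfg : LinearMap.range f = LinearMap.ker g) (hm : m = n + e)
    {d : ℕ} (hpiv : HasPivots (cols f) (d + 1) Finset.univ) {U : Submodule R E}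
    (hU : IsReductionOfModule e b U) {u : Fin (d + 1 + e) → E}
    (hu : Submodule.span R (Set.range u) = U) {x : E}
    (hx : ∀ z ∈ LinearMap.range (reesLin b) ^ d,
      reesLin b x * z ∈ U.map (reesLin b) * LinearMap.range (reesLin b) ^ d) : x ∈ U := by
  obtain ⟨a, rfl⟩ := hg x
  choose v hv using fun j => hg (u j)
  let ψ := Fintype.linearCombination R (Fin.append (cols f) v)
  have hψ : LinearMap.range ψ = U.comap g :=
    range_linearCombination_append_eq_comap hfg (by simpa only [hv] using hu)
  have hψ1 : ∀ j, ψ (Pi.single j 1) = Fin.append (cols f) v j := fun j => by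
    rw [Fintype.linearCombination_apply_single, one_smul]
  suffices a ∈ LinearMap.range ψ by
    rw [hψ] at this
    exact this
  refine mem_range_of_linForm_mul (δ := d + 1) (by rw [Fintype.card_fin]; omega) (by omega) rfl
    (hExt _ _ (fun p hp => ?_) _) fun s hs => ?_
  · by_contra hlt
    obtain ⟨h, hh⟩ := ENat.ne_top_iff_exists.1 (ne_top_of_lt (not_le.1 hlt))
    have hle : h ≤ d + 1 := by
      rw [← hh, not_le] at hlt
      have : h < d + 1 + 1 := by exact_mod_cast hlt
      omega
    obtain ⟨N, hN⟩ := isReductionOfModule_iff.1 hU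
    obtain ⟨y, hy, hyU⟩ := exists_smul_mem_of_smul_mem_rees b hg hfg hpiv h p.asIdeal p.2 hh.symm
      hle U ⟨N, 1, p.asIdeal.one_notMem, fun z hz => by rwa [one_smul, hN N le_rfl]⟩
    refine hy (p.2.mem_of_pow_mem _ (hp (Ideal.subset_span ⟨y, fun c => ?_, rfl⟩)))
    rw [hψ, Submodule.mem_comap, map_smul]
    exact hyU _
  · rw [Nat.add_sub_cancel] at hs ⊢
    let ρ : Fin m → MvPolynomial (Fin e) (FractionRing R) := fun q => reesLin b (g (Pi.single q 1))
    have h1 := hx _ (aeval_mem_range_reesLin_pow b (g := g) hs)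
    rw [← hu, Submodule.map_span, ← Set.range_comp] at h1
    obtain ⟨y, hy, hxy⟩ := exists_eq_sum_mul_of_mem_span_range_mul h1
    choose s₂ hs₂ hs₂y using fun j => exists_aeval_eq_of_mem_pow b hg (hy j)
    let z := linForm R (Fin m) a * s - ∑ j, linForm R (Fin m) (v j) * s₂ j
    have hz : z ∈ homogeneousSubmodule (Fin m) R (d + 1) :=
      Submodule.sub_mem _ (linForm_mul_mem a hs)
        (Submodule.sum_mem _ fun j _ => linForm_mul_mem _ (hs₂ j))
    have hz0 : aeval ρ z = 0 := by
      simp only [z, ρ, map_sub, map_sum, map_mul, aeval_reesLin_linForm, hs₂y, hv, hxy,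
        Function.comp_apply, sub_self]
    obtain ⟨r, hr, hrz⟩ := exists_smul_mem_symRel b hg hfg hz hz0
    obtain ⟨s₁, hs₁, hzs₁⟩ := exists_eq_sum_of_mem_symRel (mem_symRel_of_smul_mem
      (fun p hp P h hh => hExt p h (fun q hq => hh.trans (Ideal.height_mono hq)) P)
      hpiv le_rfl hz hr hrz)
    refine ⟨Fin.append s₁ s₂, fun j => ?_, ?_⟩
    · refine Fin.addCases (fun j => ?_) (fun j => ?_) j
      · rw [Fin.append_left]
        exact hs₁ j
      · rw [Fin.append_right]
        exact hs₂ j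
    · rw [Fin.sum_univ_add]
      simp only [hψ1, Fin.append_left, Fin.append_right]
      rw [← hzs₁, sub_add_cancel]

end Colon

/-- **Theorem 2.5** (Corso–Polini). Let `R` be a local Gorenstein ring (of positive
dimension) with infinite residue field and let `E` be a finitely generated `R`-module
of projective dimension one and of (positive) rank `e`; write `ℓ = ℓ(E)` for the
analytic spread. Assume that `E` satisfies `G_{ℓ-e+1}` and is torsionfree locally in
codimension one. If the Rees algebra `𝓡(E)` is Cohen--Macaulay, then for any minimal
reduction `U` of `E` one has `U ⬝ 𝓡(E)_t :_E 𝓡(E)_t = U` for all `0 ≤ t ≤ ℓ - e - 1`. -/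
theorem minimal_reduction_colon_of_projdim_one {R : Type u} [CommRing R] [IsLocalRing R]
    [IsNoetherianRing R] [Infinite (ResidueField R)] (hGor : IsGorensteinLocalRing R)
    (hdimR : (0 : WithBot ℕ∞) < ringKrullDim R)
    (E : Type u) [AddCommGroup E] [Module R E] [Module.Finite R E]
    -- `E` has projective dimension exactly one:
    (hpd : ∃ (n m : ℕ) (f : (Fin n → R) →ₗ[R] (Fin m → R)) (g : (Fin m → R) →ₗ[R] E),
      Function.Injective f ∧ Function.Surjective g ∧ LinearMap.range f = LinearMap.ker g)
    (hnotproj : ¬ Module.Projective R E)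
    -- `E` has (positive) rank `e`, witnessed by a trivialization of `E ⊗ Q`:
    (e : ℕ) (he : 0 < e)
    (b : LocalizedModule (nonZeroDivisors R) E ≃ₗ[FractionRing R] (Fin e → FractionRing R))
    -- `ℓ` is the analytic spread of `E`:
    (ℓ : ℕ) (hl : analyticSpreadOfModule e b = ((ℓ : ℕ∞) : WithBot ℕ∞))
    -- `E` satisfies `G_{ℓ-e+1}`, i.e. `μ(E_p) ≤ dim R_p + e - 1` whenever
    -- `1 ≤ dim R_p ≤ ℓ - e`:
    (hGs : ∀ (p : Ideal R) (hp : p.IsPrime), 1 ≤ dimAt p hp →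
      dimAt p hp + (e : WithBot ℕ∞) ≤ (ℓ : WithBot ℕ∞) →
      haveI := hp
      ((mu (Localization.AtPrime p) (LocalizedModule p.primeCompl E) : ℕ∞) : WithBot ℕ∞) + 1 ≤
        dimAt p hp + (e : WithBot ℕ∞))
    -- `E` is torsionfree locally in codimension one:
    (htf : ∀ (p : Ideal R) (hp : p.IsPrime), dimAt p hp ≤ (1 : WithBot ℕ∞) →
      haveI := hp
      Submodule.torsion (Localization.AtPrime p) (LocalizedModule p.primeCompl E) = ⊥)
    -- the Rees algebra `𝓡(E)` is Cohen--Macaulay: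
    (hCM : IsCohenMacaulayRing (reesAlgebraOfModule e b))
    -- `U` is a minimal reduction of `E`:
    (U : Submodule R E) (hU : IsMinimalReductionOfModule e b U)
    (t : ℕ) (ht : t + e + 1 ≤ ℓ) :
    {x : E | ∀ z ∈ reesComponent e b t, reesMap e b x * z ∈
        Submodule.span R (reesMap e b '' (U : Set E)) * reesComponent e b t} =
      (U : Set E) := by
  obtain ⟨n, m, f, g, hf, hg, hfg⟩ := hpd
  obtain ⟨-, rs, hmem, hreg, hdim, -⟩ := hGor
  obtain ⟨d, rfl⟩ : ∃ d, ℓ = d + 1 + e := ⟨ℓ - e - 1, by omega⟩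
  have hm := card_eq_add_of_trivialization b hf hg hfg
  have hpiv := hasPivots_cols hf hg hfg hm hGs
  obtain ⟨u, hu⟩ := hU.exists_span_eq hl
  ext x
  rw [Set.mem_ofPred_eq, SetLike.mem_coe, ← reesLin_apply, span_reesMap_image, reesComponent_eq]
  refine ⟨fun hx => ?_, fun hx z hz =>
    Submodule.mul_mem_mul (Submodule.mem_map_of_mem hx) hz⟩
  refine mem_of_forall_reesLin_mul_mem b (extTorsionLT_of_le_height hmem hreg hdim) hg hfg hm hpiv
    hU.1 hu fun z hz => ?_
  obtain ⟨i, rfl⟩ : ∃ i, d = t + i := ⟨d - t, by omega⟩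
  have h : Submodule.span R {reesLin b x} * LinearMap.range (reesLin b) ^ t ≤
      U.map (reesLin b) * LinearMap.range (reesLin b) ^ t := by
    refine Submodule.mul_le.2 fun y hy w hw => ?_
    obtain ⟨a, rfl⟩ := Submodule.mem_span_singleton.1 hy
    rw [smul_mul_assoc]
    exact Submodule.smul_mem _ _ (hx w hw)
  have h' := mul_le_mul' h (le_refl (LinearMap.range (reesLin b) ^ i))
  rw [mul_assoc, mul_assoc, ← pow_add] at h'
  exact h' (Submodule.mul_mem_mul (Submodule.mem_span_singleton_self _) hz)

end
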